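/- For the Jordan quiver case: if λ and σ are partitions of the same integer l, then the transition coefficient between the canonical (IC) basis element indexed by λ and the Hall-Littlewood basis element indexed by σ equals the Kostka-Foulkes polynomial K_{λσ}(ν); in particular it lies in ℕ[ν] and vanishes unless σ ⪯ λ in dominance order, and K_{λλ}(ν) = 1. -/

import Mathlib

open MvPolynomial

/-- The base ring: polynomials in the Hall–Littlewood parameter `ν` over `ℚ`. -/
abbrev Rnu : Type := Polynomial ℚ

/-- Symmetric polynomials in `l` variables with coefficients in `ℚ[ν]`. -/
abbrev SymA (l : ℕ) : Type := MvPolynomial (Fin l) Rnu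

/-- The decreasing list of parts of a partition, padded with zeros: `partsFn l λ i` is the
`i`-th largest part of `λ` (or `0`). -/
def partsFn (l : ℕ) (lam : Nat.Partition l) (i : Fin l) : ℕ :=
  (lam.parts.sort (· ≥ ·)).getD i 0

/-- Antisymmetrization over the symmetric group: `Σ_w sign(w) · w(P)`. -/
noncomputable def altSum (l : ℕ) (P : SymA l) : SymA l :=
  ∑ w : Equiv.Perm (Fin l), (Equiv.Perm.sign w : ℤ) • rename (⇑w) P

/-- `a_{λ+δ} = Σ_w sign(w) x^{w(λ+δ)}`, the alternant whose quotient by the Vandermonde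
determinant `a_δ` is the Schur polynomial `s_λ`. -/
noncomputable def schurNum (l : ℕ) (lam : Nat.Partition l) : SymA l :=
  altSum l (∏ i : Fin l, X i ^ (partsFn l lam i + (l - 1 - (i : ℕ))))

/-- `Σ_w sign(w) w(x^λ ∏_{i<j} (x_i − ν x_j))`, whose quotient by `v_λ(ν) · a_δ` is the
Hall–Littlewood polynomial `P_λ(x; ν)`. -/
noncomputable def hlNum (l : ℕ) (lam : Nat.Partition l) : SymA l :=
  altSum l ((∏ i : Fin l, X i ^ partsFn l lam i) *
    ∏ p ∈ Finset.univ.filter (fun p : Fin l × Fin l => p.1 < p.2),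
      (X p.1 - C Polynomial.X * X p.2))

/-- The Vandermonde determinant `a_δ = ∏_{i<j} (x_i − x_j)`. -/
noncomputable def vandermonde (l : ℕ) : SymA l :=
  ∏ p ∈ Finset.univ.filter (fun p : Fin l × Fin l => p.1 < p.2), (X p.1 - X p.2)

/-- The normalization factor `v_λ(ν) = ∏_{i ≥ 0} ∏_{j=1}^{m_i(λ)} (1 + ν + ⋯ + ν^{j-1})`,
where `m_i(λ)` is the multiplicity of `i` among the parts of `λ` padded with zeros. -/
noncomputable def vHL (l : ℕ) (lam : Nat.Partition l) : Rnu :=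
  ∏ i ∈ Finset.range (l + 1),
    ∏ j ∈ Finset.range ((Finset.univ.filter fun a : Fin l => partsFn l lam a = i).card),
      ∑ k ∈ Finset.range (j + 1), Polynomial.X ^ k

/-- Dominance order on partitions of `l`: all partial sums of the decreasingly ordered
parts of `σ` are at most those of `λ`. -/
def domLE (l : ℕ) (sig lam : Nat.Partition l) : Prop :=
  ∀ k : ℕ, ((sig.parts.sort (· ≥ ·)).take k).sum ≤ ((lam.parts.sort (· ≥ ·)).take k).sum

/-! ### Energy of column configurations -/

namespace KostkaFoulkes

/-- Columns with letters modulo `n + 1`: periodic nonnegative integer functions. -/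
structure IsCol (n : ℕ) (X : ℕ → ℤ) : Prop where
  per : ∀ s, X (s + (n + 1)) = X s
  nonneg : ∀ s, 0 ≤ X s

/-- The number of boxes of a column. -/
def size (n : ℕ) (X : ℕ → ℤ) : ℤ := ∑ s ∈ Finset.range (n + 1), X s

/-- The partial differences of two columns. -/
def pdiff (X Y : ℕ → ℤ) (b : ℕ) : ℤ := ∑ c ∈ Finset.range b, (Y c - X c)

/-- The height function of a pair of columns. -/
def height (X Y : ℕ → ℤ) (b : ℕ) : ℤ := pdiff X Y b + Y b

/-- The maximum of `f` on the window `[s, s + k]`. -/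
def winMax (f : ℕ → ℤ) (s : ℕ) : ℕ → ℤ
  | 0 => f s
  | k + 1 => max (winMax f s k) (f (s + (k + 1)))

/-- The maximum of the height function on a period starting at `s`. -/
def peak (n : ℕ) (X Y : ℕ → ℤ) (s : ℕ) : ℤ := winMax (height X Y) s n

/-- The left factor of the image of a pair of columns under the combinatorial `R`-matrix. -/
def rLeft (n : ℕ) (X Y : ℕ → ℤ) (s : ℕ) : ℤ := X s + peak n X Y (s + 1) - peak n X Y s

/-- The right factor of the image of a pair of columns under the combinatorial `R`-matrix. -/
def rRight (n : ℕ) (X Y : ℕ → ℤ) (s : ℕ) : ℤ := Y s - peak n X Y (s + 1) + peak n X Y s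

theorem winMax_le_iff (f : ℕ → ℤ) (s k : ℕ) (c : ℤ) :
    winMax f s k ≤ c ↔ ∀ j ≤ k, f (s + j) ≤ c := by
  induction k with
  | zero => simp [winMax]
  | succ k ih =>
    rw [winMax, max_le_iff, ih]
    constructor
    · rintro ⟨h1, h2⟩ j hj
      rcases Nat.lt_or_ge j (k + 1) with h | h
      · exact h1 j (by omega)
      · obtain rfl : j = k + 1 := by omega
        exact h2
    · intro h
      exact ⟨fun j hj => h j (by omega), h _ le_rfl⟩

theorem peak_le_iff {n : ℕ} {X Y : ℕ → ℤ} {s : ℕ} {c : ℤ} :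
    peak n X Y s ≤ c ↔ ∀ j ≤ n, height X Y (s + j) ≤ c := winMax_le_iff _ _ _ _

theorem pdiff_succ (X Y : ℕ → ℤ) (b : ℕ) : pdiff X Y (b + 1) = pdiff X Y b + (Y b - X b) := by
  rw [pdiff, Finset.sum_range_succ, pdiff]

theorem height_succ (X Y : ℕ → ℤ) (b : ℕ) :
    height X Y (b + 1) = height X Y b + Y (b + 1) - X b := by
  simp only [height, pdiff_succ]; ring

theorem pdiff_period (n : ℕ) (X Y : ℕ → ℤ) : pdiff X Y (n + 1) = size n Y - size n X := by
  simp [pdiff, size, Finset.sum_sub_distrib]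

theorem height_add_period {n : ℕ} {X Y : ℕ → ℤ} (hX : IsCol n X) (hY : IsCol n Y) (b : ℕ) :
    height X Y (b + (n + 1)) = height X Y b - (size n X - size n Y) := by
  induction b with
  | zero =>
    have := hY.per 0
    simp only [zero_add] at this ⊢
    rw [height, pdiff_period, this, height]
    simp [pdiff]; ring
  | succ b ih =>
    have h1 := hY.per (b + 1)
    have h2 := hX.per b
    rw [show b + 1 + (n + 1) = (b + (n + 1)) + 1 by ring] at *
    rw [height_succ, ih, h1, h2, height_succ]
    ring

theorem peak_add_period {n : ℕ} {X Y : ℕ → ℤ} (hX : IsCol n X) (hY : IsCol n Y) (s : ℕ) :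
    peak n X Y (s + (n + 1)) = peak n X Y s - (size n X - size n Y) := by
  apply eq_of_forall_ge_iff
  intro c
  rw [sub_le_iff_le_add, peak_le_iff, peak_le_iff]
  refine forall₂_congr fun j _ => ?_
  rw [show s + (n + 1) + j = (s + j) + (n + 1) by ring, height_add_period hX hY]
  omega

theorem peak_eq_max {n : ℕ} {X Y : ℕ → ℤ} (hX : IsCol n X) (hY : IsCol n Y)
    (h : size n Y ≤ size n X) (s : ℕ) :
    peak n X Y s = max (height X Y s) (peak n X Y (s + 1)) := by
  apply eq_of_forall_ge_iff
  intro c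
  rw [max_le_iff, peak_le_iff, peak_le_iff]
  constructor
  · intro hc
    refine ⟨hc 0 (by omega), fun j hj => ?_⟩
    rcases Nat.lt_or_ge j n with hj' | hj'
    · have := hc (j + 1) (by omega)
      rwa [show s + 1 + j = s + (j + 1) by ring]
    · obtain rfl : j = n := by omega
      have := hc 0 (by omega)
      rw [show s + 1 + j = s + (j + 1) by ring, height_add_period hX hY]
      simp only [add_zero] at this
      omega
  · rintro ⟨h0, h1⟩ j hj
    cases j with
    | zero => simpa using h0
    | succ j =>
      have := h1 j (by omega)
      rwa [show s + (j + 1) = s + 1 + j by ring]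

theorem rLeft_isCol {n : ℕ} {X Y : ℕ → ℤ} (hX : IsCol n X) (hY : IsCol n Y) :
    IsCol n (rLeft n X Y) := by
  refine ⟨fun s => ?_, fun s => ?_⟩
  · rw [rLeft, rLeft, show s + (n + 1) + 1 = (s + 1) + (n + 1) by ring, peak_add_period hX hY,
      peak_add_period hX hY, hX.per]
    ring
  · have : peak n X Y s ≤ X s + peak n X Y (s + 1) := by
      rw [peak_le_iff]
      intro j hj
      have h1 := height_succ X Y (s + j)
      have h2 := (peak_le_iff (n := n) (X := X) (Y := Y) (s := s + 1)).1 le_rfl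
      rcases Nat.eq_zero_or_pos j with rfl | hj0
      · have h3 := h2 0 (by omega)
        have h4 := hY.nonneg (s + 0 + 1)
        simp only [add_zero] at *
        omega
      · obtain ⟨j, rfl⟩ : ∃ k, j = k + 1 := ⟨j - 1, by omega⟩
        have h3 := h2 j (by omega)
        rw [show s + 1 + j = s + (j + 1) by ring] at h3
        have := hX.nonneg s
        omega
    rw [rLeft]; omega

theorem rRight_isCol {n : ℕ} {X Y : ℕ → ℤ} (hX : IsCol n X) (hY : IsCol n Y)
    (h : size n Y ≤ size n X) : IsCol n (rRight n X Y) := by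
  refine ⟨fun s => ?_, fun s => ?_⟩
  · rw [rRight, rRight, show s + (n + 1) + 1 = (s + 1) + (n + 1) by ring, peak_add_period hX hY,
      peak_add_period hX hY, hY.per]
    ring
  · have h1 := peak_eq_max hX hY h s
    have h2 := hY.nonneg s
    have := le_max_right (height X Y s) (peak n X Y (s + 1))
    rw [rRight]; omega

theorem size_rLeft {n : ℕ} {X Y : ℕ → ℤ} (hX : IsCol n X) (hY : IsCol n Y) :
    size n (rLeft n X Y) = size n Y := by
  have h := Finset.sum_range_sub (peak n X Y) (n + 1)
  have h2 := peak_add_period hX hY 0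
  rw [zero_add] at h2
  simp only [size, rLeft, add_sub_assoc, Finset.sum_add_distrib] at *
  rw [h, h2]; ring

theorem size_rRight {n : ℕ} {X Y : ℕ → ℤ} (hX : IsCol n X) (hY : IsCol n Y) :
    size n (rRight n X Y) = size n X := by
  have h := size_rLeft hX hY
  have : size n (rRight n X Y) + size n (rLeft n X Y) = size n X + size n Y := by
    simp only [size, ← Finset.sum_add_distrib]
    refine Finset.sum_congr rfl fun s _ => ?_
    rw [rLeft, rRight]; ring
  omega

theorem peak_zero_nonneg {n : ℕ} {X Y : ℕ → ℤ} (hY : IsCol n Y) : 0 ≤ peak n X Y 0 := by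
  have h := (peak_le_iff (n := n) (X := X) (Y := Y) (s := 0)).1 le_rfl 0 (by omega)
  have := hY.nonneg 0
  simp [height, pdiff] at h
  omega

/-- Apply the `R`-matrix to `X` and the head of a configuration. -/
def swapHead (n : ℕ) (X : ℕ → ℤ) : List (ℕ → ℤ) → List (ℕ → ℤ)
  | [] => []
  | Y :: r => rLeft n X Y :: rRight n X Y :: r

/-- The local energy of `X` and the head of a configuration. -/
def headEnergy (n : ℕ) (X : ℕ → ℤ) : List (ℕ → ℤ) → ℤ
  | [] => 0
  | Y :: _ => peak n X Y 0

/-- The configurations obtained by pulling each column to the front. -/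
def pulls (n : ℕ) : List (ℕ → ℤ) → List (List (ℕ → ℤ))
  | [] => []
  | X :: L => (X :: L) :: (pulls n L).map (swapHead n X)

/-- The energy of a configuration. -/
def energy (n : ℕ) : List (ℕ → ℤ) → ℤ
  | [] => 0
  | X :: L => energy n L + ((pulls n L).map (headEnergy n X)).sum

/-- All entries are columns of size at most `m`. -/
def Bounded (n : ℕ) (m : ℤ) (L : List (ℕ → ℤ)) : Prop := ∀ X ∈ L, IsCol n X ∧ size n X ≤ m

/-- A configuration of columns with weakly decreasing sizes. -/
def Config (n : ℕ) (L : List (ℕ → ℤ)) : Prop :=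
  (∀ X ∈ L, IsCol n X) ∧ L.Pairwise (fun X Y => size n Y ≤ size n X)

theorem config_cons {n : ℕ} {X : ℕ → ℤ} {L : List (ℕ → ℤ)} :
    Config n (X :: L) ↔ IsCol n X ∧ Bounded n (size n X) L ∧ Config n L := by
  simp only [Config, Bounded, List.mem_cons, forall_eq_or_imp, List.pairwise_cons]
  constructor
  · rintro ⟨⟨h1, h2⟩, h3, h4⟩
    exact ⟨h1, fun Z hZ => ⟨h2 Z hZ, h3 Z hZ⟩, h2, h4⟩
  · rintro ⟨h1, h2, h3, h4⟩
    exact ⟨⟨h1, h3⟩, fun Z hZ => (h2 Z hZ).2, h4⟩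

theorem pulls_bounded {n : ℕ} {L : List (ℕ → ℤ)} (hL : Config n L) {m : ℤ}
    (hb : Bounded n m L) : ∀ M ∈ pulls n L, M ≠ [] ∧ Bounded n m M := by
  induction L generalizing m with
  | nil => simp [pulls]
  | cons X L ih =>
    rw [config_cons] at hL
    obtain ⟨hX, hbL, hL⟩ := hL
    intro M hM
    rw [pulls, List.mem_cons, List.mem_map] at hM
    rcases hM with rfl | ⟨M, hM, rfl⟩
    · exact ⟨by simp, hb⟩
    · obtain ⟨h0, h1⟩ := ih hL hbL M hM
      have hXm : size n X ≤ m := (hb X (by simp)).2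
      cases M with
      | nil => exact absurd rfl h0
      | cons Y r =>
        obtain ⟨hY, hYX⟩ := h1 Y (by simp)
        refine ⟨by simp [swapHead], ?_⟩
        intro Z hZ
        simp only [swapHead, List.mem_cons] at hZ
        rcases hZ with rfl | rfl | hZ
        · exact ⟨rLeft_isCol hX hY, by rw [size_rLeft hX hY]; omega⟩
        · exact ⟨rRight_isCol hX hY hYX, by rw [size_rRight hX hY]; omega⟩
        · obtain ⟨h3, h4⟩ := h1 Z (by simp [hZ])
          exact ⟨h3, by omega⟩

theorem energy_nonneg {n : ℕ} {L : List (ℕ → ℤ)} (hL : Config n L) : 0 ≤ energy n L := by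
  induction L with
  | nil => simp [energy]
  | cons X L ih =>
    rw [config_cons] at hL
    obtain ⟨hX, hbL, hL⟩ := hL
    refine add_nonneg (ih hL) (List.sum_nonneg ?_)
    intro z hz
    rw [List.mem_map] at hz
    obtain ⟨M, hM, rfl⟩ := hz
    obtain ⟨h0, h1⟩ := pulls_bounded hL hbL M hM
    cases M with
    | nil => exact absurd rfl h0
    | cons Y r => exact peak_zero_nonneg (h1 Y (by simp)).1

/-! #### Rotation -/

/-- Cyclic rotation of the letters of a column. -/
def rot (X : ℕ → ℤ) (s : ℕ) : ℤ := X (s + 1)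

theorem rot_isCol {n : ℕ} {X : ℕ → ℤ} (hX : IsCol n X) : IsCol n (rot X) :=
  ⟨fun s => by rw [rot, rot, ← hX.per (s + 1)]; congr 1; ring, fun s => hX.nonneg _⟩

theorem size_rot {n : ℕ} {X : ℕ → ℤ} (hX : IsCol n X) : size n (rot X) = size n X := by
  have h1 := Finset.sum_range_succ X (n + 1)
  have h2 := Finset.sum_range_succ' X (n + 1)
  have h3 := hX.per 0
  rw [zero_add] at h3
  simp only [size, rot]
  omega

theorem height_rot (X Y : ℕ → ℤ) (b : ℕ) :
    height (rot X) (rot Y) b = height X Y (b + 1) - (Y 0 - X 0) := by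
  simp only [height, pdiff, rot]
  rw [Finset.sum_range_succ' (fun c => Y c - X c)]
  ring

theorem peak_rot (n : ℕ) (X Y : ℕ → ℤ) (s : ℕ) :
    peak n (rot X) (rot Y) s = peak n X Y (s + 1) - (Y 0 - X 0) := by
  apply eq_of_forall_ge_iff
  intro c
  rw [sub_le_iff_le_add, peak_le_iff, peak_le_iff]
  refine forall₂_congr fun j _ => ?_
  rw [height_rot, show s + 1 + j = s + j + 1 by ring]
  omega

theorem swapHead_map_rot (n : ℕ) (X : ℕ → ℤ) (M : List (ℕ → ℤ)) :
    swapHead n (rot X) (M.map rot) = (swapHead n X M).map rot := by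
  cases M with
  | nil => rfl
  | cons Y r =>
    simp only [swapHead, List.map_cons, List.cons.injEq, and_true]
    constructor <;> funext s <;> simp only [rLeft, rRight, peak_rot, rot] <;> ring

theorem pulls_map_rot (n : ℕ) (L : List (ℕ → ℤ)) :
    pulls n (L.map rot) = (pulls n L).map (List.map rot) := by
  induction L with
  | nil => rfl
  | cons X L ih =>
    simp only [pulls, List.map_cons, ih, List.map_map]
    congr 1
    exact List.map_congr_left fun M _ => swapHead_map_rot n X M

/-- The number of occurrences of the letter `s` in the head of a configuration. -/
def headCount (s : ℕ) : List (ℕ → ℤ) → ℤ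
  | [] => 0
  | Y :: _ => Y s

theorem headEnergy_rot (n : ℕ) (X : ℕ → ℤ) (M : List (ℕ → ℤ)) :
    headEnergy n (rot X) (M.map rot) =
      headEnergy n X M + (headCount 0 (swapHead n X M) - headCount 0 M) := by
  cases M with
  | nil => rfl
  | cons Y r =>
    simp only [headEnergy, List.map_cons, peak_rot, swapHead, headCount, rLeft]
    ring

/-- The number of occurrences of the letter `s` in a configuration. -/
def count (s : ℕ) (L : List (ℕ → ℤ)) : ℤ := (L.map (fun X => X s)).sum

theorem energy_map_rot (n : ℕ) (L : List (ℕ → ℤ)) :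
    energy n (L.map rot) + count 0 L = energy n L + ((pulls n L).map (headCount 0)).sum := by
  induction L with
  | nil => simp [energy, pulls, count]
  | cons X L ih =>
    have h : ((pulls n (L.map rot)).map (headEnergy n (rot X))).sum
        + ((pulls n L).map (headCount 0)).sum =
        ((pulls n L).map (headEnergy n X)).sum +
          ((pulls n L).map (fun M => headCount 0 (swapHead n X M))).sum := by
      rw [pulls_map_rot, List.map_map, ← List.sum_map_add, ← List.sum_map_add]
      congr 1
      refine List.map_congr_left fun M _ => ?_
      simp only [Function.comp, headEnergy_rot]
      ring
    simp only [energy, List.map_cons, pulls, count, List.sum_cons, List.map_map] at *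
    simp only [Function.comp_def] at *
    simp only [headCount] at *
    linarith

/-- The column with `m` letters `0`. -/
def zeroCol (n : ℕ) (m : ℤ) (s : ℕ) : ℤ := if s % (n + 1) = 0 then m else 0

theorem zeroCol_isCol (n : ℕ) {m : ℤ} (hm : 0 ≤ m) : IsCol n (zeroCol n m) :=
  ⟨fun s => by simp [zeroCol], fun s => by unfold zeroCol; split_ifs <;> omega⟩

theorem size_zeroCol (n : ℕ) (m : ℤ) : size n (zeroCol n m) = m := by
  rw [size, Finset.sum_range_succ', Finset.sum_eq_zero]
  · simp [zeroCol]
  · intro s hs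
    have : s + 1 < n + 1 := by simpa using hs
    simp [zeroCol, Nat.mod_eq_of_lt this]

theorem peak_zeroCol {n : ℕ} {m : ℤ} {Y : ℕ → ℤ} (hY : IsCol n Y) (h : size n Y ≤ m) :
    peak n (zeroCol n m) Y 0 = Y 0 := by
  apply eq_of_forall_ge_iff
  intro c
  rw [peak_le_iff]
  have key : ∀ j, j ≤ n → j ≠ 0 → height (zeroCol n m) Y (0 + j) ≤ 0 := by
    intro j hj hj0
    obtain ⟨k, rfl⟩ : ∃ k, j = k + 1 := ⟨j - 1, by omega⟩
    have h1 : height (zeroCol n m) Y (0 + (k + 1)) =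
        ∑ s ∈ Finset.range (k + 1 + 1), Y s - m := by
      rw [zero_add, height, pdiff, Finset.sum_sub_distrib, Finset.sum_range_succ Y (k + 1),
        Finset.sum_range_succ' (zeroCol n m), Finset.sum_eq_zero (s := Finset.range k)]
      · simp [zeroCol]; ring
      · intro s hs
        have : s < k := by simpa using hs
        have : s + 1 < n + 1 := by omega
        simp [zeroCol, Nat.mod_eq_of_lt this]
    have h2 : ∑ s ∈ Finset.range (k + 1 + 1), Y s ≤ size n Y :=
      Finset.sum_le_sum_of_subset_of_nonneg (Finset.range_subset_range.2 (by omega))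
        fun s _ _ => hY.nonneg s
    omega
  have h0 := hY.nonneg 0
  have h00 : height (zeroCol n m) Y 0 = Y 0 := by simp [height, pdiff]
  constructor
  · intro hc
    have := hc 0 (by omega)
    simpa [h00] using this
  · intro hc j hj
    rcases Nat.eq_zero_or_pos j with rfl | hj0
    · simpa [h00] using hc
    · have := key j hj (by omega)
      omega

theorem energy_zeroCol_cons {n : ℕ} {m : ℤ} {L : List (ℕ → ℤ)} (hL : Config n L)
    (hb : Bounded n m L) :
    energy n (zeroCol n m :: L) = energy n (L.map rot) + count 0 L := by
  rw [energy_map_rot, energy]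
  congr 2
  refine List.map_congr_left fun M hM => ?_
  obtain ⟨h0, h1⟩ := pulls_bounded hL hb M hM
  cases M with
  | nil => exact absurd rfl h0
  | cons Y r =>
    obtain ⟨h2, h3⟩ := h1 Y (by simp)
    exact peak_zeroCol h2 h3

end KostkaFoulkes

/-! ### Crystal operators -/

namespace KostkaFoulkes

/-- Replace a letter `i + 1` by a letter `i`. -/
def addUnit (n i : ℕ) (X : ℕ → ℤ) (s : ℕ) : ℤ :=
  X s + (if s % (n + 1) = i then 1 else 0) - (if s % (n + 1) = i + 1 then 1 else 0)

/-- The number of unmatched letters `i + 1` in a configuration. -/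
def eps (i : ℕ) : List (ℕ → ℤ) → ℤ
  | [] => 0
  | X :: L => X (i + 1) + max 0 (eps i L - X i)

/-- The raising operator for the letter `i`. -/
def raise (n i : ℕ) : List (ℕ → ℤ) → List (ℕ → ℤ)
  | [] => []
  | X :: L => if X i < eps i L then X :: raise n i L else addUnit n i X :: L

theorem succ_mod_eq_iff {n i : ℕ} (hi : i < n) (b : ℕ) :
    (b + 1) % (n + 1) = i + 1 ↔ b % (n + 1) = i := by
  have h : b % (n + 1) < n + 1 := Nat.mod_lt b (Nat.succ_pos n)
  rw [Nat.add_mod]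
  rcases Nat.lt_or_ge (b % (n + 1)) n with h1 | h1
  · rw [Nat.mod_eq_of_lt (a := 1) (by omega), Nat.mod_eq_of_lt (by omega)]
    omega
  · have h2 : b % (n + 1) = n := by omega
    rw [h2, Nat.mod_eq_of_lt (a := 1) (by omega), Nat.mod_self]
    omega

theorem addUnit_isCol {n i : ℕ} (_hi : i < n) {X : ℕ → ℤ} (hX : IsCol n X) (h : 0 < X (i + 1)) :
    IsCol n (addUnit n i X) := by
  refine ⟨fun s => by simp [addUnit, hX.per], fun s => ?_⟩
  have hs : X s = X (s % (n + 1)) := by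
    have : Function.Periodic X (n + 1) := hX.per
    exact (this.map_mod_nat s).symm
  have h0 := hX.nonneg s
  unfold addUnit
  split_ifs with h1 h2 h2
  · omega
  · omega
  · rw [h2] at hs; omega
  · omega

theorem addUnit_left {n i : ℕ} (hi : i < n) (X : ℕ → ℤ) : addUnit n i X i = X i + 1 := by
  simp [addUnit, Nat.mod_eq_of_lt (show i < n + 1 by omega)]

theorem addUnit_right {n i : ℕ} (hi : i < n) (X : ℕ → ℤ) :
    addUnit n i X (i + 1) = X (i + 1) - 1 := by
  simp [addUnit, Nat.mod_eq_of_lt (show i + 1 < n + 1 by omega)]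

theorem addUnit_of_ne {n i s : ℕ} (hs : s < n + 1) (h1 : s ≠ i) (h2 : s ≠ i + 1) (X : ℕ → ℤ) :
    addUnit n i X s = X s := by
  simp [addUnit, Nat.mod_eq_of_lt hs, h1, h2]

theorem size_addUnit {n i : ℕ} (hi : i < n) (X : ℕ → ℤ) : size n (addUnit n i X) = size n X := by
  have h : ∀ s ∈ Finset.range (n + 1), addUnit n i X s =
      X s + (if s = i then 1 else 0) - (if s = i + 1 then 1 else 0) := by
    intro s hs
    rw [Finset.mem_range] at hs
    simp [addUnit, Nat.mod_eq_of_lt hs]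
  rw [size, Finset.sum_congr rfl h, Finset.sum_sub_distrib, Finset.sum_add_distrib]
  simp [size, hi, show i < n + 1 by omega]

theorem pdiff_addUnit_left {n i : ℕ} (hi : i < n) (X Y : ℕ → ℤ) (b : ℕ) :
    pdiff (addUnit n i X) Y b = pdiff X Y b - (if b % (n + 1) = i + 1 then 1 else 0) := by
  induction b with
  | zero => simp [pdiff]
  | succ b ih =>
    rw [pdiff_succ, ih, pdiff_succ, addUnit]
    simp only [succ_mod_eq_iff hi]
    ring

theorem pdiff_addUnit_right {n i : ℕ} (hi : i < n) (X Y : ℕ → ℤ) (b : ℕ) :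
    pdiff X (addUnit n i Y) b = pdiff X Y b + (if b % (n + 1) = i + 1 then 1 else 0) := by
  induction b with
  | zero => simp [pdiff]
  | succ b ih =>
    rw [pdiff_succ, ih, pdiff_succ, addUnit]
    simp only [succ_mod_eq_iff hi]
    ring

theorem height_addUnit_left {n i : ℕ} (hi : i < n) (X Y : ℕ → ℤ) (b : ℕ) :
    height (addUnit n i X) Y b = height X Y b - (if b % (n + 1) = i + 1 then 1 else 0) := by
  rw [height, pdiff_addUnit_left hi, height]; ring

theorem height_addUnit_right {n i : ℕ} (hi : i < n) (X Y : ℕ → ℤ) (b : ℕ) :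
    height X (addUnit n i Y) b = height X Y b + (if b % (n + 1) = i then 1 else 0) := by
  rw [height, pdiff_addUnit_right hi, height, addUnit]; ring

theorem apply_of_mod {n : ℕ} {X : ℕ → ℤ} (hX : IsCol n X) (s : ℕ) : X s = X (s % (n + 1)) := by
  have : Function.Periodic X (n + 1) := hX.per
  exact (this.map_mod_nat s).symm

theorem apply_succ_of_mod {n : ℕ} {X : ℕ → ℤ} (hX : IsCol n X) {s i : ℕ}
    (h : s % (n + 1) = i) : X (s + 1) = X (i + 1) := by
  rw [apply_of_mod hX (s + 1), apply_of_mod hX (i + 1), ← h, Nat.mod_add_mod]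

theorem peak_addUnit_left {n i : ℕ} (hi : i < n) {X Y : ℕ → ℤ} (hX : IsCol n X) (hY : IsCol n Y)
    (h : Y (i + 1) ≤ X i) {s : ℕ} (hs : s % (n + 1) ≠ i + 1) :
    peak n (addUnit n i X) Y s = peak n X Y s := by
  apply eq_of_forall_ge_iff
  intro c
  simp only [peak_le_iff, height_addUnit_left hi]
  constructor
  · intro hc j hj
    have hcj := hc j hj
    by_cases hm : (s + j) % (n + 1) = i + 1
    · obtain ⟨k, rfl⟩ : ∃ k, j = k + 1 := by
        refine ⟨j - 1, ?_⟩
        have : j ≠ 0 := by rintro rfl; exact hs hm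
        omega
      rw [← add_assoc] at hm ⊢
      rw [succ_mod_eq_iff hi] at hm
      have hk := hc k (by omega)
      rw [if_neg (by omega)] at hk
      have h1 := height_succ X Y (s + k)
      rw [apply_succ_of_mod hY hm, apply_of_mod hX, hm] at h1
      omega
    · simpa [hm] using hcj
  · intro hc j hj
    have := hc j hj
    split_ifs <;> omega

theorem peak_addUnit_right {n i : ℕ} (hi : i < n) {X Y : ℕ → ℤ} (hX : IsCol n X)
    (hY : IsCol n Y) (h : X i < Y (i + 1)) {s : ℕ} (hs : s % (n + 1) ≠ i + 1) :
    peak n X (addUnit n i Y) s = peak n X Y s := by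
  apply eq_of_forall_ge_iff
  intro c
  simp only [peak_le_iff, height_addUnit_right hi]
  constructor
  · intro hc j hj
    have := hc j hj
    split_ifs at this <;> omega
  · intro hc j hj
    have hcj := hc j hj
    by_cases hm : (s + j) % (n + 1) = i
    · have hj' : j ≠ n := by
        rintro rfl
        apply hs
        have h3 := (succ_mod_eq_iff hi (s + j)).2 hm
        rwa [add_assoc, Nat.add_mod_right] at h3
      have hk := hc (j + 1) (by omega)
      have h1 := height_succ X Y (s + j)
      rw [← add_assoc] at hk
      rw [apply_succ_of_mod hY hm, apply_of_mod hX, hm] at h1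
      simp only [hm, if_true]
      omega
    · simpa [hm] using hcj

theorem IsCol.ext {n : ℕ} {X Y : ℕ → ℤ} (hX : IsCol n X) (hY : IsCol n Y)
    (h : ∀ s < n + 1, X s = Y s) : X = Y := by
  funext s
  rw [apply_of_mod hX, apply_of_mod hY]
  exact h _ (Nat.mod_lt _ (Nat.succ_pos n))

theorem eps_nonneg {n : ℕ} (i : ℕ) {L : List (ℕ → ℤ)} (hL : ∀ X ∈ L, IsCol n X) :
    0 ≤ eps i L := by
  cases L with
  | nil => simp [eps]
  | cons X L =>
    have := (hL X (by simp)).nonneg (i + 1)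
    rw [eps]; omega

/-- The local relations between the peaks around the letter `i`. -/
theorem peak_local {n : ℕ} (i : ℕ) {X Y : ℕ → ℤ} (hX : IsCol n X) (hY : IsCol n Y)
    (h : size n Y ≤ size n X) :
    peak n X Y i = max (height X Y i) (peak n X Y (i + 1)) ∧
    peak n X Y (i + 1) = max (height X Y (i + 1)) (peak n X Y (i + 1 + 1)) ∧
    height X Y (i + 1) = height X Y i + Y (i + 1) - X i :=
  ⟨peak_eq_max hX hY h i, peak_eq_max hX hY h (i + 1), height_succ X Y i⟩

theorem eps_swapHead {n : ℕ} (i : ℕ) {X Y : ℕ → ℤ} (hX : IsCol n X) (hY : IsCol n Y)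
    (h : size n Y ≤ size n X) {r : List (ℕ → ℤ)} (_hr : 0 ≤ eps i r) :
    eps i (swapHead n X (Y :: r)) = eps i (X :: Y :: r) := by
  obtain ⟨h1, h2, h3⟩ := peak_local i hX hY h
  simp only [swapHead, eps, rLeft, rRight]
  omega

theorem add_two_mod_ne {n i : ℕ} (hi : i < n) : (i + 1 + 1) % (n + 1) ≠ i + 1 := by
  rw [Ne, succ_mod_eq_iff hi, Nat.mod_eq_of_lt (by omega)]
  omega

theorem raise_swapHead_left {n i : ℕ} (hi : i < n) {X Y : ℕ → ℤ} (hX : IsCol n X)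
    (hY : IsCol n Y) (h : size n Y ≤ size n X) {r : List (ℕ → ℤ)} (hr : 0 ≤ eps i r)
    (hX1 : 0 < X (i + 1)) (hact : eps i (Y :: r) ≤ X i) :
    swapHead n (addUnit n i X) (Y :: r) = raise n i (swapHead n X (Y :: r)) ∧
      headEnergy n (addUnit n i X) (Y :: r) = headEnergy n X (Y :: r) := by
  have hX' := addUnit_isCol hi hX hX1
  have h' : size n Y ≤ size n (addUnit n i X) := by rwa [size_addUnit hi]
  have hq : Y (i + 1) ≤ X i := by rw [eps] at hact; omega
  have hp : ∀ s, s % (n + 1) ≠ i + 1 → peak n (addUnit n i X) Y s = peak n X Y s :=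
    fun s hs => peak_addUnit_left hi hX hY hq hs
  refine ⟨?_, hp 0 (by simp)⟩
  obtain ⟨h1, h2, h3⟩ := peak_local i hX hY h
  obtain ⟨h1', h2', h3'⟩ := peak_local i hX' hY h'
  have hg2 := hp (i + 1 + 1) (add_two_mod_ne hi)
  have hg0 := hp i (by rw [Nat.mod_eq_of_lt (by omega)]; omega)
  have hθ : height (addUnit n i X) Y i = height X Y i := by
    rw [height_addUnit_left hi, Nat.mod_eq_of_lt (by omega), if_neg (by omega), sub_zero]
  have hLo : ∀ s < n + 1, s ≠ i → s ≠ i + 1 →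
      peak n (addUnit n i X) Y s = peak n X Y s ∧
      peak n (addUnit n i X) Y (s + 1) = peak n X Y (s + 1) := by
    intro s hs hs1 hs2
    refine ⟨hp s (by rwa [Nat.mod_eq_of_lt hs]), hp (s + 1) ?_⟩
    rwa [Ne, succ_mod_eq_iff hi, Nat.mod_eq_of_lt hs]
  have hl := addUnit_left hi X
  have hr' := addUnit_right hi X
  have c1 := rLeft_isCol hX hY
  have c2 := rRight_isCol hX hY h
  have c1' := rLeft_isCol hX' hY
  have c2' := rRight_isCol hX' hY h'
  simp only [eps] at hact
  have n1 := c1.nonneg (i + 1)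
  have n2 := c2.nonneg (i + 1)
  have n3 := c1.nonneg i
  simp only [rLeft, rRight] at n1 n2 n3
  simp only [swapHead, raise]
  by_cases a1 : rLeft n X Y i < eps i (rRight n X Y :: r)
  · have a2 : ¬ rRight n X Y i < eps i r := by
      simp only [eps, rLeft, rRight] at a1 ⊢; omega
    rw [if_pos a1, if_neg a2]
    simp only [eps, rLeft, rRight] at a1 a2
    simp only [List.cons.injEq, and_true]
    have hpos : 0 < rRight n X Y (i + 1) := by
      simp only [rRight]; omega
    refine ⟨c1'.ext c1 fun s hs => ?_, c2'.ext (addUnit_isCol hi c2 hpos) fun s hs => ?_⟩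
    · by_cases e1 : s = i
      · subst e1; simp only [rLeft]; omega
      by_cases e2 : s = i + 1
      · subst e2; simp only [rLeft]; omega
      · obtain ⟨e3, e4⟩ := hLo s hs e1 e2
        simp only [rLeft, e3, e4, addUnit_of_ne hs e1 e2]
    · by_cases e1 : s = i
      · subst e1; rw [addUnit_left hi]; simp only [rRight]; omega
      by_cases e2 : s = i + 1
      · subst e2; rw [addUnit_right hi]; simp only [rRight]; omega
      · obtain ⟨e3, e4⟩ := hLo s hs e1 e2
        rw [addUnit_of_ne hs e1 e2]
        simp only [rRight, e3, e4]
  · rw [if_neg a1]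
    simp only [eps, rLeft, rRight] at a1
    simp only [List.cons.injEq, and_true]
    have hpos : 0 < rLeft n X Y (i + 1) := by
      simp only [rLeft]; omega
    refine ⟨c1'.ext (addUnit_isCol hi c1 hpos) fun s hs => ?_, c2'.ext c2 fun s hs => ?_⟩
    · by_cases e1 : s = i
      · subst e1; rw [addUnit_left hi]; simp only [rLeft]; omega
      by_cases e2 : s = i + 1
      · subst e2; rw [addUnit_right hi]; simp only [rLeft]; omega
      · obtain ⟨e3, e4⟩ := hLo s hs e1 e2
        rw [addUnit_of_ne hs e1 e2]
        simp only [rLeft, e3, e4, addUnit_of_ne hs e1 e2]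
    · by_cases e1 : s = i
      · subst e1; simp only [rRight]; omega
      by_cases e2 : s = i + 1
      · subst e2; simp only [rRight]; omega
      · obtain ⟨e3, e4⟩ := hLo s hs e1 e2
        simp only [rRight, e3, e4]

theorem raise_swapHead_right {n i : ℕ} (hi : i < n) {X Y : ℕ → ℤ} (hX : IsCol n X)
    (hY : IsCol n Y) (h : size n Y ≤ size n X) {r : List (ℕ → ℤ)} (hr : 0 ≤ eps i r)
    (hact : X i < eps i (Y :: r)) :
    swapHead n X (raise n i (Y :: r)) = raise n i (swapHead n X (Y :: r)) ∧
      headEnergy n X (raise n i (Y :: r)) = headEnergy n X (Y :: r) := by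
  obtain ⟨h1, h2, h3⟩ := peak_local i hX hY h
  have hX0 := hX.nonneg i
  by_cases hz : Y i < eps i r
  · rw [raise, if_pos hz]
    refine ⟨?_, rfl⟩
    have a2 : rRight n X Y i < eps i r := by
      simp only [eps] at hact
      simp only [rRight]; omega
    have a1 : rLeft n X Y i < eps i (rRight n X Y :: r) := by
      simp only [eps] at hact ⊢
      simp only [rRight, rLeft] at a2 ⊢; omega
    simp only [swapHead, raise, if_pos a1, if_pos a2]
  rw [raise, if_neg hz]
  have hq : X i < Y (i + 1) := by rw [eps] at hact; omega
  have hY' := addUnit_isCol hi hY (by omega)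
  have h' : size n (addUnit n i Y) ≤ size n X := by rwa [size_addUnit hi]
  have hp : ∀ s, s % (n + 1) ≠ i + 1 → peak n X (addUnit n i Y) s = peak n X Y s :=
    fun s hs => peak_addUnit_right hi hX hY hq hs
  refine ⟨?_, hp 0 (by simp)⟩
  obtain ⟨h1', h2', h3'⟩ := peak_local i hX hY' h'
  have hg2 := hp (i + 1 + 1) (add_two_mod_ne hi)
  have hg0 := hp i (by rw [Nat.mod_eq_of_lt (by omega)]; omega)
  have hθ : height X (addUnit n i Y) i = height X Y i + 1 := by
    rw [height_addUnit_right hi, Nat.mod_eq_of_lt (by omega), if_pos rfl]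
  have hLo : ∀ s < n + 1, s ≠ i → s ≠ i + 1 →
      peak n X (addUnit n i Y) s = peak n X Y s ∧
      peak n X (addUnit n i Y) (s + 1) = peak n X Y (s + 1) := by
    intro s hs hs1 hs2
    refine ⟨hp s (by rwa [Nat.mod_eq_of_lt hs]), hp (s + 1) ?_⟩
    rwa [Ne, succ_mod_eq_iff hi, Nat.mod_eq_of_lt hs]
  have hl := addUnit_left hi Y
  have hr' := addUnit_right hi Y
  have c1 := rLeft_isCol hX hY
  have c2 := rRight_isCol hX hY h
  have c1' := rLeft_isCol hX hY'
  have c2' := rRight_isCol hX hY' h'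
  have n1 := c1.nonneg (i + 1)
  have n2 := c2.nonneg (i + 1)
  have n3 := c1.nonneg i
  simp only [rLeft, rRight] at n1 n2 n3
  simp only [eps] at hact
  simp only [swapHead, raise]
  by_cases a1 : rLeft n X Y i < eps i (rRight n X Y :: r)
  · have a2 : ¬ rRight n X Y i < eps i r := by
      simp only [eps, rLeft, rRight] at a1 ⊢; omega
    rw [if_pos a1, if_neg a2]
    simp only [eps, rLeft, rRight] at a1 a2
    simp only [List.cons.injEq, and_true]
    have hpos : 0 < rRight n X Y (i + 1) := by
      simp only [rRight]; omega
    refine ⟨c1'.ext c1 fun s hs => ?_, c2'.ext (addUnit_isCol hi c2 hpos) fun s hs => ?_⟩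
    · by_cases e1 : s = i
      · subst e1; simp only [rLeft]; omega
      by_cases e2 : s = i + 1
      · subst e2; simp only [rLeft]; omega
      · obtain ⟨e3, e4⟩ := hLo s hs e1 e2
        simp only [rLeft, e3, e4]
    · by_cases e1 : s = i
      · subst e1; rw [addUnit_left hi]; simp only [rRight]; omega
      by_cases e2 : s = i + 1
      · subst e2; rw [addUnit_right hi]; simp only [rRight]; omega
      · obtain ⟨e3, e4⟩ := hLo s hs e1 e2
        rw [addUnit_of_ne hs e1 e2]
        simp only [rRight, e3, e4, addUnit_of_ne hs e1 e2]
  · rw [if_neg a1]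
    simp only [eps, rLeft, rRight] at a1
    simp only [List.cons.injEq, and_true]
    have hpos : 0 < rLeft n X Y (i + 1) := by
      simp only [rLeft]; omega
    refine ⟨c1'.ext (addUnit_isCol hi c1 hpos) fun s hs => ?_, c2'.ext c2 fun s hs => ?_⟩
    · by_cases e1 : s = i
      · subst e1; rw [addUnit_left hi]; simp only [rLeft]; omega
      by_cases e2 : s = i + 1
      · subst e2; rw [addUnit_right hi]; simp only [rLeft]; omega
      · obtain ⟨e3, e4⟩ := hLo s hs e1 e2
        rw [addUnit_of_ne hs e1 e2]
        simp only [rLeft, e3, e4]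
    · by_cases e1 : s = i
      · subst e1; simp only [rRight]; omega
      by_cases e2 : s = i + 1
      · subst e2; simp only [rRight]; omega
      · obtain ⟨e3, e4⟩ := hLo s hs e1 e2
        simp only [rRight, e3, e4, addUnit_of_ne hs e1 e2]

theorem eps_of_mem_pulls {n i : ℕ} {L : List (ℕ → ℤ)} (hL : Config n L) :
    ∀ M ∈ pulls n L, eps i M = eps i L := by
  induction L with
  | nil => simp [pulls]
  | cons X L ih =>
    rw [config_cons] at hL
    obtain ⟨hX, hbL, hL⟩ := hL
    intro M hM
    rw [pulls, List.mem_cons, List.mem_map] at hM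
    rcases hM with rfl | ⟨M, hM, rfl⟩
    · rfl
    · obtain ⟨h0, h1⟩ := pulls_bounded hL hbL M hM
      cases M with
      | nil => exact absurd rfl h0
      | cons Y r =>
        obtain ⟨hY, hYX⟩ := h1 Y (by simp)
        rw [eps_swapHead i hX hY hYX (eps_nonneg (n := n) i fun Z hZ => (h1 Z (by simp [hZ])).1),
          eps, ih hL _ hM, eps]

theorem pulls_raise {n i : ℕ} (hi : i < n) {L : List (ℕ → ℤ)} (hL : Config n L)
    (he : 0 < eps i L) :
    pulls n (raise n i L) = (pulls n L).map (raise n i) ∧ energy n (raise n i L) = energy n L := by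
  induction L with
  | nil => simp [eps] at he
  | cons X L ih =>
    rw [config_cons] at hL
    obtain ⟨hX, hbL, hL⟩ := hL
    have hX0 := hX.nonneg i
    have hpull : ∀ M ∈ pulls n L, ∃ Y r, M = Y :: r ∧ IsCol n Y ∧ size n Y ≤ size n X ∧
        0 ≤ eps i r ∧ eps i (Y :: r) = eps i L := by
      intro M hM
      obtain ⟨h0, h1⟩ := pulls_bounded hL hbL M hM
      have h2 := eps_of_mem_pulls (i := i) hL M hM
      cases M with
      | nil => exact absurd rfl h0
      | cons Y r =>
        obtain ⟨hY, hYX⟩ := h1 Y (by simp)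
        exact ⟨Y, r, rfl, hY, hYX,
          eps_nonneg (n := n) i fun Z hZ => (h1 Z (by simp [hZ])).1, h2⟩
    by_cases hact : X i < eps i L
    · obtain ⟨ih1, ih2⟩ := ih hL (by omega)
      simp only [raise, if_pos hact, pulls, energy, List.map_cons, ih1, ih2, List.map_map]
      constructor
      · congr 1
        refine List.map_congr_left fun M hM => ?_
        obtain ⟨Y, r, rfl, hY, hYX, hr, hE⟩ := hpull M hM
        exact (raise_swapHead_right hi hX hY hYX hr (by omega)).1
      · congr 2
        refine List.map_congr_left fun M hM => ?_
        obtain ⟨Y, r, rfl, hY, hYX, hr, hE⟩ := hpull M hM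
        exact (raise_swapHead_right hi hX hY hYX hr (by omega)).2
    · have hX1 : 0 < X (i + 1) := by rw [eps] at he; omega
      simp only [raise, if_neg hact, pulls, energy, List.map_cons, List.map_map]
      constructor
      · congr 1
        refine List.map_congr_left fun M hM => ?_
        obtain ⟨Y, r, rfl, hY, hYX, hr, hE⟩ := hpull M hM
        exact (raise_swapHead_left hi hX hY hYX hr hX1 (by omega)).1
      · congr 2
        refine List.map_congr_left fun M hM => ?_
        obtain ⟨Y, r, rfl, hY, hYX, hr, hE⟩ := hpull M hM
        exact (raise_swapHead_left hi hX hY hYX hr hX1 (by omega)).2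

/-- The number of unmatched letters `i` in a configuration. -/
def phi (i : ℕ) : List (ℕ → ℤ) → ℤ
  | [] => 0
  | X :: L => phi i L + max 0 (X i - eps i L)

/-- Replace the multiplicities of the letters `i` and `i + 1` by `p` and `q`. -/
def setPair (n i : ℕ) (p q : ℤ) (X : ℕ → ℤ) (s : ℕ) : ℤ :=
  if s % (n + 1) = i then p else if s % (n + 1) = i + 1 then q else X s

/-- The element of the `i`-string of a configuration with `k` unmatched letters `i + 1`. -/
def setEps (n i : ℕ) : ℤ → List (ℕ → ℤ) → List (ℕ → ℤ)
  | _, [] => []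
  | k, X :: L =>
    setPair n i (X i + X (i + 1) - min k (X (i + 1) + max 0 (X i - eps i L)))
        (min k (X (i + 1) + max 0 (X i - eps i L))) X ::
      setEps n i (min (X i) (eps i L) + max 0 (k - (X (i + 1) + max 0 (X i - eps i L)))) L

theorem setPair_left {n i : ℕ} (hi : i < n) (p q : ℤ) (X : ℕ → ℤ) : setPair n i p q X i = p := by
  simp [setPair, Nat.mod_eq_of_lt (show i < n + 1 by omega)]

theorem setPair_right {n i : ℕ} (hi : i < n) (p q : ℤ) (X : ℕ → ℤ) :
    setPair n i p q X (i + 1) = q := by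
  simp [setPair, Nat.mod_eq_of_lt (show i + 1 < n + 1 by omega)]

theorem setPair_of_ne {n i s : ℕ} (hs : s < n + 1) (h1 : s ≠ i) (h2 : s ≠ i + 1) (p q : ℤ)
    (X : ℕ → ℤ) : setPair n i p q X s = X s := by
  simp [setPair, Nat.mod_eq_of_lt hs, h1, h2]

theorem setPair_isCol {n : ℕ} (i : ℕ) {p q : ℤ} (hp : 0 ≤ p) (hq : 0 ≤ q) {X : ℕ → ℤ}
    (hX : IsCol n X) : IsCol n (setPair n i p q X) := by
  refine ⟨fun s => by simp [setPair, hX.per], fun s => ?_⟩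
  have := hX.nonneg s
  unfold setPair
  split_ifs <;> assumption

theorem setPair_self {n : ℕ} (i : ℕ) {X : ℕ → ℤ} (hX : IsCol n X) :
    setPair n i (X i) (X (i + 1)) X = X := by
  funext s
  unfold setPair
  split_ifs with h1 h2
  · rw [apply_of_mod hX s, h1]
  · rw [apply_of_mod hX s, h2]
  · rfl

theorem setPair_setPair (n i : ℕ) (p q p' q' : ℤ) (X : ℕ → ℤ) :
    setPair n i p q (setPair n i p' q' X) = setPair n i p q X := by
  funext s
  unfold setPair
  split_ifs <;> rfl

theorem addUnit_setPair (n i : ℕ) (p q : ℤ) (X : ℕ → ℤ) :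
    addUnit n i (setPair n i p q X) = setPair n i (p + 1) (q - 1) X := by
  funext s
  unfold addUnit setPair
  split_ifs with h1 h2
  · omega
  all_goals ring

theorem size_setPair {n i : ℕ} (hi : i < n) {p q : ℤ} {X : ℕ → ℤ} (h : p + q = X i + X (i + 1)) :
    size n (setPair n i p q X) = size n X := by
  have hs : ∀ s ∈ Finset.range (n + 1), setPair n i p q X s =
      X s + (if s = i then p - X i else 0) + (if s = i + 1 then q - X (i + 1) else 0) := by
    intro s hs
    rw [Finset.mem_range] at hs
    unfold setPair
    rw [Nat.mod_eq_of_lt hs]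
    split_ifs with h1 h2 h2
    · omega
    · subst h1; ring
    · subst h2; ring
    · ring
  rw [size, Finset.sum_congr rfl hs, Finset.sum_add_distrib, Finset.sum_add_distrib]
  simp only [Finset.sum_ite_eq', Finset.mem_range, show i < n + 1 by omega, if_true, size,
    show i + 1 < n + 1 by omega]
  omega

theorem phi_nonneg (i : ℕ) (L : List (ℕ → ℤ)) : 0 ≤ phi i L := by
  induction L with
  | nil => simp [phi]
  | cons X L ih => rw [phi]; omega

theorem phi_sub_eps (i : ℕ) (L : List (ℕ → ℤ)) :
    phi i L - eps i L = count i L - count (i + 1) L := by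
  induction L with
  | nil => simp [phi, eps, count]
  | cons X L ih =>
    simp only [phi, eps, count, List.map_cons, List.sum_cons] at *
    omega

/-- A configuration of columns with prescribed sizes. -/
def Shape (n : ℕ) (μ : List ℕ) (M : List (ℕ → ℤ)) : Prop :=
  List.Forall₂ (fun (m : ℕ) X => IsCol n X ∧ size n X = m) μ M

theorem Shape.isCol {n : ℕ} {μ : List ℕ} {M : List (ℕ → ℤ)} (h : Shape n μ M) :
    ∀ X ∈ M, IsCol n X := by
  induction h with
  | nil => simp
  | cons h _ ih =>
    intro X hX
    rcases List.mem_cons.1 hX with rfl | hX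
    · exact h.1
    · exact ih X hX

theorem Shape.bounded {n : ℕ} {μ : List ℕ} {M : List (ℕ → ℤ)} (h : Shape n μ M) {m : ℕ}
    (hm : ∀ k ∈ μ, k ≤ m) : Bounded n m M := by
  induction h with
  | nil => simp [Bounded]
  | @cons k Y μ M h _ ih =>
    intro X hX
    rcases List.mem_cons.1 hX with rfl | hX
    · exact ⟨h.1, by rw [h.2]; exact_mod_cast hm k (by simp)⟩
    · exact ih (fun k hk => hm k (by simp [hk])) X hX

theorem Shape.isConfig {n : ℕ} {μ : List ℕ} {M : List (ℕ → ℤ)} (h : Shape n μ M)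
    (hμ : μ.Pairwise (· ≥ ·)) : Config n M := by
  induction h with
  | nil => exact ⟨by simp, List.Pairwise.nil⟩
  | @cons k Y μ M h h2 ih =>
    rw [List.pairwise_cons] at hμ
    rw [config_cons]
    refine ⟨h.1, ?_, ih hμ.2⟩
    rw [h.2]
    exact Shape.bounded h2 hμ.1

theorem setEps_shape {n i : ℕ} (hi : i < n) {μ : List ℕ} {M : List (ℕ → ℤ)} (h : Shape n μ M)
    {k : ℤ} (hk : 0 ≤ k) : Shape n μ (setEps n i k M) := by
  induction h generalizing k with
  | nil => exact List.Forall₂.nil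
  | @cons m X μ L h h2 ih =>
    have h0 := eps_nonneg (n := n) i (Shape.isCol h2)
    have h3 := h.1.nonneg i
    have h4 := h.1.nonneg (i + 1)
    refine List.Forall₂.cons ⟨setPair_isCol i ?_ ?_ h.1, ?_⟩ (ih ?_)
    · omega
    · omega
    · rw [size_setPair hi (by ring), h.2]
    · omega

theorem eps_setEps {n i : ℕ} (hi : i < n) {M : List (ℕ → ℤ)} (h : ∀ X ∈ M, IsCol n X)
    {k : ℤ} (hk : 0 ≤ k) (hk2 : k ≤ eps i M + phi i M) : eps i (setEps n i k M) = k := by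
  induction M generalizing k with
  | nil => simp [eps, phi] at hk2; simp [setEps, eps]; omega
  | cons X L ih =>
    have hL : ∀ Z ∈ L, IsCol n Z := fun Z hZ => h Z (by simp [hZ])
    have h0 := eps_nonneg (n := n) i hL
    have h9 := phi_nonneg i L
    have h3 := (h X (by simp)).nonneg i
    have h4 := (h X (by simp)).nonneg (i + 1)
    simp only [eps, phi] at hk2
    rw [setEps, eps, ih hL (by omega) (by omega), setPair_left hi, setPair_right hi]
    omega

theorem phi_setEps {n i : ℕ} (hi : i < n) {M : List (ℕ → ℤ)} (h : ∀ X ∈ M, IsCol n X)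
    {k : ℤ} (hk : 0 ≤ k) (hk2 : k ≤ eps i M + phi i M) :
    phi i (setEps n i k M) = eps i M + phi i M - k := by
  induction M generalizing k with
  | nil => simp [eps, phi] at hk2; simp [setEps, eps, phi]; omega
  | cons X L ih =>
    have hL : ∀ Z ∈ L, IsCol n Z := fun Z hZ => h Z (by simp [hZ])
    have h0 := eps_nonneg (n := n) i hL
    have h9 := phi_nonneg i L
    have h3 := (h X (by simp)).nonneg i
    have h4 := (h X (by simp)).nonneg (i + 1)
    simp only [eps, phi] at hk2
    rw [setEps, phi, ih hL (by omega) (by omega), eps_setEps hi hL (by omega) (by omega),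
      setPair_left hi, eps, phi]
    omega

theorem setEps_setEps {n i : ℕ} (hi : i < n) {M : List (ℕ → ℤ)} (h : ∀ X ∈ M, IsCol n X)
    {k p : ℤ} (hk : 0 ≤ k) (hk2 : k ≤ eps i M + phi i M) :
    setEps n i p (setEps n i k M) = setEps n i p M := by
  induction M generalizing k p with
  | nil => rfl
  | cons X L ih =>
    have hL : ∀ Z ∈ L, IsCol n Z := fun Z hZ => h Z (by simp [hZ])
    have h0 := eps_nonneg (n := n) i hL
    have h9 := phi_nonneg i L
    have h3 := (h X (by simp)).nonneg i
    have h4 := (h X (by simp)).nonneg (i + 1)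
    simp only [eps, phi] at hk2
    rw [setEps, setEps, ih hL (by omega) (by omega), eps_setEps hi hL (by omega) (by omega),
      setPair_left hi, setPair_right hi, setPair_setPair, setEps]
    congr 2 <;> omega

theorem setEps_eps {n i : ℕ} {M : List (ℕ → ℤ)} (h : ∀ X ∈ M, IsCol n X) :
    setEps n i (eps i M) M = M := by
  induction M with
  | nil => rfl
  | cons X L ih =>
    have hL : ∀ Z ∈ L, IsCol n Z := fun Z hZ => h Z (by simp [hZ])
    have h0 := eps_nonneg (n := n) i hL
    have hX := h X (by simp)
    have h3 := hX.nonneg i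
    have h4 := hX.nonneg (i + 1)
    rw [setEps, eps, show min (X i) (eps i L) + max 0 (X (i + 1) + max 0 (eps i L - X i) -
      (X (i + 1) + max 0 (X i - eps i L))) = eps i L by omega, ih hL,
      show min (X (i + 1) + max 0 (eps i L - X i)) (X (i + 1) + max 0 (X i - eps i L)) =
        X (i + 1) by omega, add_sub_cancel_right, setPair_self i hX]

theorem raise_setEps {n i : ℕ} (hi : i < n) {M : List (ℕ → ℤ)} (h : ∀ X ∈ M, IsCol n X)
    {k : ℤ} (hk : 0 < k) (hk2 : k ≤ eps i M + phi i M) :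
    raise n i (setEps n i k M) = setEps n i (k - 1) M := by
  induction M generalizing k with
  | nil => simp [eps, phi] at hk2; omega
  | cons X L ih =>
    have hL : ∀ Z ∈ L, IsCol n Z := fun Z hZ => h Z (by simp [hZ])
    have h0 := eps_nonneg (n := n) i hL
    have h9 := phi_nonneg i L
    have h3 := (h X (by simp)).nonneg i
    have h4 := (h X (by simp)).nonneg (i + 1)
    simp only [eps, phi] at hk2
    rw [setEps, raise, eps_setEps hi hL (by omega) (by omega), setPair_left hi, setEps]
    split_ifs with hc
    · rw [ih hL (by omega) (by omega)]
      congr 2 <;> omega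
    · rw [addUnit_setPair]
      congr 2 <;> omega

theorem energy_setEps {n i : ℕ} (hi : i < n) {μ : List ℕ} (hμ : μ.Pairwise (· ≥ ·))
    {M : List (ℕ → ℤ)} (h : Shape n μ M) {k : ℤ} (hk : 0 ≤ k) (hk2 : k ≤ eps i M + phi i M) :
    energy n (setEps n i k M) = energy n M := by
  have key : ∀ j : ℕ, (j : ℤ) ≤ eps i M + phi i M →
      energy n (setEps n i j M) = energy n (setEps n i 0 M) := by
    intro j
    induction j with
    | zero => intro; rfl
    | succ j ih =>
      intro hj
      push_cast at hj ⊢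
      rw [← ih (by omega), ← (pulls_raise hi ((setEps_shape hi h (by omega)).isConfig hμ) _).2,
        raise_setEps hi h.isCol (by omega) hj, add_sub_cancel_right]
      rw [eps_setEps hi h.isCol (by omega) hj]
      omega
  have h0 := eps_nonneg (n := n) i h.isCol
  have h1 := phi_nonneg i M
  have e1 := key k.toNat (by omega)
  have e2 := key (eps i M).toNat (by omega)
  rw [Int.toNat_of_nonneg hk] at e1
  rw [Int.toNat_of_nonneg h0, setEps_eps h.isCol] at e2
  rw [e1, e2]

theorem count_setEps_of_ne {n i s : ℕ} (hs : s < n + 1) (h1 : s ≠ i) (h2 : s ≠ i + 1) (k : ℤ)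
    (M : List (ℕ → ℤ)) : count s (setEps n i k M) = count s M := by
  induction M generalizing k with
  | nil => rfl
  | cons X L ih =>
    simp only [count, setEps, List.map_cons, List.sum_cons] at *
    rw [ih, setPair_of_ne hs h1 h2]

theorem count_add_setEps {n i : ℕ} (hi : i < n) (k : ℤ) (M : List (ℕ → ℤ)) :
    count i (setEps n i k M) + count (i + 1) (setEps n i k M) = count i M + count (i + 1) M := by
  induction M generalizing k with
  | nil => rfl
  | cons X L ih =>
    simp only [count, setEps, List.map_cons, List.sum_cons, setPair_left hi,
      setPair_right hi] at *
    have := ih (min (X i) (eps i L) + max 0 (k - (X (i + 1) + max 0 (X i - eps i L))))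
    omega

/-! #### Highest weight configurations -/

/-- The letter `i + 1` violates the strict ballot condition at the column `X`. -/
def Violates (n : ℕ) (c X : ℕ → ℤ) (i : ℕ) : Prop := i < n ∧ c i < c (i + 1) + X (i + 1)

open Classical in
/-- The letter at the first violation of the ballot condition. -/
noncomputable def firstBad (n : ℕ) : (ℕ → ℤ) → List (ℕ → ℤ) → Option ℕ
  | _, [] => none
  | c, X :: L =>
    if ∃ i, Violates n c X i then some (Nat.findGreatest (Violates n c X) n)
    else firstBad n (c + X) L

theorem firstBad_setEps {n i : ℕ} {c : ℕ → ℤ} {M : List (ℕ → ℤ)} (h : ∀ X ∈ M, IsCol n X)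
    (hc : c (i + 1) ≤ c i) (hb : firstBad n c M = some i) :
    i < n ∧ c i - c (i + 1) < eps i M ∧
    ∀ k, c i - c (i + 1) < k → firstBad n c (setEps n i k M) = some i ∧
      ((¬ ∃ j, ∃ X ∈ M.head?, Violates n c X j) → (setEps n i k M).head? = M.head?) := by
  induction M generalizing c with
  | nil => simp [firstBad] at hb
  | cons X L ih =>
    classical
    have hL : ∀ Z ∈ L, IsCol n Z := fun Z hZ => h Z (by simp [hZ])
    have h0 := eps_nonneg (n := n) i hL
    have hX := h X (by simp)
    have h3 := hX.nonneg i
    have h4 := hX.nonneg (i + 1)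
    rw [firstBad] at hb
    by_cases hv : ∃ i, Violates n c X i
    · rw [if_pos hv, Option.some.injEq] at hb
      obtain ⟨j, hj⟩ := hv
      have hvi : Violates n c X i := by
        rw [← hb]
        exact Nat.findGreatest_spec (le_of_lt hj.1) hj
      have hmax : ∀ j, i < j → ¬ Violates n c X j := by
        intro j hj hvj
        exact Nat.findGreatest_is_greatest (hb ▸ hj) (le_of_lt hvj.1) hvj
      have hi := hvi.1
      refine ⟨hi, ?_, fun k hk => ⟨?_, fun hne => absurd ⟨j, X, by simp, hj⟩ hne⟩⟩
      · have := hvi.2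
        rw [eps]; omega
      · have hvi' := hvi.2
        rw [setEps, firstBad]
        have hnew : Violates n c (setPair n i (X i + X (i + 1) -
          min k (X (i + 1) + max 0 (X i - eps i L)))
          (min k (X (i + 1) + max 0 (X i - eps i L))) X) i := by
          refine ⟨hi, ?_⟩
          rw [setPair_right hi]; omega
        rw [if_pos ⟨i, hnew⟩, Option.some.injEq, Nat.findGreatest_eq_iff]
        refine ⟨le_of_lt hi, fun _ => hnew, fun j hj hjn hvj => hmax j hj ⟨hvj.1, ?_⟩⟩
        have h5 := hvj.2
        have := hvj.1
        rwa [setPair_of_ne (by omega) (by omega) (by omega)] at h5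
    · rw [if_neg hv] at hb
      have hi : i < n := by
        by_contra hin
        have : ∀ (L : List (ℕ → ℤ)) c, firstBad n c L ≠ some i := by
          intro L
          induction L with
          | nil => simp [firstBad]
          | cons Z L ih =>
            intro c hc
            rw [firstBad] at hc
            split_ifs at hc with hz
            · obtain ⟨j, hj⟩ := hz
              have := (Nat.findGreatest_spec (le_of_lt hj.1) hj).1
              rw [Option.some.injEq] at hc
              omega
            · exact ih _ hc
        exact this L _ hb
      have hnv : c (i + 1) + X (i + 1) ≤ c i := by
        by_contra hlt
        exact hv ⟨i, hi, by omega⟩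
      obtain ⟨-, ih2, ih3⟩ := ih hL (c := c + X) (by simp only [Pi.add_apply]; omega) hb
      simp only [Pi.add_apply] at ih2 ih3
      refine ⟨hi, by rw [eps]; omega, fun k hk => ?_⟩
      have e1 : min k (X (i + 1) + max 0 (X i - eps i L)) = X (i + 1) := by omega
      rw [setEps, e1, add_sub_cancel_right, setPair_self i hX, firstBad, if_neg hv]
      exact ⟨(ih3 _ (by omega)).1, fun _ => rfl⟩

theorem count_antitone_of_firstBad {n : ℕ} {c : ℕ → ℤ} {M : List (ℕ → ℤ)}
    (h : ∀ X ∈ M, IsCol n X) (hb : firstBad n c M = none) (hc : ∀ i < n, c (i + 1) ≤ c i) :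
    ∀ i < n, c (i + 1) + count (i + 1) M ≤ c i + count i M := by
  induction M generalizing c with
  | nil => simpa [count] using hc
  | cons X L ih =>
    intro i hi
    rw [firstBad] at hb
    split_ifs at hb with hv
    have key : ∀ i < n, c (i + 1) + X (i + 1) ≤ c i := by
      intro i hi
      by_contra hlt
      exact hv ⟨i, hi, by omega⟩
    have := ih (fun Z hZ => h Z (by simp [hZ])) hb (c := c + X) (fun i hi => by
      have h1 := key i hi
      have h2 := (h X (by simp)).nonneg i
      simp only [Pi.add_apply]; omega) i hi
    simp only [Pi.add_apply] at this
    simp only [count, List.map_cons, List.sum_cons] at *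
    omega

theorem head_eq_zeroCol {n m : ℕ} {X : ℕ → ℤ} (hX : IsCol n X) (hm : size n X = m)
    (h : ¬ ∃ i, Violates n 0 X i) : X = zeroCol n m := by
  have key : ∀ i < n, X (i + 1) = 0 := by
    intro i hi
    have h1 := hX.nonneg (i + 1)
    by_contra hlt
    exact h ⟨i, hi, by simp; omega⟩
  refine hX.ext (zeroCol_isCol n (by omega)) fun s hs => ?_
  cases s with
  | zero =>
    rw [size, Finset.sum_range_succ', Finset.sum_eq_zero (fun i hi => key i (by simpa using hi))]
      at hm
    simpa [zeroCol] using hm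
  | succ s => rw [key s (by omega)]; simp [zeroCol, Nat.mod_eq_of_lt hs]

end KostkaFoulkes

/-! ### Generating functions of configurations -/

namespace KostkaFoulkes

theorem finite_cols (n m : ℕ) : {X : ℕ → ℤ | IsCol n X ∧ size n X = m}.Finite := by
  refine Set.Finite.of_injOn (f := fun X (i : Fin (n + 1)) => X i)
    (t := Set.Icc (fun _ => (0 : ℤ)) (fun _ => (m : ℤ))) ?_ ?_ (Set.finite_Icc _ _)
  · rintro X ⟨hX, hm⟩
    refine ⟨fun i => hX.nonneg i, fun i => ?_⟩
    change X i ≤ m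
    rw [← hm]
    exact Finset.single_le_sum (f := X) (fun s _ => hX.nonneg s) (Finset.mem_range.2 i.2)
  · rintro X ⟨hX, -⟩ Y ⟨hY, -⟩ h
    exact hX.ext hY fun s hs => congrFun h ⟨s, hs⟩

theorem finite_shape (n : ℕ) (μ : List ℕ) : {M | Shape n μ M}.Finite := by
  induction μ with
  | nil => simp [Shape]
  | cons m μ ih =>
    refine ((finite_cols n m).image2 List.cons ih).subset ?_
    intro M hM
    rw [Set.mem_ofPred_eq, Shape, List.forall₂_cons_left_iff] at hM
    obtain ⟨X, L, h1, h2, rfl⟩ := hM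
    exact ⟨X, h1, L, h2, rfl⟩

/-- The finite set of configurations of a given shape. -/
noncomputable def configs (n : ℕ) (μ : List ℕ) : Finset (List (ℕ → ℤ)) :=
  (finite_shape n μ).toFinset

theorem mem_configs {n : ℕ} {μ : List ℕ} {M : List (ℕ → ℤ)} : M ∈ configs n μ ↔ Shape n μ M := by
  simp [configs]

/-- The weight of a configuration. -/
def wt (n : ℕ) (M : List (ℕ → ℤ)) (i : Fin (n + 1)) : ℕ := (count i M).toNat

theorem count_nonneg {n : ℕ} {M : List (ℕ → ℤ)} (h : ∀ X ∈ M, IsCol n X) (s : ℕ) :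
    0 ≤ count s M := by
  refine List.sum_nonneg fun z hz => ?_
  rw [List.mem_map] at hz
  obtain ⟨X, hX, rfl⟩ := hz
  exact (h X hX).nonneg s

/-- Functions on weights that are antisymmetric under the dot action of the symmetric group. -/
def DotAlt {R : Type*} [CommRing R] (n : ℕ) (F : (Fin (n + 1) → ℕ) → R) : Prop :=
  ∀ (i : ℕ) (hi : i < n) (α β : Fin (n + 1) → ℕ),
    (∀ j : Fin (n + 1), (j : ℕ) ≠ i → (j : ℕ) ≠ i + 1 → β j = α j) →
    β ⟨i, by omega⟩ + 1 = α ⟨i + 1, by omega⟩ → β ⟨i + 1, by omega⟩ = α ⟨i, by omega⟩ + 1 →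
    F β = - F α

variable {R : Type*} [CommRing R]

/-- The contribution of a configuration to a generating function. -/
noncomputable def term (n : ℕ) (t : R) (F : (Fin (n + 1) → ℕ) → R) (M : List (ℕ → ℤ)) : R :=
  t ^ (energy n M).toNat * F (wt n M)

/-- The sign reversing involution on configurations violating the ballot condition. -/
noncomputable def flip (n : ℕ) (M : List (ℕ → ℤ)) : List (ℕ → ℤ) :=
  match firstBad n 0 M with
  | none => M
  | some i => setEps n i (phi i M + 1) M

theorem flip_props {n i : ℕ} {μ : List ℕ} (hμ : μ.Pairwise (· ≥ ·)) {M : List (ℕ → ℤ)}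
    (h : Shape n μ M) (hb : firstBad n 0 M = some i) :
    Shape n μ (flip n M) ∧ firstBad n 0 (flip n M) = some i ∧ flip n (flip n M) = M ∧
    ((¬ ∃ j, ∃ X ∈ M.head?, Violates n 0 X j) → (flip n M).head? = M.head?) ∧
    ∀ (t : R) (F : (Fin (n + 1) → ℕ) → R), DotAlt n F → term n t F (flip n M) = - term n t F M := by
  obtain ⟨hi, he, hk⟩ := firstBad_setEps h.isCol (by simp) hb
  simp only [Pi.zero_apply, sub_zero] at he hk
  have hp := phi_nonneg i M
  have hfl : flip n M = setEps n i (phi i M + 1) M := by simp only [flip, hb]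
  obtain ⟨h1, h2⟩ := hk (phi i M + 1) (by omega)
  have hsh := setEps_shape hi h (k := phi i M + 1) (by omega)
  rw [← hfl] at h1 h2 hsh
  have hphi := phi_setEps hi h.isCol (k := phi i M + 1) (by omega) (by omega)
  have heps := eps_setEps hi h.isCol (k := phi i M + 1) (by omega) (by omega)
  refine ⟨hsh, h1, ?_, h2, ?_⟩
  · have : flip n (flip n M) = setEps n i (phi i (flip n M) + 1) (flip n M) := by
      rw [flip]; simp only [h1]
    rw [this, hfl, hphi, setEps_setEps hi h.isCol (by omega) (by omega),
      show eps i M + phi i M - (phi i M + 1) + 1 = eps i M by ring, setEps_eps h.isCol]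
  · intro t F hF
    have e1 := phi_sub_eps i M
    have e2 := phi_sub_eps i (flip n M)
    have e3 := count_add_setEps hi (phi i M + 1) M
    have n1 := count_nonneg h.isCol i
    have n2 := count_nonneg h.isCol (i + 1)
    have n3 := count_nonneg hsh.isCol i
    have n4 := count_nonneg hsh.isCol (i + 1)
    rw [← hfl] at hphi heps e3
    rw [term, term, hF i hi (wt n M) (wt n (flip n M)), hfl,
      energy_setEps hi hμ h (by omega) (by omega), mul_neg]
    · intro j hj1 hj2
      rw [wt, wt, hfl, count_setEps_of_ne j.2 hj1 hj2]
    · simp only [wt]; omega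
    · simp only [wt]; omega

theorem sum_eq_sum_ballot [IsDomain R] [CharZero R] {n : ℕ} {μ : List ℕ}
    (hμ : μ.Pairwise (· ≥ ·)) (S : Finset (List (ℕ → ℤ))) (hS : ∀ M ∈ S, Shape n μ M)
    (hfl : ∀ M ∈ S, firstBad n 0 M ≠ none → flip n M ∈ S) (t : R)
    {F : (Fin (n + 1) → ℕ) → R} (hF : DotAlt n F) :
    ∑ M ∈ S, term n t F M = ∑ M ∈ S with firstBad n 0 M = none, term n t F M := by
  rw [← Finset.sum_filter_add_sum_filter_not S (fun M => firstBad n 0 M = none), add_eq_left]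
  have : ∑ M ∈ S with ¬ firstBad n 0 M = none, term n t F M =
      ∑ M ∈ S with ¬ firstBad n 0 M = none, - term n t F M := by
    refine Finset.sum_nbij' (flip n) (flip n) ?_ ?_ ?_ ?_ ?_ <;> intro M hM <;>
      rw [Finset.mem_filter] at hM <;>
      obtain ⟨i, hi⟩ := Option.ne_none_iff_exists'.1 hM.2 <;>
      have hp := flip_props (R := R) hμ (hS M hM.1) hi
    · exact Finset.mem_filter.2 ⟨hfl M hM.1 hM.2, by simp [hp.2.1]⟩
    · exact Finset.mem_filter.2 ⟨hfl M hM.1 hM.2, by simp [hp.2.1]⟩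
    · exact hp.2.2.1
    · exact hp.2.2.1
    · rw [hp.2.2.2.2 t F hF, neg_neg]
  rw [Finset.sum_neg_distrib] at this
  exact self_eq_neg.1 this

theorem sum_configs_eq_ballot [IsDomain R] [CharZero R] {n : ℕ} {μ : List ℕ}
    (hμ : μ.Pairwise (· ≥ ·)) (t : R) {F : (Fin (n + 1) → ℕ) → R} (hF : DotAlt n F) :
    ∑ M ∈ configs n μ, term n t F M =
      ∑ M ∈ configs n μ with firstBad n 0 M = none, term n t F M := by
  refine sum_eq_sum_ballot hμ _ (fun M hM => mem_configs.1 hM) (fun M hM hb => ?_) t hF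
  obtain ⟨i, hi⟩ := Option.ne_none_iff_exists'.1 hb
  exact mem_configs.2 (flip_props (R := R) hμ (mem_configs.1 hM) hi).1

theorem not_violates_zeroCol (n m i : ℕ) : ¬ Violates n 0 (zeroCol n m) i := by
  rintro ⟨h1, h2⟩
  simp [zeroCol, Nat.mod_eq_of_lt (show i + 1 < n + 1 by omega)] at h2

theorem sum_configs_cons [IsDomain R] [CharZero R] {n m : ℕ} {μ : List ℕ}
    (hμ : (m :: μ).Pairwise (· ≥ ·)) (t : R) {F : (Fin (n + 1) → ℕ) → R} (hF : DotAlt n F) :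
    ∑ M ∈ configs n (m :: μ), term n t F M =
      ∑ M ∈ configs n μ, term n t F (zeroCol n m :: M) := by
  classical
  rw [sum_configs_eq_ballot hμ t hF]
  have hinj : Set.InjOn (List.cons (zeroCol n m)) (configs n μ : Set (List (ℕ → ℤ))) :=
    fun _ _ _ _ h => (List.cons.inj h).2
  rw [← Finset.sum_image (f := term n t F) hinj]
  have hz : IsCol n (zeroCol n m) ∧ size n (zeroCol n m) = m :=
    ⟨zeroCol_isCol n (by omega), size_zeroCol n m⟩
  have hsub : ∀ M, M ∈ (configs n μ).image (List.cons (zeroCol n m)) ↔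
      Shape n (m :: μ) M ∧ M.head? = some (zeroCol n m) := by
    intro M
    rw [Finset.mem_image]
    constructor
    · rintro ⟨L, hL, rfl⟩
      exact ⟨List.Forall₂.cons hz (mem_configs.1 hL), rfl⟩
    · rintro ⟨h1, h2⟩
      rw [Shape, List.forall₂_cons_left_iff] at h1
      obtain ⟨X, L, h1, h3, rfl⟩ := h1
      obtain rfl : X = zeroCol n m := by simpa using h2
      exact ⟨L, mem_configs.2 h3, rfl⟩
  rw [sum_eq_sum_ballot hμ _ (fun M hM => ((hsub M).1 hM).1) ?_ t hF]
  · refine Finset.sum_congr ?_ fun _ _ => rfl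
    ext M
    rw [Finset.mem_filter, Finset.mem_filter, hsub, mem_configs]
    constructor
    · rintro ⟨h1, h2⟩
      refine ⟨⟨h1, ?_⟩, h2⟩
      rw [Shape, List.forall₂_cons_left_iff] at h1
      obtain ⟨X, L, h1, h3, rfl⟩ := h1
      rw [firstBad] at h2
      split_ifs at h2 with hv
      rw [head_eq_zeroCol h1.1 h1.2 hv]
      rfl
    · rintro ⟨⟨h1, -⟩, h2⟩
      exact ⟨h1, h2⟩
  · intro M hM hb
    rw [hsub] at hM ⊢
    obtain ⟨i, hi⟩ := Option.ne_none_iff_exists'.1 hb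
    have hp := flip_props (R := R) hμ hM.1 hi
    refine ⟨hp.1, ?_⟩
    rw [hp.2.2.2.1 ?_, hM.2]
    rintro ⟨j, X, hX, hv⟩
    rw [hM.2] at hX
    obtain rfl : zeroCol n m = X := by simpa using hX
    exact not_violates_zeroCol n m j hv

/-- The inverse of the cyclic rotation of the letters of a column. -/
def rotInv (n : ℕ) (X : ℕ → ℤ) (s : ℕ) : ℤ := X (s + n)

theorem rotInv_isCol {n : ℕ} {X : ℕ → ℤ} (hX : IsCol n X) : IsCol n (rotInv n X) :=
  ⟨fun s => by rw [rotInv, rotInv, ← hX.per (s + n)]; congr 1; ring, fun s => hX.nonneg _⟩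

theorem rot_rotInv {n : ℕ} {X : ℕ → ℤ} (hX : IsCol n X) : rot (rotInv n X) = X := by
  funext s
  rw [rot, rotInv, ← hX.per s]; congr 1; ring

theorem rotInv_rot {n : ℕ} {X : ℕ → ℤ} (hX : IsCol n X) : rotInv n (rot X) = X := by
  funext s
  exact hX.per s

theorem Shape.map_rot {n : ℕ} {μ : List ℕ} {M : List (ℕ → ℤ)} (h : Shape n μ M) :
    Shape n μ (M.map rot) := by
  rw [Shape, List.forall₂_map_right_iff]
  exact h.imp fun _ _ h => ⟨rot_isCol h.1, by rw [size_rot h.1, h.2]⟩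

theorem Shape.map_rotInv {n : ℕ} {μ : List ℕ} {M : List (ℕ → ℤ)} (h : Shape n μ M) :
    Shape n μ (M.map (rotInv n)) := by
  rw [Shape, List.forall₂_map_right_iff]
  refine h.imp fun _ _ h => ⟨rotInv_isCol h.1, ?_⟩
  rw [← size_rot (rotInv_isCol h.1), rot_rotInv h.1, h.2]

theorem count_map_rot (s : ℕ) (M : List (ℕ → ℤ)) : count s (M.map rot) = count (s + 1) M := by
  simp only [count, List.map_map]; rfl

theorem count_period {n : ℕ} {M : List (ℕ → ℤ)} (h : ∀ X ∈ M, IsCol n X) (s : ℕ) :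
    count (s + (n + 1)) M = count s M := by
  rw [count, count]
  congr 1
  exact List.map_congr_left fun X hX => (h X hX).per s

/-- Prepending a row of size `m` turns the last letter into a new first letter. -/
theorem sum_configs_cons_rot [IsDomain R] [CharZero R] {n m : ℕ} {μ : List ℕ}
    (hμ : (m :: μ).Pairwise (· ≥ ·)) (t : R) {F : (Fin (n + 1) → ℕ) → R} (hF : DotAlt n F) :
    ∑ M ∈ configs n (m :: μ), term n t F M =
      ∑ M ∈ configs n μ, t ^ (energy n M).toNat * (t ^ wt n M (Fin.last n) *
        F (Fin.cons (m + wt n M (Fin.last n)) fun j : Fin n => wt n M j.castSucc)) := by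
  rw [sum_configs_cons hμ t hF]
  rw [List.pairwise_cons] at hμ
  refine Finset.sum_nbij' (List.map rot) (List.map (rotInv n)) ?_ ?_ ?_ ?_ ?_
  · intro M hM
    exact mem_configs.2 (mem_configs.1 hM).map_rot
  · intro M hM
    exact mem_configs.2 (mem_configs.1 hM).map_rotInv
  · intro M hM
    rw [List.map_map]
    conv_rhs => rw [← List.map_id M]
    exact List.map_congr_left fun X hX => rotInv_rot ((mem_configs.1 hM).isCol X hX)
  · intro M hM
    rw [List.map_map]
    conv_rhs => rw [← List.map_id M]
    exact List.map_congr_left fun X hX => rot_rotInv ((mem_configs.1 hM).isCol X hX)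
  · intro M hM
    have hM' := mem_configs.1 hM
    have hcol := hM'.isCol
    have h0 : count 0 M = count n (M.map rot) := by
      rw [count_map_rot, ← count_period hcol, zero_add]
    have hc0 := count_nonneg hcol 0
    rw [term, energy_zeroCol_cons (hM'.isConfig hμ.2) (hM'.bounded hμ.1),
      Int.toNat_add (energy_nonneg (hM'.map_rot.isConfig hμ.2)) hc0, pow_add, mul_assoc]
    congr 1
    congr 1
    · rw [h0]; rfl
    · congr 1
      funext j
      refine Fin.cases ?_ (fun j => ?_) j
      · simp only [Fin.cons_zero, wt, Fin.val_last, ← h0, Fin.val_zero]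
        simp only [count, List.map_cons, List.sum_cons, zeroCol] at *
        simp only [Nat.zero_mod, if_true]
        omega
      · simp only [Fin.cons_succ, wt, Fin.val_castSucc, count_map_rot, Fin.val_succ]
        simp only [count, List.map_cons, List.sum_cons, zeroCol]
        rw [Nat.mod_eq_of_lt (by omega), if_neg (by omega), zero_add]

/-- The generating function of configurations is symmetric. -/
theorem sum_configs_swap {n : ℕ} {μ : List ℕ} (hμ : μ.Pairwise (· ≥ ·)) (t : R)
    (F : (Fin (n + 1) → ℕ) → R) (i : Fin n) :
    ∑ M ∈ configs n μ, term n t F M =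
      ∑ M ∈ configs n μ, term n t (fun α => F (α ∘ Equiv.swap i.castSucc i.succ)) M := by
  have hi := i.2
  have key : ∀ M ∈ configs n μ, setEps n i (phi i M) M ∈ configs n μ ∧
      setEps n i (phi i (setEps n i (phi i M) M)) (setEps n i (phi i M) M) = M ∧
      energy n (setEps n i (phi i M) M) = energy n M ∧
      wt n (setEps n i (phi i M) M) ∘ Equiv.swap i.castSucc i.succ = wt n M := by
    intro M hM
    have h := mem_configs.1 hM
    have h0 := eps_nonneg (n := n) i h.isCol
    have hp := phi_nonneg i M
    have hphi := phi_setEps hi h.isCol (k := phi i M) (by omega) (by omega)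
    have heps := eps_setEps hi h.isCol (k := phi i M) (by omega) (by omega)
    have hsh := setEps_shape hi h (k := phi i M) (by omega)
    refine ⟨mem_configs.2 hsh, ?_, energy_setEps hi hμ h (by omega) (by omega), ?_⟩
    · rw [hphi, add_sub_cancel_right, setEps_setEps hi h.isCol (by omega) (by omega),
        setEps_eps h.isCol]
    · have e1 := phi_sub_eps i M
      have e2 := phi_sub_eps i (setEps n i (phi i M) M)
      have e3 := count_add_setEps hi (phi i M) M
      funext j
      simp only [Function.comp, wt]
      rcases eq_or_ne j i.castSucc with rfl | hj1
      · rw [Equiv.swap_apply_left]; simp only [Fin.val_succ, Fin.val_castSucc]; omega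
      rcases eq_or_ne j i.succ with rfl | hj2
      · rw [Equiv.swap_apply_right]; simp only [Fin.val_succ, Fin.val_castSucc]; omega
      rw [Equiv.swap_apply_of_ne_of_ne hj1 hj2, count_setEps_of_ne j.2]
      · intro h; exact hj1 (Fin.ext (by simpa using h))
      · intro h; exact hj2 (Fin.ext (by simpa using h))
  refine Finset.sum_nbij' (fun M => setEps n i (phi i M) M) (fun M => setEps n i (phi i M) M)
    (fun M hM => (key M hM).1) (fun M hM => (key M hM).1) (fun M hM => (key M hM).2.1)
    (fun M hM => (key M hM).2.1) fun M hM => ?_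
  obtain ⟨-, -, h1, h2⟩ := key M hM
  simp only [term, h1, h2]

/-- The weight of a ballot configuration is weakly decreasing. -/
theorem wt_antitone {n : ℕ} {μ : List ℕ} {M : List (ℕ → ℤ)} (h : Shape n μ M)
    (hb : firstBad n 0 M = none) : Antitone (wt n M) := by
  refine Fin.antitone_iff_succ_le.2 fun i => ?_
  have := count_antitone_of_firstBad h.isCol hb (by simp) i i.2
  simp only [Pi.zero_apply, zero_add] at this
  simp only [wt, Fin.val_succ, Fin.val_castSucc]
  omega

theorem take_sum_le {n : ℕ} {μ : List ℕ} {M : List (ℕ → ℤ)} (h : Shape n μ M) {c : ℕ → ℤ}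
    {d : ℕ} (hb : firstBad n c M = none) (hc : ∀ s, 0 ≤ c s) (hd : ∀ s, d ≤ s → s ≤ n → c s = 0)
    (k : ℕ)
    (hk : d + k ≤ n + 1) :
    ((μ.take k).sum : ℤ) ≤ ∑ s ∈ Finset.range (d + k), count s M := by
  induction h generalizing c d k with
  | nil => simp [count]
  | @cons m X μ L h h2 ih =>
    cases k with
    | zero =>
      simp only [List.take_zero, List.sum_nil, Nat.cast_zero]
      exact Finset.sum_nonneg fun s _ => count_nonneg (Shape.isCol (List.Forall₂.cons h h2)) s
    | succ k =>
      rw [firstBad] at hb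
      split_ifs at hb with hv
      have hX : ∀ s, d + 1 ≤ s → s ≤ n → X s = 0 := by
        intro s hs hsn
        obtain ⟨s, rfl⟩ : ∃ r, s = r + 1 := ⟨s - 1, by omega⟩
        have h3 : c (s + 1) + X (s + 1) ≤ c s := by
          by_contra hlt
          exact hv ⟨s, by omega, by omega⟩
        have h4 := hd s (by omega) (by omega)
        have h5 := hc (s + 1)
        have h6 := h.1.nonneg (s + 1)
        omega
      have := ih hb (d := d + 1) (fun s => add_nonneg (hc s) (h.1.nonneg s))
        (fun s hs hsn => by simp [hX s hs hsn, hd s (by omega) hsn]) k (by omega)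
      have hsz : (m : ℤ) ≤ ∑ s ∈ Finset.range (d + 1 + k), X s := by
        rw [← h.2, size]
        refine (Finset.sum_subset (Finset.range_subset_range.2 (by omega)) ?_).ge
        intro s hs hs'
        simp only [Finset.mem_range] at hs hs'
        exact hX s (by omega) (by omega)
      rw [show d + (k + 1) = d + 1 + k by ring]
      simp only [count, List.map_cons, List.sum_cons, Finset.sum_add_distrib, List.take_succ_cons]
        at *
      rw [Nat.cast_add]
      omega

end KostkaFoulkes

/-! ### Alternants and the recursion for modified Hall-Littlewood functions -/

namespace KostkaFoulkes

section Alternants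

variable {S : Type*} [CommRing S]

/-- The alternant with exponents `β` in the variables `y`. -/
def alternant {n : ℕ} (y : Fin n → S) (β : Fin n → ℕ) : S :=
  Matrix.det (Matrix.of fun i j => y j ^ β i)

theorem alternant_cons {n : ℕ} (y : Fin (n + 1) → S) (b : ℕ) (β : Fin n → ℕ) :
    alternant y (Fin.cons b β : Fin (n + 1) → ℕ) =
      ∑ a : Fin (n + 1), (-1) ^ (a : ℕ) * y a ^ b * alternant (y ∘ a.succAbove) β := by
  rw [alternant, Matrix.det_succ_row_zero]
  refine Finset.sum_congr rfl fun a _ => ?_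
  rw [alternant]
  congr 1

theorem alternant_eq_zero {n : ℕ} (y : Fin n → S) {β : Fin n → ℕ} {i j : Fin n} (hij : i ≠ j)
    (h : β i = β j) : alternant y β = 0 :=
  Matrix.det_zero_of_row_eq hij (by ext; simp [h])

theorem alternant_snoc {n : ℕ} (y : Fin n → S) (z : S) (ε : Fin n → ℕ) :
    alternant (Fin.snoc y z : Fin (n + 1) → S)
      (Fin.snoc (fun i => ε i + 1) 0 : Fin (n + 1) → ℕ) =
      Matrix.det (Matrix.of fun i j => y j ^ (ε i + 1) - z ^ (ε i + 1)) := by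
  have h1 : alternant (Fin.snoc y z : Fin (n + 1) → S)
      (Fin.snoc (fun i => ε i + 1) 0 : Fin (n + 1) → ℕ) =
      Matrix.det (Matrix.of fun (j i : Fin (n + 1)) =>
        (Fin.snoc y z : Fin (n + 1) → S) j ^
            (Fin.snoc (fun i => ε i + 1) 0 : Fin (n + 1) → ℕ) i
          - (Fin.snoc (fun _ => 1) 0 : Fin (n + 1) → S) j *
            z ^ (Fin.snoc (fun i => ε i + 1) 0 : Fin (n + 1) → ℕ) i) := by
    rw [alternant, ← Matrix.det_transpose]
    symm
    refine Matrix.det_eq_of_forall_row_eq_smul_add_const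
      (fun j => - (Fin.snoc (fun _ => 1) 0 : Fin (n + 1) → S) j) (Fin.last n) (by simp) ?_
    intro i j
    simp [sub_eq_add_neg]
  rw [h1, ← Matrix.det_transpose, Matrix.det_succ_row _ (Fin.last n), Fin.sum_univ_castSucc]
  simp only [Matrix.transpose_apply, Matrix.of_apply, Fin.snoc_castSucc, Fin.snoc_last]
  simp only [pow_zero, sub_self, mul_zero, zero_mul, Finset.sum_const_zero, zero_add,
    sub_zero, mul_one, Fin.val_last]
  rw [← two_mul, pow_mul]
  simp only [neg_one_sq, one_pow, one_mul, Fin.succAbove_last]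
  congr 1
  ext i j
  simp

theorem prod_mul_sum_alternant {n : ℕ} (y : Fin n → S) (z : S) (ε : Fin n → ℕ) :
    (∏ j, (y j - z)) * ∑ ρ ∈ Fintype.piFinset fun i => Finset.range (ε i + 1),
        z ^ (∑ i, ρ i) * alternant y (ε - ρ) =
      alternant (Fin.snoc y z : Fin (n + 1) → S)
        (Fin.snoc (fun i => ε i + 1) 0 : Fin (n + 1) → ℕ) := by
  have h1 : ∑ ρ ∈ Fintype.piFinset fun i => Finset.range (ε i + 1),
        z ^ (∑ i, ρ i) * alternant y (ε - ρ) =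
      Matrix.det (Matrix.of fun i j =>
        ∑ r ∈ Finset.range (ε i + 1), z ^ r * y j ^ (ε i - r)) := by
    have := (Matrix.detRowAlternating (R := S) (n := Fin n)).toMultilinearMap.map_sum_finset
      (fun i r j => z ^ r * y j ^ (ε i - r)) (fun i => Finset.range (ε i + 1))
    simp only [AlternatingMap.coe_multilinearMap] at this
    change _ = Matrix.detRowAlternating _
    have h2 : (Matrix.of fun i j => ∑ r ∈ Finset.range (ε i + 1), z ^ r * y j ^ (ε i - r)) =
      fun i => ∑ r ∈ Finset.range (ε i + 1), (fun j => z ^ r * y j ^ (ε i - r)) := by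
      ext i j
      simp
    rw [h2, this]
    refine Finset.sum_congr rfl fun ρ _ => ?_
    change _ = Matrix.det (Matrix.of fun i j => z ^ ρ i * (Matrix.of fun i j => y j ^ (ε i - ρ i)) i j)
    rw [Matrix.det_mul_column, Finset.prod_pow_eq_pow_sum]
    rfl
  rw [h1, alternant_snoc, ← Matrix.det_mul_row]
  congr 1
  ext i j
  have := geom_sum₂_mul z (y j) (ε i + 1)
  simp only [Nat.add_sub_cancel] at this
  simp only [Matrix.of_apply]
  linear_combination -this

end Alternants

section Weights

variable {A : Type*} [CommRing A] (t : A)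

/-- The operator prepending the leading exponent `g`, raised by lowering the others. -/
noncomputable def raiseWt {n : ℕ} (g : ℕ) :
    ((Fin n → ℕ) →₀ A) →ₗ[A] ((Fin (n + 1) → ℕ) →₀ A) :=
  Finsupp.linearCombination A fun ε =>
    ∑ ρ ∈ Fintype.piFinset fun i => Finset.range (ε i + 1),
      Finsupp.single (Fin.cons (g + ∑ i, ρ i) (ε - ρ)) (t ^ (∑ i, ρ i))

/-- The expansion of `∏ (1 - t R i j)⁻¹` applied to the exponent `γ`. -/
noncomputable def hlWeights : ∀ {n : ℕ}, (Fin n → ℕ) → ((Fin n → ℕ) →₀ A)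
  | 0, γ => Finsupp.single γ 1
  | _ + 1, γ => raiseWt t (γ 0) (hlWeights (Fin.tail γ))

theorem raiseWt_single {n : ℕ} (g : ℕ) (ε : Fin n → ℕ) (a : A) :
    raiseWt t g (Finsupp.single ε a) = a • ∑ ρ ∈ Fintype.piFinset fun i => Finset.range (ε i + 1),
      Finsupp.single (Fin.cons (g + ∑ i, ρ i) (ε - ρ) : Fin (n + 1) → ℕ) (t ^ (∑ i, ρ i)) := by
  simp [raiseWt]

theorem hlWeights_cons {n : ℕ} (g : ℕ) (γ : Fin n → ℕ) :
    hlWeights t (Fin.cons g γ : Fin (n + 1) → ℕ) = raiseWt t g (hlWeights t γ) := by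
  simp [hlWeights]

/-- Exponents with two vanishing entries. -/
def degenerate (A : Type*) [CommRing A] (n : ℕ) : Submodule A ((Fin n → ℕ) →₀ A) :=
  Finsupp.supported A A {β | ∃ i j, i ≠ j ∧ β i = 0 ∧ β j = 0}

theorem raiseWt_degenerate {n : ℕ} (g : ℕ) {P : (Fin n → ℕ) →₀ A} (h : P ∈ degenerate A n) :
    raiseWt t g P ∈ degenerate A (n + 1) := by
  rw [raiseWt, Finsupp.linearCombination_apply]
  refine Submodule.sum_mem _ fun ε hε => Submodule.smul_mem _ _ (Submodule.sum_mem _ fun ρ hρ => ?_)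
  obtain ⟨i, j, hij, hi, hj⟩ := (Finsupp.mem_supported A P).1 h hε
  refine Finsupp.single_mem_supported A _ ⟨i.succ, j.succ, by simpa using hij, ?_, ?_⟩
  · simp [hi]
  · simp [hj]

/-- Adding one to all exponents and appending a vanishing one. -/
def shiftSnoc {n : ℕ} (ε : Fin n → ℕ) : Fin (n + 1) → ℕ := Fin.snoc (fun i => ε i + 1) 0

theorem shiftSnoc_cons {n : ℕ} (g : ℕ) (γ : Fin n → ℕ) :
    shiftSnoc (Fin.cons g γ : Fin (n + 1) → ℕ) =
      (Fin.cons (g + 1) (shiftSnoc γ) : Fin (n + 2) → ℕ) := by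
  rw [shiftSnoc, shiftSnoc, Fin.cons_snoc_eq_snoc_cons]
  congr 1
  ext i
  refine Fin.cases ?_ (fun i => ?_) i <;> simp

theorem raiseWt_shiftSnoc {n : ℕ} (g : ℕ) (ε : Fin n → ℕ) :
    raiseWt t (g + 1) (Finsupp.single (shiftSnoc ε) 1) -
      Finsupp.mapDomain shiftSnoc (raiseWt t g (Finsupp.single ε 1)) ∈ degenerate A (n + 2) := by
  rw [raiseWt_single, raiseWt_single, one_smul, one_smul, Finsupp.mapDomain_finsetSum]
  have hinj : Function.Injective (fun ρ : Fin n → ℕ => (Fin.snoc ρ 0 : Fin (n + 1) → ℕ)) := by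
    intro a b h
    ext i
    simpa using congrFun h i.castSucc
  have hs : (Fintype.piFinset fun i => Finset.range (ε i + 1)).map
      ⟨fun ρ : Fin n → ℕ => (Fin.snoc ρ 0 : Fin (n + 1) → ℕ), hinj⟩ ⊆
      Fintype.piFinset fun i => Finset.range (shiftSnoc ε i + 1) := by
    intro ρ hρ
    simp only [Finset.mem_map, Fintype.mem_piFinset, Finset.mem_range,
      Function.Embedding.coeFn_mk] at hρ ⊢
    obtain ⟨ρ, hρ, rfl⟩ := hρ
    intro i
    refine Fin.lastCases ?_ (fun i => ?_) i
    · simp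
    · have := hρ i
      simp [shiftSnoc]
      omega
  rw [← Finset.sum_sdiff hs, Finset.sum_map, add_sub_assoc, ← Finset.sum_sub_distrib]
  refine Submodule.add_mem _ (Submodule.sum_mem _ fun ρ hρ => ?_)
    (Submodule.sum_mem _ fun ρ hρ => ?_)
  · simp only [Finset.mem_sdiff, Finset.mem_map, Fintype.mem_piFinset, Finset.mem_range,
      Function.Embedding.coeFn_mk, not_exists, not_and] at hρ
    obtain ⟨h1, h2⟩ := hρ
    have hl : ρ (Fin.last n) = 0 := by simpa [shiftSnoc] using h1 (Fin.last n)
    have : ∃ i : Fin n, ε i + 1 ≤ ρ i.castSucc := by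
      by_contra! hc
      refine h2 (fun i => ρ i.castSucc) hc ?_
      ext i
      refine Fin.lastCases ?_ (fun i => ?_) i
      · simp [hl]
      · simp
    obtain ⟨i, hi⟩ := this
    refine Finsupp.single_mem_supported A _
      ⟨i.castSucc.succ, (Fin.last n).succ, ?_, ?_, ?_⟩
    · simp
    · simp [shiftSnoc]
      omega
    · simp [shiftSnoc]
  · convert Submodule.zero_mem _
    rw [sub_eq_zero, Finsupp.mapDomain_single, Function.Embedding.coeFn_mk, shiftSnoc_cons]
    have h1 : ∑ i, (Fin.snoc ρ 0 : Fin (n + 1) → ℕ) i = ∑ i, ρ i := by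
      rw [Fin.sum_univ_castSucc]; simp
    have h2 : shiftSnoc ε - (Fin.snoc ρ 0 : Fin (n + 1) → ℕ) = shiftSnoc (ε - ρ) := by
      ext i
      refine Fin.lastCases ?_ (fun i => ?_) i
      · simp [shiftSnoc]
      · have := Finset.mem_range.1 (Fintype.mem_piFinset.1 hρ i)
        simp [shiftSnoc]
        omega
    rw [h1, h2]
    congr 2
    omega

theorem hlWeights_shiftSnoc {n : ℕ} (γ : Fin n → ℕ) :
    hlWeights t (shiftSnoc γ) - Finsupp.mapDomain shiftSnoc (hlWeights t γ) ∈
      degenerate A (n + 1) := by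
  induction n with
  | zero =>
    convert Submodule.zero_mem _
    rw [sub_eq_zero]
    simp only [hlWeights, raiseWt_single]
    simp only [Finsupp.mapDomain_single, one_smul]
    rw [Finset.sum_eq_single (0 : Fin 0 → ℕ)]
    · simp only [Finset.univ_eq_empty, Finset.sum_empty, pow_zero]
      congr 1
      ext i
      have : i = Fin.last 0 := by omega
      subst this
      simp [shiftSnoc]
    · intro b _ hb
      exact absurd (Subsingleton.elim _ _) hb
    · intro h
      exact absurd (Fintype.mem_piFinset.2 fun i => i.elim0) h
  | succ n ih =>
    obtain ⟨g, γ, rfl⟩ : ∃ g τ, γ = (Fin.cons g τ : Fin (n + 1) → ℕ) :=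
      ⟨γ 0, Fin.tail γ, (Fin.cons_self_tail γ).symm⟩
    rw [shiftSnoc_cons, hlWeights_cons, hlWeights_cons]
    have h1 := raiseWt_degenerate t (g + 1) (ih γ)
    rw [map_sub] at h1
    have h2 : ∀ P : (Fin n → ℕ) →₀ A, raiseWt t (g + 1) (Finsupp.mapDomain shiftSnoc P) -
        Finsupp.mapDomain shiftSnoc (raiseWt t g P) ∈ degenerate A (n + 2) := by
      intro P
      induction P using Finsupp.induction_linear with
      | zero => simp
      | add f g hf hg =>
        rw [Finsupp.mapDomain_add, map_add, map_add, Finsupp.mapDomain_add, add_sub_add_comm]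
        exact Submodule.add_mem _ hf hg
      | single ε a =>
        have := Submodule.smul_mem _ a (raiseWt_shiftSnoc t g ε)
        rw [smul_sub, ← map_smul, ← Finsupp.mapDomain_smul, ← map_smul] at this
        simpa [Finsupp.mapDomain_single] using this
    have := Submodule.add_mem _ h1 (h2 (hlWeights t γ))
    simpa using this

end Weights

section Theta

variable {A S : Type*} [CommRing A] [CommRing S] [Algebra A S] (t : A)

/-- The alternating form of the modified Hall-Littlewood function with exponent `γ`. -/
noncomputable def theta {n : ℕ} (γ : Fin n → ℕ) (y : Fin n → S) : S :=
  Finsupp.linearCombination A (alternant y) (hlWeights t γ)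

theorem linearCombination_degenerate {n : ℕ} {P : (Fin n → ℕ) →₀ A} (h : P ∈ degenerate A n)
    (y : Fin n → S) : Finsupp.linearCombination A (alternant y) P = 0 := by
  rw [Finsupp.linearCombination_apply]
  refine Finset.sum_eq_zero fun β hβ => ?_
  obtain ⟨i, j, hij, hi, hj⟩ := (Finsupp.mem_supported A P).1 h hβ
  exact (congrArg _ (alternant_eq_zero y hij (hi.trans hj.symm))).trans (smul_zero _)

theorem theta_shiftSnoc {n : ℕ} (γ : Fin n → ℕ) (y : Fin (n + 1) → S) :
    theta t (shiftSnoc γ) y =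
      Finsupp.linearCombination A (fun ε => alternant y (shiftSnoc ε)) (hlWeights t γ) := by
  have := linearCombination_degenerate (hlWeights_shiftSnoc t γ) y
  rw [map_sub, sub_eq_zero, Finsupp.linearCombination_mapDomain] at this
  exact this

theorem theta_cons {n : ℕ} (g : ℕ) (γ : Fin n → ℕ) (y : Fin (n + 1) → S) :
    theta t (Fin.cons g γ : Fin (n + 1) → ℕ) y =
      ∑ a : Fin (n + 1), (-1) ^ (a : ℕ) * y a ^ g *
        Finsupp.linearCombination A (fun ε => ∑ ρ ∈ Fintype.piFinset fun i => Finset.range (ε i + 1),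
          (t • y a) ^ (∑ i, ρ i) * alternant (y ∘ a.succAbove) (ε - ρ)) (hlWeights t γ) := by
  rw [theta, hlWeights_cons]
  induction hlWeights t γ using Finsupp.induction_linear with
  | zero => simp
  | add f g hf hg => simp only [map_add, hf, hg, mul_add, Finset.sum_add_distrib]
  | single ε c =>
    rw [raiseWt_single]
    simp only [map_smul, map_sum, Finsupp.linearCombination_single, Finset.mul_sum,
      alternant_cons, Finset.smul_sum]
    rw [Finset.sum_comm]
    refine Finset.sum_congr rfl fun a _ => Finset.sum_congr rfl fun ρ _ => ?_
    simp only [Algebra.smul_def, mul_pow, pow_add, map_pow]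
    ring

theorem theta_cons_of_factor [IsDomain S] {n : ℕ} (g : ℕ) (γ : Fin n → ℕ)
    (H : (Fin (n + 1) → S) → S) (δ : Fin n → ℕ)
    (hδ : ∀ (y : Fin n → S) (z : S), alternant (Fin.snoc y z : Fin (n + 1) → S) (shiftSnoc δ) =
      alternant y δ * ∏ j, (y j - z))
    (hH : ∀ Y : Fin (n + 1) → S, theta t (shiftSnoc γ) Y = alternant Y (shiftSnoc δ) * H Y)
    (y : Fin (n + 1) → S) (hy : ∀ j a, j ≠ a → y j ≠ t • y a) :
    theta t (Fin.cons g γ : Fin (n + 1) → ℕ) y =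
      ∑ a : Fin (n + 1), (-1) ^ (a : ℕ) * y a ^ g *
        (alternant (y ∘ a.succAbove) δ *
          H (Fin.snoc (y ∘ a.succAbove) (t • y a) : Fin (n + 1) → S)) := by
  rw [theta_cons]
  refine Finset.sum_congr rfl fun a _ => ?_
  congr 1
  have hne : ∏ j, ((y ∘ a.succAbove) j - t • y a) ≠ 0 :=
    Finset.prod_ne_zero_iff.2 fun j _ => sub_ne_zero.2 (hy _ _ (Fin.succAbove_ne a j))
  refine mul_left_cancel₀ hne ?_
  have h := hH (Fin.snoc (y ∘ a.succAbove) (t • y a) : Fin (n + 1) → S)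
  rw [hδ, theta_shiftSnoc] at h
  rw [← mul_assoc, mul_comm _ (alternant _ δ), ← h]
  induction hlWeights t γ using Finsupp.induction_linear with
  | zero => simp
  | add f g hf hg => simp only [map_add, mul_add, hf, hg]
  | single ε c =>
    simp only [Finsupp.linearCombination_single, mul_smul_comm]
    congr 1
    exact prod_mul_sum_alternant _ _ _

/-- The staircase exponent. -/
def stair (n : ℕ) (i : Fin n) : ℕ := n - 1 - i

theorem shiftSnoc_stair (n : ℕ) : shiftSnoc (stair n) = stair (n + 1) := by
  ext i
  refine Fin.lastCases ?_ (fun i => ?_) i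
  · simp [shiftSnoc, stair]
  · simp [shiftSnoc, stair]
    omega

theorem stair_succ (n : ℕ) : stair (n + 1) = (Fin.cons n (stair n) : Fin (n + 1) → ℕ) := by
  ext i
  refine Fin.cases ?_ (fun i => ?_) i
  · simp [stair]
  · simp [stair]
    omega

theorem alternant_stair {n : ℕ} (y : Fin n → S) :
    alternant y (stair n) = (Matrix.vandermonde (y ∘ Fin.rev)).det := by
  rw [alternant, ← Matrix.det_transpose, ← Matrix.det_submatrix_equiv_self Fin.revPerm]
  congr 1
  ext i j
  simp only [Matrix.submatrix_apply, Matrix.transpose_apply, Matrix.of_apply, Fin.revPerm_apply,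
    Matrix.vandermonde_apply, Function.comp, stair, Fin.val_rev]
  congr 1
  omega

theorem alternant_snoc_stair {n : ℕ} (y : Fin n → S) (z : S) :
    alternant (Fin.snoc y z : Fin (n + 1) → S) (shiftSnoc (stair n)) =
      alternant y (stair n) * ∏ j, (y j - z) := by
  rw [shiftSnoc_stair, alternant_stair, alternant_stair, Fin.snoc_comp_rev, Matrix.det_vandermonde,
    Matrix.det_vandermonde, Fin.prod_univ_succ, mul_comm]
  congr 1
  · refine Finset.prod_congr rfl fun i _ => ?_
    rw [← Fin.map_succEmb_Ioi, Finset.prod_map]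
    simp
  · rw [Fin.Ioi_zero_eq_map, Finset.prod_map, ← Equiv.prod_comp Fin.revPerm]
    simp

theorem theta_stair {n : ℕ} (y : Fin n → S) :
    theta t (stair n) y = alternant y (stair n) := by
  induction n with
  | zero => simp [theta, hlWeights]
  | succ n ih =>
    have key : ∀ (ε : Fin n → ℕ), alternant y (shiftSnoc ε) =
        ∑ j : Fin (n + 1), (-1) ^ (n + j : ℕ) * (∏ i, y (j.succAbove i)) *
          alternant (y ∘ j.succAbove) ε := by
      intro ε
      rw [alternant, Matrix.det_succ_row _ (Fin.last n)]
      refine Finset.sum_congr rfl fun j _ => ?_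
      simp only [Matrix.of_apply, shiftSnoc, Fin.snoc_last, pow_zero, mul_one, Fin.val_last,
        mul_assoc, alternant]
      rw [← Matrix.det_mul_row]
      congr 2
      ext a b
      simp [pow_succ, mul_comm]
    rw [← shiftSnoc_stair, theta_shiftSnoc, key]
    simp only [← ih]
    simp only [theta, key]
    induction hlWeights t (stair n) using Finsupp.induction_linear with
    | zero => simp
    | add f g hf hg => simp only [map_add, mul_add, hf, hg, Finset.sum_add_distrib]
    | single ε c => simp [Finset.smul_sum]

end Theta

section

variable {S : Type*} [CommRing S]

theorem alternant_eq_sum {n : ℕ} (y : Fin n → S) (β : Fin n → ℕ) :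
    alternant y β = ∑ w : Equiv.Perm (Fin n), (Equiv.Perm.sign w : S) * ∏ i, y (w i) ^ β i := by
  rw [alternant, ← Matrix.det_transpose, Matrix.det_apply']
  rfl

theorem sum_alternant_add {n : ℕ} {ι : Type*} (s : Finset ι) (c : ι → S) (v : ι → Fin n → ℕ)
    (δ : Fin n → ℕ) (y : Fin n → S)
    (h : ∀ w : Equiv.Perm (Fin n), ∑ M ∈ s, c M * ∏ i, y (w i) ^ v M i =
      ∑ M ∈ s, c M * ∏ i, y i ^ v M i) :
    ∑ M ∈ s, c M * alternant y (v M + δ) =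
      alternant y δ * ∑ M ∈ s, c M * ∏ i, y i ^ v M i := by
  simp only [alternant_eq_sum, Finset.mul_sum (Finset.univ (α := Equiv.Perm (Fin n)))]
  rw [Finset.sum_comm, Finset.sum_mul]
  refine Finset.sum_congr rfl fun w _ => ?_
  rw [← h w, Finset.mul_sum]
  refine Finset.sum_congr rfl fun M _ => ?_
  simp only [Pi.add_apply, pow_add, Finset.prod_mul_distrib]
  ring

theorem sum_configs_perm {n : ℕ} {μ : List ℕ} (hμ : μ.Pairwise (· ≥ ·)) (t : S)
    (F : (Fin (n + 1) → ℕ) → S) (w : Equiv.Perm (Fin (n + 1))) :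
    ∑ M ∈ configs n μ, term n t F M = ∑ M ∈ configs n μ, term n t (fun α => F (α ∘ w)) M := by
  have hw : w ∈ Submonoid.closure
      (Set.range fun i : Fin n => Equiv.swap i.castSucc i.succ) := by
    rw [Equiv.Perm.mclosure_swap_castSucc_succ]
    trivial
  induction hw using Submonoid.closure_induction generalizing F with
  | mem w hw =>
    obtain ⟨i, rfl⟩ := hw
    exact sum_configs_swap hμ t F i
  | one => rfl
  | mul a b _ _ ha hb => rw [hb F, ha]; rfl

/-- The generating polynomial of configurations. -/
noncomputable def genFn (n : ℕ) (t : S) (μ : List ℕ) (y : Fin (n + 1) → S) : S :=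
  ∑ M ∈ configs n μ, term n t (fun α => ∏ i, y i ^ α i) M

theorem genFn_perm {n : ℕ} {μ : List ℕ} (hμ : μ.Pairwise (· ≥ ·)) (t : S) (y : Fin (n + 1) → S)
    (w : Equiv.Perm (Fin (n + 1))) : genFn n t μ (y ∘ w) = genFn n t μ y := by
  rw [genFn, sum_configs_perm hμ t _ w, genFn]
  refine Finset.sum_congr rfl fun M _ => ?_
  simp only [term, Function.comp]
  congr 1
  exact Equiv.prod_comp w (fun i => y i ^ wt n M i)

theorem sum_term_alternant {n : ℕ} {μ : List ℕ} (hμ : μ.Pairwise (· ≥ ·)) (t : S)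
    (δ : Fin (n + 1) → ℕ) (y : Fin (n + 1) → S) :
    ∑ M ∈ configs n μ, term n t (fun α => alternant y (α + δ)) M =
      alternant y δ * genFn n t μ y :=
  sum_alternant_add _ _ _ δ y fun w => genFn_perm hμ t y w

/-- The function on `Fin n` listing the entries of a list, padded with zeros. -/
def pad (n : ℕ) (μ : List ℕ) (i : Fin n) : ℕ := μ.getD i 0

theorem pad_cons (n m : ℕ) (μ : List ℕ) :
    pad (n + 1) (m :: μ) = (Fin.cons m (pad n μ) : Fin (n + 1) → ℕ) := by
  ext i
  refine Fin.cases ?_ (fun i => ?_) i <;> simp [pad]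

theorem pad_add_stair {n : ℕ} {μ : List ℕ} (h : μ.length ≤ n) :
    pad (n + 1) μ + stair (n + 1) = shiftSnoc (pad n μ + stair n) := by
  ext i
  refine Fin.lastCases ?_ (fun i => ?_) i
  · simp [shiftSnoc, pad, stair, h]
  · simp [shiftSnoc, pad, stair]
    omega

theorem dotAlt_alternant (n : ℕ) (y : Fin (n + 1) → S) :
    DotAlt n fun α => alternant y (α + stair (n + 1)) := by
  intro i hi α β h h1 h2
  have hs : β + stair (n + 1) =
      (α + stair (n + 1)) ∘ Equiv.swap (⟨i, by omega⟩ : Fin (n + 1)) ⟨i + 1, by omega⟩ := by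
    ext j
    simp only [Pi.add_apply, Function.comp, stair]
    by_cases hj : j = ⟨i, by omega⟩
    · subst hj
      simp
      omega
    · by_cases hj' : j = ⟨i + 1, by omega⟩
      · subst hj'
        simp
        omega
      · rw [Equiv.swap_apply_of_ne_of_ne hj hj',
          h j (fun e => hj (Fin.ext e)) (fun e => hj' (Fin.ext e))]
  have hp := Matrix.det_permute (Equiv.swap (⟨i, by omega⟩ : Fin (n + 1)) ⟨i + 1, by omega⟩)
    (Matrix.of fun i j => y j ^ (α + stair (n + 1)) i)
  rw [Equiv.Perm.sign_swap (by simp)] at hp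
  simp only [hs]
  refine hp.trans ?_
  simp [alternant]

theorem sum_term_cons [IsDomain S] [CharZero S] {n m : ℕ} {μ : List ℕ}
    (hμ : (m :: μ).Pairwise (· ≥ ·)) (t : S)
    (y : Fin (n + 1) → S) :
    ∑ M ∈ configs n (m :: μ), term n t (fun α => alternant y (α + stair (n + 1))) M =
      ∑ a : Fin (n + 1), (-1) ^ (a : ℕ) * y a ^ (m + n) *
        (alternant (y ∘ a.succAbove) (stair n) *
          genFn n t μ (Fin.snoc (y ∘ a.succAbove) (t * y a) : Fin (n + 1) → S)) := by
  have key : ∀ a : Fin (n + 1), alternant (y ∘ a.succAbove) (stair n) *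
          genFn n t μ (Fin.snoc (y ∘ a.succAbove) (t * y a) : Fin (n + 1) → S) =
      ∑ M ∈ configs n μ, (t ^ (energy n M).toNat * (t * y a) ^ wt n M (Fin.last n)) *
        alternant (y ∘ a.succAbove) ((fun j : Fin n => wt n M j.castSucc) + stair n) := by
    intro a
    have hg : ∀ y' : Fin n → S, genFn n t μ (Fin.snoc y' (t * y a) : Fin (n + 1) → S) =
        ∑ M ∈ configs n μ, (t ^ (energy n M).toNat * (t * y a) ^ wt n M (Fin.last n)) *
          ∏ i : Fin n, y' i ^ wt n M i.castSucc := by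
      intro y'
      refine Finset.sum_congr rfl fun M _ => ?_
      simp only [term, Fin.prod_univ_castSucc, Fin.snoc_castSucc, Fin.snoc_last]
      ring
    rw [sum_alternant_add, hg]
    intro w
    have h1 := hg (y ∘ a.succAbove)
    have h2 := hg ((y ∘ a.succAbove) ∘ w)
    refine h2.symm.trans (Eq.trans ?_ h1)
    rw [← genFn_perm (List.pairwise_cons.1 hμ).2 t
      (Fin.snoc (y ∘ a.succAbove) (t * y a) : Fin (n + 1) → S)
      ((finSuccEquivLast.trans (Equiv.optionCongr w)).trans finSuccEquivLast.symm)]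
    congr 1
    ext i
    refine Fin.lastCases ?_ (fun i => ?_) i <;> simp
  rw [sum_configs_cons_rot hμ t (dotAlt_alternant n y)]
  simp only [key]
  simp only [Finset.mul_sum]
  rw [Finset.sum_comm]
  refine Finset.sum_congr rfl fun M _ => ?_
  have h1 : (Fin.cons (m + wt n M (Fin.last n)) fun j : Fin n => wt n M j.castSucc) +
      stair (n + 1) = (Fin.cons (m + n + wt n M (Fin.last n))
        ((fun j : Fin n => wt n M j.castSucc) + stair n) : Fin (n + 1) → ℕ) := by
    rw [stair_succ]
    ext i
    refine Fin.cases ?_ (fun i => ?_) i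
    · simp
      omega
    · simp
  rw [h1, alternant_cons, Finset.mul_sum, Finset.mul_sum]
  refine Finset.sum_congr rfl fun a _ => ?_
  ring

end

section

variable {A : Type*} [CommRing A] [IsDomain A] [CharZero A] (t : A)

theorem theta_eq_genFn {n : ℕ} {μ : List ℕ} (hμ : μ.Pairwise (· ≥ ·)) (hl : μ.length ≤ n + 1)
    (y : Fin (n + 1) → MvPolynomial (Fin (n + 1)) A) :
    theta t (pad (n + 1) μ + stair (n + 1)) y =
      alternant y (stair (n + 1)) * genFn n (C t) μ y := by
  induction μ generalizing y with
  | nil =>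
    have h0 : pad (n + 1) [] + stair (n + 1) = stair (n + 1) := by
      ext i
      simp [pad]
    have h1 : configs n [] = {[]} := by
      ext M
      simp [mem_configs, Shape]
    have h2 : energy n [] = 0 := by simp [energy]
    have h3 : wt n [] = 0 := by
      ext i
      simp [wt, count]
    rw [h0, theta_stair, genFn, h1, Finset.sum_singleton, term, h2, h3]
    simp
  | cons m μ ih =>
    have hμ' := (List.pairwise_cons.1 hμ).2
    have hl' : μ.length ≤ n := by simpa using hl
    have h0 : pad (n + 1) (m :: μ) + stair (n + 1) =
        (Fin.cons (m + n) (pad n μ + stair n) : Fin (n + 1) → ℕ) := by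
      rw [pad_cons, stair_succ]
      ext i
      refine Fin.cases ?_ (fun i => ?_) i <;> simp
    have hX : theta t (pad (n + 1) (m :: μ) + stair (n + 1))
        (X : Fin (n + 1) → MvPolynomial (Fin (n + 1)) A) =
        ∑ M ∈ configs n (m :: μ), term n (C t) (fun α => alternant X (α + stair (n + 1))) M := by
      rw [h0, theta_cons_of_factor t (m + n) _ (genFn n (C t) μ) (stair n)
        (fun y z => alternant_snoc_stair y z), sum_term_cons hμ]
      · simp only [smul_eq_C_mul]
      · intro Y
        rw [← pad_add_stair hl', shiftSnoc_stair]
        exact ih hμ' (by omega) Y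
      · intro j a hja h
        have := congrArg (coeff (Finsupp.single j 1)) h
        rw [coeff_smul, coeff_X, coeff_X, if_pos rfl, if_neg] at this
        · simp at this
        · intro h'
          exact hja ((Finsupp.single_left_injective one_ne_zero h').symm)
    rw [sum_term_alternant hμ] at hX
    have := congrArg (aeval y) hX
    have hA : ∀ β, aeval y (alternant (X : Fin (n + 1) → MvPolynomial (Fin (n + 1)) A) β) =
        alternant y β := by
      intro β
      simp [alternant_eq_sum]
    rw [map_mul, hA] at this
    simp only [theta, genFn, term, Finsupp.linearCombination_apply, Finsupp.sum, map_sum, map_smul, hA,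
      map_mul, map_pow, map_prod, aeval_X, aeval_C] at this ⊢
    exact this

end

section

variable {A : Type*} [CommRing A] (t : A)

theorem toLex_cons_le {n : ℕ} {g b : ℕ} {γ β : Fin n → ℕ} (h : g < b ∨ g = b ∧ toLex γ ≤ toLex β) :
    toLex (Fin.cons g γ : Fin (n + 1) → ℕ) ≤ toLex (Fin.cons b β : Fin (n + 1) → ℕ) := by
  obtain h | ⟨rfl, h⟩ := h
  · exact le_of_lt ⟨0, fun j hj => absurd hj (Fin.not_lt_zero j), by simpa using h⟩
  · obtain h | ⟨i, h1, h2⟩ := h.eq_or_lt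
    · rw [toLex_inj] at h
      rw [h]
    · refine le_of_lt ⟨i.succ, fun j hj => ?_, by simpa using h2⟩
      induction j using Fin.cases with
      | zero => rfl
      | succ j => simpa using h1 j (by simpa using hj)

theorem hlWeights_mem_supported {n : ℕ} (γ : Fin n → ℕ) :
    hlWeights t γ ∈ Finsupp.supported A A {β | toLex γ ≤ toLex β} := by
  induction n with
  | zero => exact Finsupp.single_mem_supported A _ (le_refl (toLex γ))
  | succ n ih =>
    obtain ⟨g, γ, rfl⟩ : ∃ g τ, γ = (Fin.cons g τ : Fin (n + 1) → ℕ) :=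
      ⟨γ 0, Fin.tail γ, (Fin.cons_self_tail γ).symm⟩
    rw [hlWeights_cons, raiseWt, Finsupp.linearCombination_apply]
    refine Submodule.sum_mem _ fun ε hε => Submodule.smul_mem _ _
      (Submodule.sum_mem _ fun ρ hρ => Finsupp.single_mem_supported A _ ?_)
    have hε' : toLex γ ≤ toLex ε := (Finsupp.mem_supported A _).1 (ih γ) hε
    refine toLex_cons_le ?_
    rcases Nat.eq_zero_or_pos (∑ i, ρ i) with h | h
    · have : ρ = 0 := by
        ext i
        exact Finset.sum_eq_zero_iff.1 h i (Finset.mem_univ i)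
      subst this
      right
      simpa using hε'
    · left
      omega

theorem raiseWt_apply_self {n : ℕ} (g : ℕ) (P : (Fin n → ℕ) →₀ A) (γ : Fin n → ℕ) :
    raiseWt t g P (Fin.cons g γ : Fin (n + 1) → ℕ) = P γ := by
  induction P using Finsupp.induction_linear with
  | zero => simp
  | add f h hf hh => rw [map_add, Finsupp.add_apply, hf, hh, Finsupp.add_apply]
  | single ε c =>
    rw [raiseWt_single, Finsupp.smul_apply, Finset.sum_apply', Finset.sum_eq_single 0]
    · simp [Finsupp.single_apply]
    · intro ρ _ hρ
      rw [Finsupp.single_apply, if_neg]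
      intro h
      rw [Fin.cons_inj] at h
      refine hρ ?_
      ext i
      have h0 : ∑ i, ρ i = 0 := by omega
      exact Finset.sum_eq_zero_iff.1 h0 i (Finset.mem_univ i)
    · intro h
      exact absurd (Fintype.mem_piFinset.2 fun i => by simp) h

theorem hlWeights_self {n : ℕ} (γ : Fin n → ℕ) : hlWeights t γ γ = 1 := by
  induction n with
  | zero => simp [hlWeights]
  | succ n ih =>
    obtain ⟨g, γ, rfl⟩ : ∃ g τ, γ = (Fin.cons g τ : Fin (n + 1) → ℕ) :=
      ⟨γ 0, Fin.tail γ, (Fin.cons_self_tail γ).symm⟩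
    rw [hlWeights_cons, raiseWt_apply_self, ih]

/-- The linear form whose value on `x ^ β` is the coefficient of `β` in `hlWeights t γ`. -/
noncomputable def pairing {n : ℕ} (γ : Fin n → ℕ) : MvPolynomial (Fin n) A →ₗ[A] A :=
  (basisMonomials (Fin n) A).constr A fun β => hlWeights t γ β

theorem pairing_monomial {n : ℕ} (γ : Fin n → ℕ) (β : Fin n →₀ ℕ) (a : A) :
    pairing t γ (monomial β a) = a * hlWeights t γ β := by
  have h : monomial β a = a • basisMonomials (Fin n) A β := by
    simp [smul_monomial]
  rw [h, map_smul, pairing, Module.Basis.constr_basis, smul_eq_mul]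

theorem pairing_eq_coeff {n : ℕ} (γ : Fin n →₀ ℕ) (f : MvPolynomial (Fin n) A)
    (h : ∀ β ∈ f.support, toLex (β : Fin n → ℕ) ≤ toLex (γ : Fin n → ℕ)) :
    pairing t γ f = coeff γ f := by
  conv_lhs => rw [f.as_sum]
  rw [map_sum]
  simp only [pairing_monomial]
  rw [Finset.sum_eq_single γ]
  · rw [hlWeights_self, mul_one]
  · intro β hβ hne
    have hz : hlWeights t (γ : Fin n → ℕ) β = 0 := by
      by_contra hc
      have h1 := (Finsupp.mem_supported A _).1 (hlWeights_mem_supported t γ)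
        (Finsupp.mem_support_iff.2 hc)
      exact hne (DFunLike.coe_injective (toLex_inj.1 ((h β hβ).antisymm h1)))
    rw [hz, mul_zero]
  · intro h
    rw [notMem_support_iff.1 h, zero_mul]

theorem prod_X_pow_perm {n : ℕ} (β : Fin n → ℕ) (w : Equiv.Perm (Fin n)) :
    ∏ i, (X (w i) : MvPolynomial (Fin n) A) ^ β i =
      monomial (Finsupp.equivFunOnFinite.symm (β ∘ w.symm)) 1 := by
  rw [monomial_eq, Finsupp.prod_fintype _ _ (by simp), C_1, one_mul,
    ← Equiv.prod_comp w.symm]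
  simp

theorem coeff_theta {n : ℕ} (γ κ : Fin n → ℕ) :
    coeff (Finsupp.equivFunOnFinite.symm κ)
        (theta t γ (X : Fin n → MvPolynomial (Fin n) A)) =
      pairing t γ (alternant X κ) := by
  have h1 : coeff (Finsupp.equivFunOnFinite.symm κ)
        (theta t γ (X : Fin n → MvPolynomial (Fin n) A)) =
      ∑ w : Equiv.Perm (Fin n), (Equiv.Perm.sign w : A) * hlWeights t γ (κ ∘ w) := by
    rw [theta]
    induction hlWeights t γ using Finsupp.induction_linear with
    | zero => simp
    | add f g hf hg => simp [map_add, hf, hg, mul_add, Finset.sum_add_distrib]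
    | single β c =>
      rw [Finsupp.linearCombination_single, alternant_eq_sum, Finset.smul_sum, coeff_sum]
      refine Finset.sum_congr rfl fun w _ => ?_
      rw [prod_X_pow_perm, Finsupp.single_apply]
      have h0 : ((Equiv.Perm.sign w : ℤ) : MvPolynomial (Fin n) A) =
        C ((Equiv.Perm.sign w : ℤ) : A) := by simp
      rw [coeff_smul, h0, coeff_C_mul, coeff_monomial, smul_eq_mul]
      have h2 : (Finsupp.equivFunOnFinite.symm (β ∘ w.symm) : Fin n →₀ ℕ) =
          Finsupp.equivFunOnFinite.symm κ ↔ β = κ ∘ w := by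
        rw [Finsupp.equivFunOnFinite.symm.injective.eq_iff]
        constructor
        · rintro rfl
          ext
          simp
        · rintro rfl
          ext
          simp
      by_cases h : β = κ ∘ w
      · rw [if_pos (h2.2 h), if_pos h]
        ring
      · rw [if_neg (fun h' => h (h2.1 h')), if_neg h]
        ring
  rw [h1, alternant_eq_sum, map_sum, ← Equiv.sum_comp (Equiv.inv (Equiv.Perm (Fin n)))]
  refine Finset.sum_congr rfl fun w _ => ?_
  rw [prod_X_pow_perm]
  have h0 : ((Equiv.Perm.sign w : ℤ) : MvPolynomial (Fin n) A) =
        C ((Equiv.Perm.sign w : ℤ) : A) := by simp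
  rw [h0, C_mul_monomial, pairing_monomial, mul_one]
  simp

theorem coeff_alternant {n : ℕ} {β κ : Fin n → ℕ} (hβ : StrictAnti β) (hκ : StrictAnti κ) :
    coeff (Finsupp.equivFunOnFinite.symm κ) (alternant (X : Fin n → MvPolynomial (Fin n) A) β) =
      if β = κ then 1 else 0 := by
  rw [alternant_eq_sum, coeff_sum, Finset.sum_eq_single 1]
  · rw [prod_X_pow_perm]
    simp only [Equiv.Perm.sign_one, Units.val_one, Int.cast_one, one_mul, coeff_monomial]
    congr 1
    simp only [eq_iff_iff]
    rw [Finsupp.equivFunOnFinite.symm.injective.eq_iff]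
    exact Iff.rfl
  · intro w _ hw
    have h0 : ((Equiv.Perm.sign w : ℤ) : MvPolynomial (Fin n) A) =
        C ((Equiv.Perm.sign w : ℤ) : A) := by simp
    rw [prod_X_pow_perm, h0, coeff_C_mul, coeff_monomial, if_neg, mul_zero]
    intro h
    rw [Finsupp.equivFunOnFinite.symm.injective.eq_iff] at h
    have hm : StrictMono w.symm := by
      intro i j hij
      have h1 := hκ hij
      rw [← h] at h1
      exact hβ.lt_iff_gt.1 h1
    have h2 := (hm.range_inj strictMono_id).1 (by simp [w.symm.surjective.range_eq])
    refine hw ?_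
    ext i
    have := congrFun h2 (w i)
    simp at this
    rw [← this]
    rfl
  · intro h
    exact absurd (Finset.mem_univ _) h

theorem strictAnti_add_stair {n : ℕ} {μ : Fin n → ℕ} (h : Antitone μ) :
    StrictAnti (μ + stair n) := by
  intro i j hij
  have := h hij.le
  have h1 : (i : ℕ) < j := hij
  simp only [Pi.add_apply, stair]
  omega

/-- The generating polynomial by energy of ballot configurations of shape `μ` and weight `l`. -/
noncomputable def kostka (n : ℕ) (t : A) (μ : List ℕ) (l : Fin (n + 1) → ℕ) : A :=
  open Classical in
  ∑ M ∈ configs n μ with firstBad n 0 M = none ∧ wt n M = l, t ^ (energy n M).toNat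

theorem pairing_alternant [IsDomain A] [CharZero A] {n : ℕ} {μ : List ℕ}
    (hμ : μ.Pairwise (· ≥ ·)) (hlen : μ.length ≤ n + 1) {l : Fin (n + 1) → ℕ} (hl : Antitone l) :
    pairing t (pad (n + 1) μ + stair (n + 1)) (alternant X (l + stair (n + 1))) =
      kostka n t μ l := by
  classical
  rw [← coeff_theta, theta_eq_genFn t hμ hlen, ← sum_term_alternant hμ,
    sum_configs_eq_ballot hμ _ (dotAlt_alternant n _), coeff_sum, kostka, ← Finset.filter_filter,
    Finset.sum_filter (fun M => wt n M = l)]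
  refine Finset.sum_congr rfl fun M hM => ?_
  rw [Finset.mem_filter, mem_configs] at hM
  rw [term, ← C_pow, coeff_C_mul, coeff_alternant (strictAnti_add_stair (wt_antitone hM.1 hM.2))
    (strictAnti_add_stair hl)]
  simp

end

theorem toLex_comp_le {n : ℕ} {κ : Fin n → ℕ} (h : Antitone κ) (w : Equiv.Perm (Fin n)) :
    toLex (κ ∘ w) ≤ toLex κ := by
  by_contra hc
  obtain ⟨i, h1, h2⟩ := not_le.1 hc
  simp only [Pi.toLex_apply, Function.comp] at h1 h2
  have hcard : (Finset.univ.filter fun j => κ i < κ (w j)).card =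
      (Finset.univ.filter fun j => κ i < κ j).card :=
    Finset.card_bij (fun j _ => w j) (by simp) (by simp)
      (fun j hj => ⟨w.symm j, by simpa using hj, by simp⟩)
  have hlt : (Finset.univ.filter fun j => κ i < κ j).card <
      (Finset.univ.filter fun j => κ i < κ (w j)).card := by
    refine Finset.card_lt_card (Finset.ssubset_iff.2 ⟨i, by simp, ?_⟩)
    intro j hj
    simp only [Finset.mem_insert, Finset.mem_filter, Finset.mem_univ, true_and] at hj ⊢
    obtain rfl | hj := hj
    · exact h2
    · have hji : j < i := by
        by_contra! hle
        exact absurd (h hle) (not_le.2 hj)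
      rwa [← h1 j hji]
  omega

section

variable {A : Type*} [CommRing A]

/-- All exponents of `f` are lexicographically at most `γ`, whose coefficient is `c`. -/
def LexLead {n : ℕ} (f : MvPolynomial (Fin n) A) (γ : Fin n → ℕ) (c : A) : Prop :=
  (∀ β : Fin n →₀ ℕ, coeff β f ≠ 0 → toLex (β : Fin n → ℕ) ≤ toLex γ) ∧
    coeff (Finsupp.equivFunOnFinite.symm γ) f = c

theorem LexLead.mul {n : ℕ} {f g : MvPolynomial (Fin n) A} {γ κ : Fin n → ℕ} {c d : A}
    (hf : LexLead f γ c) (hg : LexLead g κ d) : LexLead (f * g) (γ + κ) (c * d) := by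
  refine ⟨fun β hβ => ?_, ?_⟩
  · rw [coeff_mul] at hβ
    obtain ⟨⟨a, b⟩, hab, hne⟩ := Finset.exists_ne_zero_of_sum_ne_zero hβ
    rw [Finset.HasAntidiagonal.mem_antidiagonal] at hab
    have := add_le_add (hf.1 a (left_ne_zero_of_mul hne)) (hg.1 b (right_ne_zero_of_mul hne))
    rw [← toLex_add, ← toLex_add, ← Finsupp.coe_add] at this
    rwa [← hab]
  · rw [coeff_mul, Finset.sum_eq_single
      (Finsupp.equivFunOnFinite.symm γ, Finsupp.equivFunOnFinite.symm κ)]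
    · rw [hf.2, hg.2]
    · rintro ⟨a, b⟩ hab hne
      rw [Finset.HasAntidiagonal.mem_antidiagonal] at hab
      by_contra h
      have ha := hf.1 a (left_ne_zero_of_mul h)
      have hb := hg.1 b (right_ne_zero_of_mul h)
      have hsum : toLex (a : Fin n → ℕ) + toLex (b : Fin n → ℕ) = toLex γ + toLex κ := by
        rw [← toLex_add, ← toLex_add, ← Finsupp.coe_add]
        simp only at hab
        rw [hab]
        rfl
      have ha' : toLex (a : Fin n → ℕ) = toLex γ := by
        refine ha.antisymm (le_of_add_le_add_right (a := toLex κ) ?_)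
        rw [← hsum]
        exact add_le_add_right hb _
      have hb' : toLex (b : Fin n → ℕ) = toLex κ := by
        rw [ha'] at hsum
        exact add_left_cancel hsum
      refine hne (Prod.ext ?_ ?_)
      · exact DFunLike.coe_injective (toLex_inj.1 ha')
      · exact DFunLike.coe_injective (toLex_inj.1 hb')
    · intro h
      refine absurd (Finset.HasAntidiagonal.mem_antidiagonal.2 ?_) h
      ext i
      simp

theorem LexLead.one (n : ℕ) : LexLead (1 : MvPolynomial (Fin n) A) 0 1 := by
  classical
  refine ⟨fun β hβ => ?_, ?_⟩
  · rw [coeff_one] at hβ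
    have : 0 = β := by
      by_contra h
      exact hβ (if_neg h)
    subst this
    rfl
  · rw [coeff_one, if_pos]
    ext
    simp

theorem LexLead.prod {n : ℕ} {ι : Type*} (s : Finset ι) {f : ι → MvPolynomial (Fin n) A}
    {γ : ι → Fin n → ℕ} {c : ι → A} (h : ∀ i ∈ s, LexLead (f i) (γ i) (c i)) :
    LexLead (∏ i ∈ s, f i) (∑ i ∈ s, γ i) (∏ i ∈ s, c i) := by
  classical
  induction s using Finset.induction_on with
  | empty => simpa using LexLead.one n
  | insert a s ha ih =>
    rw [Finset.prod_insert ha, Finset.sum_insert ha, Finset.prod_insert ha]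
    exact (h a (by simp)).mul (ih fun i hi => h i (by simp [hi]))

theorem LexLead.sum {n : ℕ} {ι : Type*} (s : Finset ι) {f : ι → MvPolynomial (Fin n) A}
    {γ : Fin n → ℕ} {c : ι → A} (h : ∀ i ∈ s, LexLead (f i) γ (c i)) :
    LexLead (∑ i ∈ s, f i) γ (∑ i ∈ s, c i) := by
  refine ⟨fun β hβ => ?_, ?_⟩
  · rw [coeff_sum] at hβ
    obtain ⟨i, hi, hne⟩ := Finset.exists_ne_zero_of_sum_ne_zero hβ
    exact (h i hi).1 β hne
  · rw [coeff_sum]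
    exact Finset.sum_congr rfl fun i hi => (h i hi).2

theorem LexLead.const_mul {n : ℕ} {f : MvPolynomial (Fin n) A} {γ : Fin n → ℕ} {c : A}
    (h : LexLead f γ c) (a : A) : LexLead (C a * f) γ (a * c) := by
  refine ⟨fun β hβ => h.1 β fun h0 => hβ ?_, ?_⟩
  · rw [coeff_C_mul, h0, mul_zero]
  · rw [coeff_C_mul, h.2]

theorem LexLead.mono {n : ℕ} {f : MvPolynomial (Fin n) A} {γ κ : Fin n → ℕ} {c : A}
    (h : LexLead f γ c) (hlt : toLex γ < toLex κ) : LexLead f κ 0 := by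
  refine ⟨fun β hβ => (h.1 β hβ).trans hlt.le, ?_⟩
  by_contra hc
  exact absurd (h.1 _ hc) (not_le.2 hlt)

theorem LexLead.of_le {n : ℕ} {f : MvPolynomial (Fin n) A} {γ κ : Fin n → ℕ} {c : A}
    (h : LexLead f γ c) (hle : toLex γ ≤ toLex κ) : LexLead f κ (if γ = κ then c else 0) := by
  obtain h' | h' := hle.eq_or_lt
  · rw [toLex_inj] at h'
    subst h'
    rwa [if_pos rfl]
  · rw [if_neg]
    · exact h.mono h'
    · rintro rfl
      exact lt_irrefl _ h'

theorem LexLead.pairing_eq (t : A) {n : ℕ} {f : MvPolynomial (Fin n) A} {γ : Fin n → ℕ} {c : A}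
    (h : LexLead f γ c) : pairing t γ f = c := by
  rw [← h.2]
  exact pairing_eq_coeff t (Finsupp.equivFunOnFinite.symm γ) f
    fun β hβ => h.1 β (mem_support_iff.1 hβ)

theorem LexLead.monomial {n : ℕ} (γ : Fin n → ℕ) :
    LexLead (MvPolynomial.monomial (Finsupp.equivFunOnFinite.symm γ) (1 : A)) γ 1 := by
  classical
  refine ⟨fun β hβ => ?_, by simp⟩
  rw [coeff_monomial] at hβ
  have : Finsupp.equivFunOnFinite.symm γ = β := by
    by_contra h
    exact hβ (if_neg h)
  subst this
  rfl

theorem LexLead.X_sub {n : ℕ} (t : A) {a b : Fin n} (h : a ≠ b) :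
    LexLead (X a - C t * X b) (Pi.single (min a b) 1) (if a < b then 1 else -t) := by
  classical
  have hX : ∀ a : Fin n, LexLead (X a : MvPolynomial (Fin n) A) (Pi.single a 1) 1 := by
    intro a
    have := LexLead.monomial (A := A) (Pi.single a 1 : Fin n → ℕ)
    convert this using 1
    rw [X]
    congr 1
    ext i
    simp
  have hlt : ∀ a b : Fin n, a < b →
      toLex (Pi.single b 1 : Fin n → ℕ) < toLex (Pi.single a 1 : Fin n → ℕ) := by
    intro a b hab
    refine ⟨a, fun j hj => ?_, ?_⟩
    · simp [hj.ne, (hj.trans hab).ne]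
    · simp [hab.ne]
  have hsum : (X a - C t * X b : MvPolynomial (Fin n) A) =
      ∑ i : Fin 2, ![X a, C (-t) * X b] i := by
    simp [sub_eq_add_neg]
  rw [hsum]
  rcases lt_or_gt_of_ne h with hab | hab
  · have := LexLead.sum (Finset.univ) (γ := Pi.single a 1) (f := ![X a, C (-t) * X b])
      (c := ![1, 0]) (by
        intro i _
        fin_cases i
        · exact hX a
        · exact ((hX b).const_mul (-t)).mono (hlt a b hab))
    rw [if_pos hab, min_eq_left hab.le]
    simpa using this
  · have := LexLead.sum (Finset.univ) (γ := Pi.single b 1) (f := ![X a, C (-t) * X b])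
      (c := ![0, -t]) (by
        intro i _
        fin_cases i
        · exact (hX a).mono (hlt b a hab)
        · simpa using (hX b).const_mul (-t))
    rw [if_neg hab.not_gt, min_eq_right hab.le]
    simpa using this

/-- The numerator of a Hall-Littlewood polynomial. -/
noncomputable def hlPoly {n : ℕ} (t : A) (ν : Fin n → ℕ) : MvPolynomial (Fin n) A :=
  ∑ w : Equiv.Perm (Fin n), (Equiv.Perm.sign w : MvPolynomial (Fin n) A) *
    ((∏ i, X (w i) ^ ν i) *
      ∏ p ∈ Finset.univ.filter (fun p : Fin n × Fin n => p.1 < p.2),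
        (X (w p.1) - C t * X (w p.2)))

/-- The number of inversions of a permutation. -/
def inv {n : ℕ} (w : Equiv.Perm (Fin n)) : ℕ :=
  (Finset.univ.filter (fun p : Fin n × Fin n => p.1 < p.2 ∧ w p.2 < w p.1)).card

theorem sum_pairs_comp {n : ℕ} (f : Fin n → Fin n → ℕ) (hf : ∀ i j, f i j = f j i)
    (w : Equiv.Perm (Fin n)) :
    ∑ p ∈ Finset.univ.filter (fun p : Fin n × Fin n => p.1 < p.2), f (w p.1) (w p.2) =
      ∑ p ∈ Finset.univ.filter (fun p : Fin n × Fin n => p.1 < p.2), f p.1 p.2 := by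
  have h : ∀ g : Fin n → Fin n → ℕ, (∀ i j, g i j = g j i) →
      ∑ p ∈ Finset.univ.filter (fun p : Fin n × Fin n => p.1 ≠ p.2), g p.1 p.2 =
      2 * ∑ p ∈ Finset.univ.filter (fun p : Fin n × Fin n => p.1 < p.2), g p.1 p.2 := by
    intro g hg
    rw [two_mul]
    have h1 : Finset.univ.filter (fun p : Fin n × Fin n => p.1 ≠ p.2) =
        (Finset.univ.filter (fun p : Fin n × Fin n => p.1 < p.2)) ∪
        (Finset.univ.filter (fun p : Fin n × Fin n => p.2 < p.1)) := by
      ext p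
      simp [lt_or_lt_iff_ne]
    rw [h1, Finset.sum_union]
    · congr 1
      refine Finset.sum_bij' (fun p _ => p.swap) (fun p _ => p.swap) ?_ ?_ ?_ ?_ ?_
      · simp
      · simp
      · simp
      · simp
      · intro p _
        exact hg _ _
    · rw [Finset.disjoint_filter]
      intro p _ h1 h2
      exact lt_asymm h1 h2
  have h1 := h f hf
  have h2 := h (fun i j => f (w i) (w j)) fun i j => hf _ _
  have h3 : ∑ p ∈ Finset.univ.filter (fun p : Fin n × Fin n => p.1 ≠ p.2), f (w p.1) (w p.2) =
      ∑ p ∈ Finset.univ.filter (fun p : Fin n × Fin n => p.1 ≠ p.2), f p.1 p.2 := by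
    refine Finset.sum_bij' (fun p _ => (w p.1, w p.2)) (fun p _ => (w.symm p.1, w.symm p.2))
      ?_ ?_ ?_ ?_ ?_ <;> simp
  omega

theorem sum_single_min {n : ℕ} (w : Equiv.Perm (Fin n)) :
    ∑ p ∈ Finset.univ.filter (fun p : Fin n × Fin n => p.1 < p.2),
      (Pi.single (min (w p.1) (w p.2)) 1 : Fin n → ℕ) = stair n := by
  ext a
  rw [Finset.sum_apply]
  have := sum_pairs_comp (fun i j => (Pi.single (min i j) 1 : Fin n → ℕ) a)
    (fun i j => by rw [min_comm]) w
  rw [this]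
  have h1 : ∀ p ∈ Finset.univ.filter (fun p : Fin n × Fin n => p.1 < p.2),
      (Pi.single (min p.1 p.2) 1 : Fin n → ℕ) a = if p.1 = a then 1 else 0 := by
    intro p hp
    rw [Finset.mem_filter] at hp
    rw [min_eq_left hp.2.le, Pi.single_apply]
    simp only [eq_comm]
  rw [Finset.sum_congr rfl h1, ← Finset.sum_filter, Finset.sum_const, Finset.filter_filter,
    smul_eq_mul, mul_one]
  have h2 : (Finset.univ.filter (fun p : Fin n × Fin n => p.1 < p.2 ∧ p.1 = a)) =
      (Finset.Ioi a).map ⟨fun b => (a, b), Prod.mk_right_injective a⟩ := by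
    ext ⟨x, y⟩
    simp only [Finset.mem_filter, Finset.mem_univ, true_and, Finset.mem_map, Finset.mem_Ioi,
      Function.Embedding.coeFn_mk, Prod.mk.injEq]
    constructor
    · rintro ⟨h, rfl⟩
      exact ⟨y, h, rfl, rfl⟩
    · rintro ⟨b, h, rfl, rfl⟩
      exact ⟨h, rfl⟩
  rw [h2, Finset.card_map, Fin.card_Ioi, stair]

theorem lexLead_hlPoly {n : ℕ} (t : A) {ν : Fin n → ℕ} (hν : Antitone ν) :
    LexLead (hlPoly t ν) (ν + stair n)
      (∑ w ∈ Finset.univ.filter (fun w : Equiv.Perm (Fin n) => ν ∘ w = ν), t ^ inv w) := by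
  have h : ∀ w : Equiv.Perm (Fin n), LexLead ((Equiv.Perm.sign w : MvPolynomial (Fin n) A) *
    ((∏ i, X (w i) ^ ν i) *
      ∏ p ∈ Finset.univ.filter (fun p : Fin n × Fin n => p.1 < p.2),
        (X (w p.1) - C t * X (w p.2)))) (ν + stair n) (if ν ∘ w = ν then t ^ inv w else 0) := by
    intro w
    have h0 : ((Equiv.Perm.sign w : ℤ) : MvPolynomial (Fin n) A) =
        C ((Equiv.Perm.sign w : ℤ) : A) := by simp
    have h1 := LexLead.prod (Finset.univ.filter (fun p : Fin n × Fin n => p.1 < p.2))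
      (f := fun p => (X (w p.1) - C t * X (w p.2) : MvPolynomial (Fin n) A))
      (γ := fun p => Pi.single (min (w p.1) (w p.2)) 1)
      (c := fun p => if w p.1 < w p.2 then 1 else -t)
      (fun p hp => LexLead.X_sub t (by simpa using (Finset.mem_filter.1 hp).2.ne))
    rw [sum_single_min] at h1
    have h2 := ((LexLead.monomial (A := A) (ν ∘ w.symm)).mul h1).const_mul
      ((Equiv.Perm.sign w : ℤ) : A)
    have h3 : toLex (ν ∘ w.symm + stair n) ≤ toLex (ν + stair n) := by
      rw [toLex_add, toLex_add]
      exact add_le_add_left (toLex_comp_le hν _) _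
    have h4 := h2.of_le h3
    rw [← prod_X_pow_perm, ← h0] at h4
    convert h4 using 1
    have h5 : ν ∘ w = ν ↔ ν ∘ w.symm + stair n = ν + stair n := by
      rw [add_left_inj, Equiv.comp_symm_eq, eq_comm]
    have h6 : ((Equiv.Perm.sign w : ℤ) : A) * (1 *
        ∏ p ∈ Finset.univ.filter (fun p : Fin n × Fin n => p.1 < p.2),
          if w p.1 < w p.2 then (1 : A) else -t) = t ^ inv w := by
      have hs : ((Equiv.Perm.sign w : ℤ) : A) =
          ∏ p ∈ Finset.univ.filter (fun p : Fin n × Fin n => p.1 < p.2),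
            if w p.1 < w p.2 then (1 : A) else -1 := by
        rw [Equiv.Perm.sign_eq_prod_prod_Ioi, Finset.prod_sigma', Units.coe_prod, Int.cast_prod]
        refine Finset.prod_bij' (fun p _ => (p.1, p.2)) (fun p _ => ⟨p.1, p.2⟩) ?_ ?_ ?_ ?_ ?_
        · simp
        · simp
        · simp
        · simp
        · intro p _
          by_cases h : w p.1 < w p.2 <;> simp [h]
      rw [hs, one_mul, ← Finset.prod_mul_distrib]
      have : ∀ p ∈ Finset.univ.filter (fun p : Fin n × Fin n => p.1 < p.2),
          (if w p.1 < w p.2 then (1 : A) else -1) * (if w p.1 < w p.2 then (1 : A) else -t) =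
            if w p.2 < w p.1 then t else 1 := by
        intro p hp
        have hne : w p.1 ≠ w p.2 := by simpa using (Finset.mem_filter.1 hp).2.ne
        rcases lt_or_gt_of_ne hne with h | h
        · simp [h, h.not_gt]
        · simp [h, h.not_gt]
      rw [Finset.prod_congr rfl this, Finset.prod_ite, Finset.prod_const, Finset.prod_const_one,
        mul_one, Finset.filter_filter, inv]
    rw [h6]
    by_cases h : ν ∘ w = ν
    · rw [if_pos h, if_pos (h5.1 h)]
    · rw [if_neg h, if_neg (fun h' => h (h5.2 h'))]
  have := LexLead.sum Finset.univ (fun w _ => h w)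
  rwa [← Finset.sum_filter] at this

theorem lexLead_alternant {n : ℕ} {κ : Fin n → ℕ} (hκ : StrictAnti κ) :
    LexLead (alternant (X : Fin n → MvPolynomial (Fin n) A) κ) κ 1 := by
  refine ⟨fun β hβ => ?_, by rw [coeff_alternant hκ hκ, if_pos rfl]⟩
  rw [alternant_eq_sum, coeff_sum] at hβ
  obtain ⟨w, -, hne⟩ := Finset.exists_ne_zero_of_sum_ne_zero hβ
  have h0 : ((Equiv.Perm.sign w : ℤ) : MvPolynomial (Fin n) A) =
      C ((Equiv.Perm.sign w : ℤ) : A) := by simp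
  rw [prod_X_pow_perm, h0] at hne
  exact (((LexLead.monomial _).const_mul _).of_le (toLex_comp_le hκ.antitone w.symm)).1 β hne

theorem injective_cons_succAbove {n : ℕ} (a : Fin (n + 1)) (w : Equiv.Perm (Fin n)) :
    Function.Injective (Fin.cons a (a.succAbove ∘ w) : Fin (n + 1) → Fin (n + 1)) := by
  rw [Fin.cons_injective_iff]
  refine ⟨?_, (Fin.succAbove_right_injective).comp w.injective⟩
  rintro ⟨i, hi⟩
  exact Fin.succAbove_ne a _ hi

/-- The permutation sending `0` to `a` and acting like `w` on the other letters. -/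
noncomputable def consPerm {n : ℕ} (a : Fin (n + 1)) (w : Equiv.Perm (Fin n)) :
    Equiv.Perm (Fin (n + 1)) :=
  Equiv.ofBijective _ (Finite.injective_iff_bijective.1 (injective_cons_succAbove a w))

theorem consPerm_zero {n : ℕ} (a : Fin (n + 1)) (w : Equiv.Perm (Fin n)) :
    consPerm a w 0 = a := rfl

theorem consPerm_succ {n : ℕ} (a : Fin (n + 1)) (w : Equiv.Perm (Fin n)) (i : Fin n) :
    consPerm a w i.succ = a.succAbove (w i) := rfl

theorem bijective_consPerm (n : ℕ) : Function.Bijective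
    (fun p : Fin (n + 1) × Equiv.Perm (Fin n) => consPerm p.1 p.2) := by
  rw [Fintype.bijective_iff_injective_and_card]
  refine ⟨?_, by simp [Fintype.card_perm, Nat.factorial_succ]⟩
  rintro ⟨a, w⟩ ⟨b, v⟩ h
  have h0 : a = b := by
    simpa only [consPerm_zero] using congrArg (fun u => u 0) h
  subst h0
  congr 1
  ext i
  have := congrArg (fun u => u i.succ) h
  simp only [consPerm_succ] at this
  rw [Fin.succAbove_right_injective this]

theorem inv_consPerm {n : ℕ} (a : Fin (n + 1)) (w : Equiv.Perm (Fin n)) :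
    inv (consPerm a w) = a + inv w := by
  have h : ∀ {m : ℕ} (u : Equiv.Perm (Fin m)),
      inv u = ∑ i, ∑ j, if i < j ∧ u j < u i then 1 else 0 := by
    intro m u
    rw [inv, Finset.card_filter, Fintype.sum_prod_type]
  rw [h, h, Fin.sum_univ_succ]
  congr 1
  · rw [Fin.sum_univ_succ]
    simp only [lt_irrefl, false_and, if_false, zero_add, Fin.succ_pos, true_and, consPerm_zero,
      consPerm_succ, Fin.succAbove_lt_iff_castSucc_lt]
    rw [Equiv.sum_comp w (fun j => if j.castSucc < a then 1 else 0), ← Finset.card_filter]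
    rw [← Finset.card_map Fin.valEmbedding]
    have : (Finset.univ.filter fun j : Fin n => j.castSucc < a).map Fin.valEmbedding =
        Finset.range a := by
      ext x
      have := a.2
      simp only [Finset.mem_map, Finset.mem_filter, Finset.mem_univ, true_and, Finset.mem_range,
        Fin.valEmbedding_apply]
      constructor
      · rintro ⟨j, hj, rfl⟩
        exact hj
      · exact fun hx => ⟨⟨x, by omega⟩, hx, rfl⟩
    rw [this, Finset.card_range]
  · refine Finset.sum_congr rfl fun i _ => ?_
    rw [Fin.sum_univ_succ]
    simp [consPerm_succ, Fin.succAbove_lt_succAbove_iff]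

theorem sum_stabilizer (t : A) {n : ℕ} {ν : Fin n → ℕ} (hν : Antitone ν) {B : ℕ}
    (hB : ∀ a, ν a < B) :
    ∑ w ∈ Finset.univ.filter (fun w : Equiv.Perm (Fin n) => ν ∘ w = ν), t ^ inv w =
      ∏ i ∈ Finset.range B, ∏ j ∈ Finset.range (Finset.univ.filter fun a => ν a = i).card,
        ∑ k ∈ Finset.range (j + 1), t ^ k := by
  induction n with
  | zero =>
    simp [inv, Finset.filter_true_of_mem, Subsingleton.elim (ν ∘ _) ν]
  | succ n ih =>
    have hle : ∀ a : Fin (n + 1), ν a = ν 0 → ∀ j, j ≤ a → ν j = ν 0 := fun a ha j hj =>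
      (hν (Fin.zero_le j)).antisymm (ha ▸ hν hj)
    have htail : Antitone (fun i : Fin n => ν i.succ) := fun i j hij =>
      hν (Fin.succ_le_succ_iff.2 hij)
    have hcond : ∀ (a : Fin (n + 1)) (w : Equiv.Perm (Fin n)), ν ∘ consPerm a w = ν ↔
        ν a = ν 0 ∧ (fun i : Fin n => ν i.succ) ∘ w = fun i : Fin n => ν i.succ := by
      intro a w
      have hsucc : ν a = ν 0 → ∀ j : Fin n, ν (a.succAbove j) = ν j.succ := by
        intro ha j
        rcases lt_or_ge j.castSucc a with h | h
        · rw [Fin.succAbove_of_castSucc_lt _ _ h, hle a ha _ h.le,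
            hle a ha _ (Fin.castSucc_lt_iff_succ_le.1 h)]
        · rw [Fin.succAbove_of_le_castSucc _ _ h]
      rw [funext_iff, Fin.forall_fin_succ]
      simp only [Function.comp, consPerm_zero, consPerm_succ, funext_iff]
      constructor
      · rintro ⟨h1, h2⟩
        exact ⟨h1, fun i => by rw [← hsucc h1, h2]⟩
      · rintro ⟨h1, h2⟩
        exact ⟨h1, fun i => by rw [hsucc h1, h2]⟩
    have hcount : (Finset.univ.filter fun a => ν a = ν 0).card =
        (Finset.univ.filter fun a : Fin n => ν a.succ = ν 0).card + 1 := by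
      rw [Fin.univ_succ, Finset.filter_cons, if_pos rfl, Finset.card_cons, Finset.filter_map,
        Finset.card_map]
      rfl
    have hfirst : ∑ a ∈ Finset.univ.filter (fun a => ν a = ν 0), t ^ (a : ℕ) =
        ∑ k ∈ Finset.range (Finset.univ.filter fun a => ν a = ν 0).card, t ^ k := by
      set T := (Finset.univ.filter fun a => ν a = ν 0).map Fin.valEmbedding with hT
      have hsub : T ⊆ Finset.range T.card := by
        intro x hx
        have : Finset.range (x + 1) ⊆ T := by
          intro y hy
          rw [hT, Finset.mem_map] at hx ⊢
          obtain ⟨a, ha, rfl⟩ := hx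
          rw [Finset.mem_range, Fin.valEmbedding_apply] at hy
          have hya : y < n + 1 := by omega
          exact ⟨⟨y, hya⟩, Finset.mem_filter.2 ⟨Finset.mem_univ _,
            hle a (Finset.mem_filter.1 ha).2 _ (Fin.le_def.2 (Nat.lt_succ_iff.1 hy))⟩, rfl⟩
        have := Finset.card_le_card this
        rw [Finset.card_range] at this
        exact Finset.mem_range.2 this
      have heq := Finset.eq_of_subset_of_card_le hsub (by rw [Finset.card_range])
      rw [← Finset.card_map Fin.valEmbedding, ← hT, ← heq, hT, Finset.sum_map]
      rfl
    rw [Finset.sum_filter, ← (bijective_consPerm n).sum_comp, Fintype.sum_prod_type]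
    simp only [hcond, inv_consPerm, pow_add, ite_and]
    have hstep : ∀ a : Fin (n + 1), (∑ w : Equiv.Perm (Fin n), if ν a = ν 0 then
        if (fun i : Fin n => ν i.succ) ∘ w = fun i : Fin n => ν i.succ then
          t ^ (a : ℕ) * t ^ inv w else 0 else 0) =
        if ν a = ν 0 then t ^ (a : ℕ) *
          ∑ w ∈ Finset.univ.filter (fun w : Equiv.Perm (Fin n) =>
            (fun i : Fin n => ν i.succ) ∘ w = fun i : Fin n => ν i.succ), t ^ inv w else 0 := by
      intro a
      by_cases h : ν a = ν 0
      · simp only [if_pos h, Finset.mul_sum, Finset.sum_filter, mul_ite, mul_zero]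
      · simp [if_neg h]
    rw [Finset.sum_congr rfl fun a _ => hstep a, ← Finset.sum_filter, ← Finset.sum_mul, hfirst,
      ih htail (fun a => hB _), hcount]
    have hfac : ∀ i ∈ Finset.range B,
        ∏ j ∈ Finset.range (Finset.univ.filter fun a => ν a = i).card,
          ∑ k ∈ Finset.range (j + 1), t ^ k =
        (if i = ν 0 then ∑ k ∈ Finset.range
          ((Finset.univ.filter fun a : Fin n => ν a.succ = ν 0).card + 1), t ^ k else 1) *
        ∏ j ∈ Finset.range (Finset.univ.filter fun a : Fin n => ν a.succ = i).card,
          ∑ k ∈ Finset.range (j + 1), t ^ k := by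
      intro i _
      by_cases h : i = ν 0
      · subst h
        rw [hcount, Finset.prod_range_succ, if_pos rfl, mul_comm]
      · rw [if_neg h, one_mul, Fin.univ_succ, Finset.filter_cons, if_neg (fun h' => h h'.symm),
          Finset.filter_map, Finset.card_map]
        rfl
    rw [Finset.prod_congr rfl hfac, Finset.prod_mul_distrib, Finset.prod_ite_eq',
      if_pos (Finset.mem_range.2 (hB 0))]

end

/-- Power series in the parameter over the Laurent polynomials in `n` letters. -/
abbrev Laurent (n : ℕ) : Type := PowerSeries (AddMonoidAlgebra ℚ (Fin n → ℤ))

/-- The Laurent monomial with exponent `v`. -/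
noncomputable def mon {n : ℕ} (v : Fin n → ℤ) : Laurent n :=
  PowerSeries.C (AddMonoidAlgebra.single v 1)

theorem mon_add {n : ℕ} (u v : Fin n → ℤ) : mon (u + v) = mon u * mon v := by
  rw [mon, mon, mon, ← map_mul, AddMonoidAlgebra.single_mul_single, one_mul]

theorem mon_zero {n : ℕ} : mon (0 : Fin n → ℤ) = 1 := by
  rw [mon, ← AddMonoidAlgebra.one_def, map_one]

theorem mon_sum {n : ℕ} {ι : Type*} (s : Finset ι) (v : ι → Fin n → ℤ) :
    mon (∑ i ∈ s, v i) = ∏ i ∈ s, mon (v i) := by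
  classical
  induction s using Finset.induction_on with
  | empty => simp [mon_zero]
  | insert a s ha ih => rw [Finset.sum_insert ha, Finset.prod_insert ha, mon_add, ih]

theorem mon_nsmul {n : ℕ} (k : ℕ) (v : Fin n → ℤ) : mon (k • v) = mon v ^ k := by
  induction k with
  | zero => simp [mon_zero]
  | succ k ih => rw [succ_nsmul, mon_add, ih, pow_succ]

/-- The geometric series `(1 - t x ^ v)⁻¹`. -/
noncomputable def geom {n : ℕ} (v : Fin n → ℤ) : Laurent n :=
  PowerSeries.mk fun k => AddMonoidAlgebra.single (k • v) 1

theorem one_sub_mul_geom {n : ℕ} (v : Fin n → ℤ) : (1 - PowerSeries.X * mon v) * geom v = 1 := by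
  ext1 k
  rw [sub_mul, one_mul, mul_assoc, map_sub]
  cases k with
  | zero => simp [geom, AddMonoidAlgebra.one_def]
  | succ k =>
    rw [PowerSeries.coeff_succ_X_mul, mon, PowerSeries.coeff_C_mul, geom, PowerSeries.coeff_mk,
      PowerSeries.coeff_mk, AddMonoidAlgebra.single_mul_single, one_mul, add_comm k 1, add_nsmul,
      one_nsmul, sub_self]
    simp [PowerSeries.coeff_one]

/-- The coefficient of `x ^ u`, as a power series in the parameter. -/
noncomputable def cf {n : ℕ} (u : Fin n → ℤ) : Laurent n →+ PowerSeries ℚ where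
  toFun f := PowerSeries.mk fun k => (PowerSeries.coeff k f).coeff u
  map_zero' := by ext; simp
  map_add' f g := by ext; simp

theorem coeff_cf {n : ℕ} (u : Fin n → ℤ) (f : Laurent n) (k : ℕ) :
    PowerSeries.coeff k (cf u f) = (PowerSeries.coeff k f).coeff u := by
  simp [cf]

theorem cf_mon_mul {n : ℕ} (u v : Fin n → ℤ) (f : Laurent n) :
    cf u (mon v * f) = cf (u - v) f := by
  ext k
  rw [coeff_cf, coeff_cf, mon, PowerSeries.coeff_C_mul, AddMonoidAlgebra.coeff_single_mul_apply,
    one_mul, neg_add_eq_sub]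

/-- Series in the parameter alone. -/
noncomputable def paramHom (n : ℕ) : PowerSeries ℚ →+* Laurent n :=
  PowerSeries.map AddMonoidAlgebra.singleZeroRingHom

theorem cf_paramHom_mul {n : ℕ} (u : Fin n → ℤ) (a : PowerSeries ℚ) (f : Laurent n) :
    cf u (paramHom n a * f) = a * cf u f := by
  ext k
  rw [coeff_cf, PowerSeries.coeff_mul, PowerSeries.coeff_mul, AddMonoidAlgebra.coeff_sum,
    Finsupp.finsetSum_apply]
  refine Finset.sum_congr rfl fun p _ => ?_
  rw [paramHom, PowerSeries.coeff_map, coeff_cf]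
  change (AddMonoidAlgebra.single (0 : Fin n → ℤ) _ * _ : AddMonoidAlgebra ℚ _).coeff u = _
  rw [AddMonoidAlgebra.coeff_single_mul_apply]
  simp

/-- The change of letters along an additive map of exponents. -/
noncomputable def act {m n : ℕ} (e : (Fin m → ℤ) →+ (Fin n → ℤ)) : Laurent m →+* Laurent n :=
  PowerSeries.map (AddMonoidAlgebra.mapDomainRingHom ℚ e)

section Act

variable {m n : ℕ} (e : (Fin m → ℤ) →+ (Fin n → ℤ))

theorem act_mon (v : Fin m → ℤ) : act e (mon v) = mon (e v) := by
  rw [act, mon, PowerSeries.map_C, AddMonoidAlgebra.mapDomainRingHom_apply,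
    AddMonoidAlgebra.mapDomain_single, mon]

theorem act_geom (v : Fin m → ℤ) : act e (geom v) = geom (e v) := by
  ext1 k
  rw [act, PowerSeries.coeff_map, geom, geom, PowerSeries.coeff_mk, PowerSeries.coeff_mk,
    AddMonoidAlgebra.mapDomainRingHom_apply, AddMonoidAlgebra.mapDomain_single, ← map_nsmul]

theorem act_paramHom (a : PowerSeries ℚ) : act e (paramHom m a) = paramHom n a := by
  ext1 k
  rw [act, paramHom, paramHom, PowerSeries.coeff_map, PowerSeries.coeff_map, PowerSeries.coeff_map,
    AddMonoidAlgebra.mapDomainRingHom_apply]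
  change AddMonoidAlgebra.mapDomain e (AddMonoidAlgebra.single 0 _) = AddMonoidAlgebra.single 0 _
  rw [AddMonoidAlgebra.mapDomain_single]
  exact congrArg (fun z => AddMonoidAlgebra.single z _) (map_zero e)

theorem cf_act (he : Function.Injective e) (u : Fin m → ℤ) (f : Laurent m) :
    cf (e u) (act e f) = cf u f := by
  ext k
  rw [coeff_cf, coeff_cf, act, PowerSeries.coeff_map, AddMonoidAlgebra.mapDomainRingHom_apply,
    AddMonoidAlgebra.coeff_mapDomain]
  exact Finsupp.mapDomain_apply he _ _

theorem cf_act_of_notMem {u : Fin n → ℤ} (hu : ∀ v, e v ≠ u) (f : Laurent m) :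
    cf u (act e f) = 0 := by
  ext k
  rw [coeff_cf, act, PowerSeries.coeff_map, AddMonoidAlgebra.mapDomainRingHom_apply,
    AddMonoidAlgebra.coeff_mapDomain, map_zero]
  exact Finsupp.mapDomain_of_notMem_range _ _ (by rintro ⟨v, hv⟩; exact hu v hv)

end Act

/-- Adjoining a letter with exponent zero. -/
def consHom (n : ℕ) : (Fin n → ℤ) →+ (Fin (n + 1) → ℤ) where
  toFun v := Fin.cons 0 v
  map_zero' := by ext i; refine Fin.cases ?_ (fun i => ?_) i <;> simp
  map_add' u v := by ext i; refine Fin.cases ?_ (fun i => ?_) i <;> simp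

theorem cf_cons_act {n : ℕ} (c : ℤ) (u : Fin n → ℤ) (f : Laurent n) :
    cf (Fin.cons c u : Fin (n + 1) → ℤ) (act (consHom n) f) = if c = 0 then cf u f else 0 := by
  split_ifs with h
  · subst h
    refine cf_act (consHom n) (fun a b h => ?_) u f
    exact (Fin.cons_inj (α := fun _ => ℤ).1 h).2
  · refine cf_act_of_notMem _ (fun v hv => h ?_) f
    exact (Fin.cons_inj (α := fun _ => ℤ).1 hv).1.symm

theorem coeff_prod_geom {n : ℕ} (k : ℕ) :
    PowerSeries.coeff k (∏ j : Fin n, geom (Pi.single j.succ 1 - Pi.single 0 1 : Fin (n + 1) → ℤ)) =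
      ∑ ρ ∈ Finset.piAntidiag Finset.univ k,
        AddMonoidAlgebra.single (Fin.cons (-(k : ℤ)) (fun j => (ρ j : ℤ)) : Fin (n + 1) → ℤ) 1 := by
  have hsum : ∀ ρ : Fin n → ℕ,
      ∑ j, ρ j • (Pi.single j.succ 1 - Pi.single 0 1 : Fin (n + 1) → ℤ) =
        Fin.cons (-((∑ j, ρ j : ℕ) : ℤ)) (fun j => (ρ j : ℤ)) := by
    intro ρ
    ext i
    rw [Finset.sum_apply]
    refine Fin.cases ?_ (fun i => ?_) i
    · simp [Fin.succ_ne_zero]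
    · simp [Pi.single_apply, Fin.succ_ne_zero]
  have hprod : ∀ ρ : Fin n → ℕ,
      ∏ j, PowerSeries.coeff (ρ j) (geom (Pi.single j.succ 1 - Pi.single 0 1 : Fin (n + 1) → ℤ)) =
        AddMonoidAlgebra.single (Fin.cons (-((∑ j, ρ j : ℕ) : ℤ)) (fun j => (ρ j : ℤ)) :
          Fin (n + 1) → ℤ) (1 : ℚ) := by
    intro ρ
    simp only [geom, PowerSeries.coeff_mk]
    rw [← hsum]
    generalize (Finset.univ : Finset (Fin n)) = s
    induction s using Finset.induction_on with
    | empty => simp [AddMonoidAlgebra.one_def]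
    | insert a s ha ih =>
      rw [Finset.sum_insert ha, Finset.prod_insert ha, ih, AddMonoidAlgebra.single_mul_single,
        one_mul]
  rw [PowerSeries.coeff_prod]
  refine Finset.sum_bij' (fun f _ => ⇑f) (fun ρ _ => Finsupp.equivFunOnFinite.symm ρ)
    ?_ ?_ ?_ ?_ ?_
  · intro f hf
    simpa using hf
  · intro ρ hρ
    simpa using hρ
  · intro f hf
    simp
  · intro ρ hρ
    simp
  · intro f hf
    rw [hprod]
    have : ∑ j, f j = k := by simpa using hf
    rw [this]

theorem cf_cons_prod_geom {n : ℕ} (c : ℤ) (u : Fin n → ℤ) (f : Laurent n) :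
    cf (Fin.cons c u : Fin (n + 1) → ℤ)
      ((∏ j : Fin n, geom (Pi.single j.succ 1 - Pi.single 0 1)) * act (consHom n) f) =
      if c ≤ 0 then PowerSeries.X ^ (-c).toNat *
        ∑ ρ ∈ Finset.piAntidiag Finset.univ (-c).toNat, cf (u - fun j => (ρ j : ℤ)) f
      else 0 := by
  have hterm : ∀ (a b : ℕ) (ρ : Fin n → ℕ),
      ((AddMonoidAlgebra.single (Fin.cons (-(a : ℤ)) (fun j => (ρ j : ℤ)) : Fin (n + 1) → ℤ) 1 *
        PowerSeries.coeff b (act (consHom n) f)).coeff (Fin.cons c u)) =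
      if c + a = 0 then PowerSeries.coeff b (cf (u - fun j => (ρ j : ℤ)) f) else 0 := by
    intro a b ρ
    have h := cf_cons_act (c + a) (u - fun j => (ρ j : ℤ)) f
    have h' := congrArg (PowerSeries.coeff b) h
    rw [coeff_cf] at h'
    rw [AddMonoidAlgebra.coeff_single_mul_apply, one_mul]
    have hv : -(Fin.cons (-(a : ℤ)) (fun j => (ρ j : ℤ)) : Fin (n + 1) → ℤ) + Fin.cons c u =
        Fin.cons (c + a) (u - fun j => (ρ j : ℤ)) := by
      ext i
      refine Fin.cases ?_ (fun i => ?_) i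
      · simp; ring
      · simp; ring
    rw [hv, h']
    split_ifs <;> simp
  have hco : ∀ m, PowerSeries.coeff m (cf (Fin.cons c u : Fin (n + 1) → ℤ)
      ((∏ j : Fin n, geom (Pi.single j.succ 1 - Pi.single 0 1)) * act (consHom n) f)) =
      ∑ p ∈ Finset.HasAntidiagonal.antidiagonal m, if c + p.1 = 0 then
        ∑ ρ ∈ Finset.piAntidiag Finset.univ p.1,
          PowerSeries.coeff p.2 (cf (u - fun j => (ρ j : ℤ)) f) else 0 := by
    intro m
    rw [coeff_cf, PowerSeries.coeff_mul, AddMonoidAlgebra.coeff_sum, Finsupp.finsetSum_apply]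
    refine Finset.sum_congr rfl fun p _ => ?_
    rw [coeff_prod_geom, Finset.sum_mul, AddMonoidAlgebra.coeff_sum, Finsupp.finsetSum_apply]
    simp only [hterm]
    split_ifs <;> simp
  ext m
  rw [hco]
  split_ifs with hc
  · obtain ⟨k, rfl⟩ : ∃ k : ℕ, c = -(k : ℤ) := ⟨(-c).toNat, by omega⟩
    rw [neg_neg, Int.toNat_natCast, PowerSeries.coeff_X_pow_mul']
    split_ifs with hk
    · rw [Finset.sum_eq_single (k, m - k)]
      · simp
      · rintro ⟨a, b⟩ hp hne
        rw [if_neg]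
        intro h
        apply hne
        have := Finset.HasAntidiagonal.mem_antidiagonal.1 hp
        simp only at this h ⊢
        ext <;> simp <;> omega
      · intro h
        exact absurd (Finset.HasAntidiagonal.mem_antidiagonal.2 (by simp; omega)) h
    · refine Finset.sum_eq_zero fun p hp => ?_
      have := Finset.HasAntidiagonal.mem_antidiagonal.1 hp
      rw [if_neg (by omega)]
  · rw [map_zero]
    refine Finset.sum_eq_zero fun p hp => ?_
    rw [if_neg (by omega)]

/-- The root `e j - e i`. -/
def root {n : ℕ} (p : Fin n × Fin n) : Fin n → ℤ := Pi.single p.2 1 - Pi.single p.1 1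

/-- The product of `(1 - t x j / x i)⁻¹` over the pairs `i < j`. -/
noncomputable def geomLT (n : ℕ) : Laurent n :=
  ∏ p ∈ Finset.univ.filter (fun p : Fin n × Fin n => p.1 < p.2), geom (root p)

theorem prod_pairs_succ {M : Type*} [CommMonoid M] {n : ℕ} (f : Fin (n + 1) × Fin (n + 1) → M) :
    ∏ p ∈ Finset.univ.filter (fun p : Fin (n + 1) × Fin (n + 1) => p.1 < p.2), f p =
      (∏ j : Fin n, f (0, j.succ)) *
        ∏ p ∈ Finset.univ.filter (fun p : Fin n × Fin n => p.1 < p.2), f (p.1.succ, p.2.succ) := by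
  simp only [Finset.prod_filter, Fintype.prod_prod_type, Fin.prod_univ_succ]
  simp

theorem geomLT_succ (n : ℕ) : geomLT (n + 1) =
    (∏ j : Fin n, geom (Pi.single j.succ 1 - Pi.single 0 1)) * act (consHom n) (geomLT n) := by
  rw [geomLT, prod_pairs_succ, geomLT, map_prod]
  congr 1
  refine Finset.prod_congr rfl fun p _ => ?_
  rw [act_geom]
  congr 1
  ext i
  refine Fin.cases ?_ (fun i => ?_) i
  · simp [root, consHom, (Fin.succ_ne_zero _).symm]
  · simp [root, consHom, Pi.single_apply]

theorem raiseWt_apply {A : Type*} [CommRing A] (t : A) {n : ℕ} (g b : ℕ)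
    (P : (Fin n → ℕ) →₀ A) (β : Fin n → ℕ) :
    raiseWt t g P (Fin.cons b β : Fin (n + 1) → ℕ) =
      if g ≤ b then t ^ (b - g) * ∑ ρ ∈ Finset.piAntidiag Finset.univ (b - g), P (β + ρ)
      else 0 := by
  induction P using Finsupp.induction_linear with
  | zero => simp
  | add f h hf hh =>
    rw [map_add, Finsupp.add_apply, hf, hh]
    split_ifs
    · rw [← mul_add, ← Finset.sum_add_distrib]; rfl
    · simp
  | single ε c =>
    rw [raiseWt_single, Finsupp.smul_apply, Finset.sum_apply']
    simp only [Finsupp.single_apply, Fin.cons_inj]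
    split_ifs with hg
    · by_cases hle : β ≤ ε ∧ ∑ i, (ε - β) i = b - g
      · have hsub : β + (ε - β) = ε := add_tsub_cancel_of_le hle.1
        rw [Finset.sum_eq_single (ε - β), Finset.sum_eq_single (ε - β)]
        · rw [if_pos, if_pos hsub.symm, hle.2, smul_eq_mul, mul_comm]
          refine ⟨by rw [hle.2]; omega, ?_⟩
          ext i
          have : β i ≤ ε i := hle.1 i
          simp only [Pi.sub_apply]
          omega
        · intro ρ _ hρ
          rw [if_neg]
          rintro rfl
          exact hρ (by ext i; simp)
        · intro h
          exact absurd (by simpa using hle.2) h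
        · intro ρ hρ hne
          rw [if_neg]
          rintro ⟨-, h⟩
          refine hne ?_
          ext i
          have h1 := congrFun h i
          have h2 := Finset.mem_range.1 (Fintype.mem_piFinset.1 hρ i)
          simp only [Pi.sub_apply] at h1 ⊢
          omega
        · intro h
          exact absurd (Fintype.mem_piFinset.2 fun i => by simp) h
      · rw [Finset.sum_eq_zero, Finset.sum_eq_zero]
        · simp
        · intro ρ hρ
          rw [if_neg]
          rintro rfl
          refine hle ⟨le_self_add, ?_⟩
          simpa using hρ
        · intro ρ hρ
          rw [if_neg]
          rintro ⟨h1, h2⟩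
          have h3 : ∀ i, ρ i ≤ ε i := fun i =>
            Nat.lt_succ_iff.1 (Finset.mem_range.1 (Fintype.mem_piFinset.1 hρ i))
          have h4 : ρ = ε - β := by
            ext i
            have := congrFun h2 i
            have := h3 i
            simp only [Pi.sub_apply] at *
            omega
          refine hle ⟨?_, ?_⟩
          · rw [← h2]; exact tsub_le_self
          · rw [← h4]; omega
    · rw [Finset.sum_eq_zero, smul_zero]
      intro ρ _
      rw [if_neg]
      rintro ⟨h, -⟩
      omega

theorem cf_geomLT {n : ℕ} (γ β : Fin n → ℕ) :
    cf (fun i => (γ i : ℤ) - β i) (geomLT n) =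
      ((hlWeights (Polynomial.X : Polynomial ℚ) γ β : Polynomial ℚ) : PowerSeries ℚ) := by
  induction n with
  | zero =>
    have h1 : (fun i : Fin 0 => (γ i : ℤ) - β i) = 0 := Subsingleton.elim _ _
    have h2 : β = γ := Subsingleton.elim _ _
    have h3 : geomLT 0 = 1 := by simp [geomLT]
    rw [h1, h2, h3, hlWeights_self]
    ext k
    rw [coeff_cf, PowerSeries.coeff_one, Polynomial.coe_one, PowerSeries.coeff_one]
    split_ifs <;> simp [AddMonoidAlgebra.one_def]
  | succ n ih =>
    obtain ⟨g, γ, rfl⟩ : ∃ g τ, γ = (Fin.cons g τ : Fin (n + 1) → ℕ) :=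
      ⟨γ 0, Fin.tail γ, (Fin.cons_self_tail γ).symm⟩
    obtain ⟨b, β, rfl⟩ : ∃ g τ, β = (Fin.cons g τ : Fin (n + 1) → ℕ) :=
      ⟨β 0, Fin.tail β, (Fin.cons_self_tail β).symm⟩
    have hu : (fun i : Fin (n + 1) => (((Fin.cons g γ : Fin (n + 1) → ℕ) i : ℕ) : ℤ) -
        ((Fin.cons b β : Fin (n + 1) → ℕ) i : ℕ)) =
        Fin.cons ((g : ℤ) - b) (fun i => (γ i : ℤ) - β i) := by
      ext i
      refine Fin.cases ?_ (fun i => ?_) i <;> simp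
    rw [hu, geomLT_succ, cf_cons_prod_geom, hlWeights_cons, raiseWt_apply]
    by_cases h : g ≤ b
    · rw [if_pos h, if_pos (by omega)]
      have hk : (-((g : ℤ) - b)).toNat = b - g := by omega
      rw [hk, Polynomial.coe_mul, Polynomial.coe_pow, Polynomial.coe_X]
      congr 1
      rw [← Polynomial.coeToPowerSeries.ringHom_apply, map_sum]
      refine Finset.sum_congr rfl fun ρ _ => ?_
      rw [Polynomial.coeToPowerSeries.ringHom_apply, ← ih]
      congr 2
      ext i
      simp
      ring
    · rw [if_neg h, if_neg (by omega), Polynomial.coe_zero]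

open Polynomial in
/-- Polynomials in the letters as Laurent series. -/
noncomputable def emb (n : ℕ) : MvPolynomial (Fin n) ℚ[X] →+* Laurent n :=
  eval₂Hom ((paramHom n).comp Polynomial.coeToPowerSeries.ringHom) fun i => mon (Pi.single i 1)

theorem emb_X {n : ℕ} (i : Fin n) : emb n (X i) = mon (Pi.single i 1) := by simp [emb]

theorem emb_C {n : ℕ} (a : Polynomial ℚ) : emb n (C a) = paramHom n a := by simp [emb]

theorem sum_nsmul_single {n : ℕ} (v : Fin n → ℕ) :
    ∑ i, v i • (Pi.single i 1 : Fin n → ℤ) = fun i => (v i : ℤ) := by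
  ext i
  simp [Finset.sum_apply, Pi.single_apply]

theorem emb_prod_X_pow {n : ℕ} (v : Fin n → ℕ) :
    emb n (∏ i, X i ^ v i) = mon fun i => (v i : ℤ) := by
  rw [map_prod, ← sum_nsmul_single, mon_sum]
  simp only [map_pow, emb_X, mon_nsmul]

theorem cf_pairing {n : ℕ} (γ : Fin n → ℕ) (f : MvPolynomial (Fin n) (Polynomial ℚ)) :
    cf 0 (emb n f * (mon (fun i => -(γ i : ℤ)) * geomLT n)) =
      ((pairing Polynomial.X γ f : Polynomial ℚ) : PowerSeries ℚ) := by
  induction f using MvPolynomial.induction_on' with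
  | monomial β a =>
    have h1 : monomial β a = C a * ∏ i, X i ^ β i := by
      rw [monomial_eq, Finsupp.prod_fintype _ _ fun i => pow_zero _]
    rw [pairing_monomial, h1, map_mul (emb n), emb_C, emb_prod_X_pow, mul_assoc, cf_paramHom_mul,
      ← mul_assoc, ← mon_add, cf_mon_mul, Polynomial.coe_mul, ← cf_geomLT]
    refine congrArg (fun u => (a : PowerSeries ℚ) * cf u (geomLT n)) (funext fun i => ?_)
    simp
    ring
  | add p q hp hq => rw [map_add, add_mul, map_add, hp, hq, map_add, Polynomial.coe_add]

/-- Permutation of the letters. -/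
def permHom {n : ℕ} (w : Equiv.Perm (Fin n)) : (Fin n → ℤ) →+ (Fin n → ℤ) where
  toFun v := v ∘ w.symm
  map_zero' := rfl
  map_add' _ _ := rfl

theorem permHom_single {n : ℕ} (w : Equiv.Perm (Fin n)) (i : Fin n) :
    permHom w (Pi.single i 1) = Pi.single (w i) 1 := by
  ext j
  simp [permHom, Pi.single_apply, Equiv.symm_apply_eq]

/-- Inversion of the letters. -/
def negHom (n : ℕ) : (Fin n → ℤ) →+ (Fin n → ℤ) := negAddMonoidHom

theorem act_emb_perm {n : ℕ} (w : Equiv.Perm (Fin n)) (f : MvPolynomial (Fin n) (Polynomial ℚ)) :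
    act (permHom w) (emb n f) = emb n (rename w f) := by
  induction f using MvPolynomial.induction_on with
  | C a => rw [rename_C, emb_C, act_paramHom]
  | add p q hp hq => simp only [map_add, hp, hq]
  | mul_X p i hp =>
    rw [map_mul, map_mul, map_mul, map_mul, hp, rename_X, emb_X, emb_X, act_mon, permHom_single]

theorem cf_zero_act {n : ℕ} (e : (Fin n → ℤ) →+ (Fin n → ℤ)) (he : Function.Injective e)
    (f : Laurent n) : cf 0 (act e f) = cf 0 f := by
  conv_lhs => rw [← map_zero e]
  exact cf_act e he 0 f

theorem act_act_neg {n : ℕ} (e : (Fin n → ℤ) →+ (Fin n → ℤ)) (f : Laurent n) :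
    act e (act (negHom n) f) = act (negHom n) (act e f) := by
  ext k : 1
  simp only [act, PowerSeries.coeff_map]
  induction PowerSeries.coeff k f using AddMonoidAlgebra.induction_linear with
  | zero => simp
  | add p q hp hq => simp only [map_add, hp, hq]
  | single v a =>
    simp only [AddMonoidAlgebra.mapDomainRingHom_apply, AddMonoidAlgebra.mapDomain_single]
    exact congrArg (fun z => AddMonoidAlgebra.single z a) (map_neg e v)

theorem act_neg_neg {n : ℕ} (f : Laurent n) : act (negHom n) (act (negHom n) f) = f := by
  ext k : 1
  simp only [act, PowerSeries.coeff_map]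
  induction PowerSeries.coeff k f using AddMonoidAlgebra.induction_linear with
  | zero => simp
  | add p q hp hq => simp only [map_add, hp, hq]
  | single v a =>
    simp only [AddMonoidAlgebra.mapDomainRingHom_apply, AddMonoidAlgebra.mapDomain_single]
    exact congrArg (fun z => AddMonoidAlgebra.single z a) (neg_neg v)

/-- The weight function of the Hall-Littlewood scalar product. -/
noncomputable def weight (n : ℕ) : Laurent n :=
  ∏ p ∈ Finset.univ.filter (fun p : Fin n × Fin n => p.1 ≠ p.2), geom (root p)

theorem act_neg_geom_root {n : ℕ} (p : Fin n × Fin n) :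
    act (negHom n) (geom (root p)) = geom (root p.swap) := by
  rw [act_geom]
  congr 1
  exact neg_sub _ _

theorem act_perm_weight {n : ℕ} (w : Equiv.Perm (Fin n)) :
    act (permHom w) (weight n) = weight n := by
  rw [weight, map_prod]
  refine Finset.prod_equiv (Equiv.prodCongr w w) (fun p => by simp) fun p _ => ?_
  rw [act_geom, root, map_sub, permHom_single, permHom_single]
  rfl

theorem act_neg_weight (n : ℕ) : act (negHom n) (weight n) = weight n := by
  rw [weight, map_prod]
  refine Finset.prod_equiv (Equiv.prodComm _ _) (fun p => by simp [eq_comm]) fun p _ => ?_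
  exact act_neg_geom_root p

theorem weight_eq (n : ℕ) : weight n = act (negHom n) (geomLT n) * geomLT n := by
  have h : act (negHom n) (geomLT n) =
      ∏ p ∈ Finset.univ.filter (fun p : Fin n × Fin n => p.2 < p.1), geom (root p) := by
    rw [geomLT, map_prod]
    refine Finset.prod_equiv (Equiv.prodComm _ _) (fun p => by simp) fun p _ => ?_
    exact act_neg_geom_root p
  rw [h, geomLT, ← Finset.prod_union]
  · refine Finset.prod_congr ?_ fun _ _ => rfl
    ext p
    simp
    omega
  · rw [Finset.disjoint_left]
    intro p hp hq
    simp at hp hq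
    omega

/-- The scalar product of alternating polynomials. -/
noncomputable def form {n : ℕ} (f g : MvPolynomial (Fin n) (Polynomial ℚ)) : PowerSeries ℚ :=
  cf 0 (emb n f * act (negHom n) (emb n g) * weight n)

theorem form_comm {n : ℕ} (f g : MvPolynomial (Fin n) (Polynomial ℚ)) : form f g = form g f := by
  rw [form, ← cf_zero_act (negHom n) neg_injective, map_mul (act _), map_mul (act _),
    act_neg_neg, act_neg_weight,
    mul_comm (act _ _), form]

theorem form_rename {n : ℕ} (w : Equiv.Perm (Fin n))
    (f g : MvPolynomial (Fin n) (Polynomial ℚ)) : form (rename w f) (rename w g) = form f g := by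
  have hw : Function.Injective (permHom w) := fun a b h => by
    ext i
    simpa [permHom] using congrFun h (w i)
  rw [form, ← act_emb_perm, ← act_emb_perm, ← act_act_neg, form]
  conv_lhs => rw [← act_perm_weight w]
  rw [← map_mul, ← map_mul, cf_zero_act _ hw]

/-- The dominant term of the numerator of a Hall-Littlewood polynomial. -/
noncomputable def hlTerm {n : ℕ} (μ : Fin n → ℕ) : MvPolynomial (Fin n) (Polynomial ℚ) :=
  (∏ i, X i ^ μ i) * ∏ p ∈ Finset.univ.filter (fun p : Fin n × Fin n => p.1 < p.2),
    (X p.1 - C Polynomial.X * X p.2)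

theorem hlPoly_eq_sum_rename {n : ℕ} (μ : Fin n → ℕ) :
    hlPoly Polynomial.X μ = ∑ w : Equiv.Perm (Fin n),
      (Equiv.Perm.sign w : MvPolynomial (Fin n) (Polynomial ℚ)) * rename w (hlTerm μ) := by
  simp [hlPoly, hlTerm, map_prod]

theorem emb_hlTerm {n : ℕ} (μ : Fin n → ℕ) :
    emb n (hlTerm μ) * geomLT n = mon fun i => (μ i : ℤ) + stair n i := by
  have hd : (∑ p ∈ Finset.univ.filter (fun p : Fin n × Fin n => p.1 < p.2),
      (Pi.single p.1 1 : Fin n → ℤ)) = fun i => (stair n i : ℤ) := by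
    ext i
    rw [Finset.sum_apply, Finset.sum_filter, Fintype.sum_prod_type,
      Finset.sum_eq_single i _ (by simp)]
    · simp only [Pi.single_eq_same]
      rw [← Finset.sum_filter, Finset.sum_const, Finset.filter_lt_eq_Ioi, Fin.card_Ioi]
      simp [stair]
    · intro j _ hj
      refine Finset.sum_eq_zero fun k _ => ?_
      simp [hj.symm]
  have hfac : ∀ p ∈ Finset.univ.filter (fun p : Fin n × Fin n => p.1 < p.2),
      emb n (X p.1 - C Polynomial.X * X p.2) * geom (root p) = mon (Pi.single p.1 1) := by
    intro p _
    have hr : (Pi.single p.2 1 : Fin n → ℤ) = Pi.single p.1 1 + root p := by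
      rw [root, add_sub_cancel]
    have hX : paramHom n ((Polynomial.X : Polynomial ℚ) : PowerSeries ℚ) = PowerSeries.X := by
      rw [Polynomial.coe_X, paramHom, PowerSeries.map_X]
    rw [map_sub, map_mul, emb_X, emb_C, emb_X, hr, mon_add, hX]
    linear_combination mon (Pi.single p.1 1) * one_sub_mul_geom (root p)
  rw [hlTerm, map_mul, emb_prod_X_pow, map_prod, geomLT, mul_assoc, ← Finset.prod_mul_distrib,
    Finset.prod_congr rfl hfac, ← mon_sum, hd, ← mon_add]
  rfl

theorem form_hlTerm {n : ℕ} (f : MvPolynomial (Fin n) (Polynomial ℚ)) (μ : Fin n → ℕ) :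
    form f (hlTerm μ) = ((pairing Polynomial.X (μ + stair n) f : Polynomial ℚ) : PowerSeries ℚ) := by
  have h := congrArg (act (negHom n)) (emb_hlTerm μ)
  rw [map_mul, act_mon] at h
  rw [← cf_pairing, form, weight_eq, mul_assoc, ← mul_assoc (act _ _), h]
  rfl

theorem form_hlPoly {n : ℕ} (f : MvPolynomial (Fin n) (Polynomial ℚ))
    (hf : ∀ w : Equiv.Perm (Fin n), rename w f = (Equiv.Perm.sign w : MvPolynomial _ _) * f)
    (μ : Fin n → ℕ) : form f (hlPoly Polynomial.X μ) = (n.factorial : PowerSeries ℚ) *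
      ((pairing Polynomial.X (μ + stair n) f : Polynomial ℚ) : PowerSeries ℚ) := by
  have h1 : ∀ w : Equiv.Perm (Fin n), form f
      ((Equiv.Perm.sign w : MvPolynomial (Fin n) (Polynomial ℚ)) * rename w (hlTerm μ)) =
      form f (hlTerm μ) := by
    intro w
    rw [← form_rename w f (hlTerm μ), hf]
    simp only [form, map_mul, map_intCast]
    congr 1
    ring
  have h2 : form f (hlPoly Polynomial.X μ) = ∑ w : Equiv.Perm (Fin n), form f
      ((Equiv.Perm.sign w : MvPolynomial (Fin n) (Polynomial ℚ)) * rename w (hlTerm μ)) := by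
    rw [hlPoly_eq_sum_rename, form, map_sum, map_sum, Finset.mul_sum, Finset.sum_mul, map_sum]
    rfl
  rw [h2, Finset.sum_congr rfl fun w _ => h1 w, Finset.sum_const, Finset.card_univ,
    Fintype.card_perm, Fintype.card_fin, form_hlTerm, nsmul_eq_mul]

theorem rename_hlPoly {n : ℕ} (μ : Fin n → ℕ) (w : Equiv.Perm (Fin n)) :
    rename w (hlPoly Polynomial.X μ) = (Equiv.Perm.sign w : MvPolynomial (Fin n) (Polynomial ℚ)) *
      hlPoly Polynomial.X μ := by
  rw [hlPoly_eq_sum_rename, map_sum, Finset.mul_sum]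
  refine Fintype.sum_equiv (Equiv.mulLeft w) _ _ fun v => ?_
  rw [map_mul, map_intCast, rename_rename, Equiv.coe_mulLeft, Equiv.Perm.sign_mul, ← mul_assoc,
    Equiv.Perm.coe_mul, ← Int.cast_mul, ← Units.val_mul, ← mul_assoc, Int.units_mul_self, one_mul]

theorem pairing_hlPoly_comm {n : ℕ} (μ ν : Fin n → ℕ) :
    pairing Polynomial.X (μ + stair n) (hlPoly (Polynomial.X : Polynomial ℚ) ν) =
      pairing Polynomial.X (ν + stair n) (hlPoly Polynomial.X μ) := by
  have h := form_comm (hlPoly (Polynomial.X : Polynomial ℚ) ν) (hlPoly Polynomial.X μ)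
  rw [form_hlPoly _ (rename_hlPoly ν), form_hlPoly _ (rename_hlPoly μ)] at h
  have h0 : (n.factorial : PowerSeries ℚ) ≠ 0 := by
    intro h
    have := congrArg PowerSeries.constantCoeff h
    simp [Nat.factorial_ne_zero] at this
  exact Polynomial.coe_injective ℚ (mul_left_cancel₀ h0 h)

theorem pairing_hlPoly_of_ne {n : ℕ} {μ ν : Fin n → ℕ} (hμ : Antitone μ) (hν : Antitone ν)
    (h : μ ≠ ν) :
    pairing Polynomial.X (μ + stair n) (hlPoly (Polynomial.X : Polynomial ℚ) ν) = 0 := by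
  have key : ∀ {μ ν : Fin n → ℕ}, Antitone ν → toLex ν < toLex μ →
      pairing Polynomial.X (μ + stair n) (hlPoly (Polynomial.X : Polynomial ℚ) ν) = 0 := by
    intro μ ν hν hlt
    refine LexLead.pairing_eq _ ((lexLead_hlPoly _ hν).mono ?_)
    simpa using hlt
  rcases lt_or_gt_of_ne (fun e => h (toLex.injective e) : toLex μ ≠ toLex ν) with hlt | hlt
  · rw [pairing_hlPoly_comm]
    exact key hμ hlt
  · exact key hν hlt

section

variable {A : Type*} [CommRing A]

/-- Polynomials changing sign under transpositions of the letters. -/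
def IsAlternating {n : ℕ} (f : MvPolynomial (Fin n) A) : Prop :=
  ∀ w : Equiv.Perm (Fin n), rename w f = (Equiv.Perm.sign w : MvPolynomial (Fin n) A) * f

theorem isAlternating_alternant {n : ℕ} (κ : Fin n → ℕ) :
    IsAlternating (alternant (X : Fin n → MvPolynomial (Fin n) A) κ) := by
  intro w
  rw [alternant_eq_sum, map_sum, Finset.mul_sum]
  refine Fintype.sum_equiv (Equiv.mulLeft w) _ _ fun v => ?_
  rw [map_mul, map_intCast, Equiv.coe_mulLeft, Equiv.Perm.sign_mul, ← mul_assoc, ← Int.cast_mul,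
    ← Units.val_mul, ← mul_assoc, Int.units_mul_self, one_mul]
  simp [map_prod]

theorem coeff_comp_swap {n : ℕ} {f : MvPolynomial (Fin n) A} (hf : IsAlternating f) {i j : Fin n}
    (hij : i ≠ j) (β : Fin n → ℕ) :
    coeff (Finsupp.equivFunOnFinite.symm (β ∘ Equiv.swap i j)) f =
      -coeff (Finsupp.equivFunOnFinite.symm β) f := by
  have h := congrArg (coeff (Finsupp.equivFunOnFinite.symm (β ∘ Equiv.swap i j)))
    (hf (Equiv.swap i j))
  have hd : Finsupp.equivFunOnFinite.symm (β ∘ Equiv.swap i j) =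
      Finsupp.mapDomain (Equiv.swap i j) (Finsupp.equivFunOnFinite.symm β) := by
    rw [← Finsupp.equivMapDomain_eq_mapDomain]
    ext k
    simp [Finsupp.equivMapDomain_apply]
  have h0 : ((Equiv.Perm.sign (Equiv.swap i j) : ℤ) : MvPolynomial (Fin n) A) = C (-1) := by
    simp [Equiv.Perm.sign_swap hij]
  rw [h0, coeff_C_mul] at h
  conv_lhs at h => rw [hd, coeff_rename_mapDomain _ (Equiv.injective _)]
  rw [h]
  ring

theorem strictAnti_of_lex_max [IsDomain A] [CharZero A] {n : ℕ} {f : MvPolynomial (Fin n) A}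
    (hf : IsAlternating f) {β : Fin n → ℕ} (hβ : coeff (Finsupp.equivFunOnFinite.symm β) f ≠ 0)
    (hmax : ∀ κ : Fin n →₀ ℕ, coeff κ f ≠ 0 → toLex (κ : Fin n → ℕ) ≤ toLex β) :
    StrictAnti β := by
  intro i j hij
  by_contra! hle
  have h := coeff_comp_swap hf hij.ne β
  rcases hle.eq_or_lt with heq | hlt
  · have hs : β ∘ Equiv.swap i j = β := by
      ext k
      simp only [Function.comp, Equiv.swap_apply_def]
      split_ifs with h1 h2
      · rw [h1, heq]
      · rw [h2, heq]
      · rfl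
    rw [hs] at h
    exact hβ (self_eq_neg.1 h)
  · have h1 : toLex β < toLex (β ∘ Equiv.swap i j) := by
      have := Pi.lex_desc (f := β ∘ Equiv.swap i j) hij.le (by simpa using hlt)
      rwa [Function.comp_assoc, ← Equiv.coe_trans, Equiv.swap_swap, Equiv.coe_refl,
        Function.comp_id] at this
    have h2 := hmax (Finsupp.equivFunOnFinite.symm (β ∘ Equiv.swap i j))
      (by rw [h]; exact neg_ne_zero.2 hβ)
    exact absurd h1 (not_lt.2 h2)

theorem strictAnti_add_sub_le {n : ℕ} {β : Fin n → ℕ} (h : StrictAnti β) {i j : Fin n}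
    (hij : i ≤ j) : β j + ((j : ℕ) - i) ≤ β i := by
  obtain ⟨d, hd⟩ : ∃ d : ℕ, (j : ℕ) = i + d := ⟨j - i, by have : (i : ℕ) ≤ j := hij; omega⟩
  induction d generalizing j with
  | zero =>
    have : j = i := Fin.ext (by omega)
    subst this
    simp
  | succ d ih =>
    have h1 := ih (j := ⟨i + d, by omega⟩) (Fin.le_def.2 (by simp)) rfl
    have h2 : β j < β ⟨i + d, by omega⟩ := h (Fin.lt_def.2 (by simp; omega))
    simp only at h1
    omega

theorem exists_antitone_add_stair {n : ℕ} {β : Fin n → ℕ} (h : StrictAnti β) :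
    ∃ μ : Fin n → ℕ, Antitone μ ∧ β = μ + stair n := by
  refine ⟨β - stair n, fun i j hij => ?_, ?_⟩
  · have := strictAnti_add_sub_le h hij
    have hij' : (i : ℕ) ≤ j := hij
    simp only [Pi.sub_apply, stair]
    omega
  · ext i
    have := strictAnti_add_sub_le h (i := i) (j := ⟨n - 1, Nat.sub_one_lt_of_lt i.2⟩)
      (Fin.le_def.2 (Nat.le_sub_one_of_lt i.2))
    simp only [Pi.add_apply, Pi.sub_apply, stair]
    simp only at this
    omega

theorem eq_zero_of_pairing [IsDomain A] [CharZero A] (t : A) {n m : ℕ}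
    {f : MvPolynomial (Fin n) A} (hf : IsAlternating f)
    (hd : f.IsHomogeneous (m + ∑ i, stair n i))
    (h : ∀ μ : Fin n → ℕ, Antitone μ → ∑ i, μ i = m → pairing t (μ + stair n) f = 0) :
    f = 0 := by
  by_contra hne
  obtain ⟨γ, hγ, hmax⟩ := Finset.exists_max_image f.support
    (fun β => toLex (β : Fin n → ℕ)) (support_nonempty.2 hne)
  obtain ⟨β, rfl⟩ := Finsupp.equivFunOnFinite.symm.surjective γ
  rw [mem_support_iff] at hγ
  have hmax' : ∀ κ : Fin n →₀ ℕ, coeff κ f ≠ 0 → toLex (κ : Fin n → ℕ) ≤ toLex β :=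
    fun κ hκ => hmax κ (mem_support_iff.2 hκ)
  obtain ⟨μ, hμ, rfl⟩ := exists_antitone_add_stair (strictAnti_of_lex_max hf hγ hmax')
  have hsum := hd hγ
  rw [Finsupp.weight_apply, Finsupp.sum_fintype _ _ (by simp)] at hsum
  simp only [Finsupp.equivFunOnFinite_symm_apply_apply, Pi.one_apply, smul_eq_mul, mul_one, Pi.add_apply,
    Finset.sum_add_distrib] at hsum
  have h1 := h μ hμ (by omega)
  rw [LexLead.pairing_eq t ⟨hmax', rfl⟩] at h1
  exact hγ h1

theorem isHomogeneous_alternant {n : ℕ} (κ : Fin n → ℕ) :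
    (alternant (X : Fin n → MvPolynomial (Fin n) A) κ).IsHomogeneous (∑ i, κ i) := by
  rw [alternant_eq_sum]
  refine IsHomogeneous.sum _ _ _ fun w _ => ?_
  have h0 : ((Equiv.Perm.sign w : ℤ) : MvPolynomial (Fin n) A) =
      C ((Equiv.Perm.sign w : ℤ) : A) := by simp
  rw [h0]
  refine IsHomogeneous.C_mul (IsHomogeneous.prod _ _ _ fun i _ => ?_) _
  simpa using (isHomogeneous_X A (w i)).pow (κ i)

theorem isHomogeneous_hlPoly {n : ℕ} (t : A) (ν : Fin n → ℕ) :
    (hlPoly t ν).IsHomogeneous (∑ i, ν i + ∑ i, stair n i) := by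
  refine IsHomogeneous.sum _ _ _ fun w _ => ?_
  have h0 : ((Equiv.Perm.sign w : ℤ) : MvPolynomial (Fin n) A) =
      C ((Equiv.Perm.sign w : ℤ) : A) := by simp
  have hc : ∑ i, stair n i =
      ∑ p ∈ Finset.univ.filter (fun p : Fin n × Fin n => p.1 < p.2), 1 := by
    rw [Finset.sum_filter, Fintype.sum_prod_type]
    refine Finset.sum_congr rfl fun i _ => ?_
    rw [← Finset.sum_filter, Finset.sum_const, Finset.filter_lt_eq_Ioi, Fin.card_Ioi]
    simp [stair]
  rw [h0, hc]
  refine IsHomogeneous.C_mul ((IsHomogeneous.prod _ _ _ fun i _ => ?_).mul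
    (IsHomogeneous.prod _ _ _ fun p _ => ?_)) _
  · simpa using (isHomogeneous_X A (w i)).pow (ν i)
  · exact (isHomogeneous_X A _).sub ((isHomogeneous_X A _).C_mul t)

theorem IsAlternating.sub {n : ℕ} {f g : MvPolynomial (Fin n) A} (hf : IsAlternating f)
    (hg : IsAlternating g) : IsAlternating (f - g) := fun w => by
  rw [map_sub, hf w, hg w, mul_sub]

theorem IsAlternating.C_mul {n : ℕ} {f : MvPolynomial (Fin n) A} (hf : IsAlternating f) (a : A) :
    IsAlternating (C a * f) := fun w => by
  rw [map_mul, hf w, rename_C, mul_left_comm]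

theorem IsAlternating.sum {n : ℕ} {ι : Type*} (s : Finset ι) {f : ι → MvPolynomial (Fin n) A}
    (hf : ∀ i ∈ s, IsAlternating (f i)) : IsAlternating (∑ i ∈ s, f i) := fun w => by
  rw [map_sum, Finset.mul_sum]
  exact Finset.sum_congr rfl fun i hi => hf i hi w

theorem pairing_C_mul (t : A) {n : ℕ} (γ : Fin n → ℕ) (a : A) (f : MvPolynomial (Fin n) A) :
    pairing t γ (C a * f) = a * pairing t γ f := by
  rw [← smul_eq_C_mul, map_smul, smul_eq_mul]

end

theorem pairing_hlPoly_self {n B : ℕ} {ν : Fin n → ℕ} (hν : Antitone ν) (hB : ∀ a, ν a < B) :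
    pairing Polynomial.X (ν + stair n) (hlPoly (Polynomial.X : Polynomial ℚ) ν) =
      ∏ i ∈ Finset.range B, ∏ j ∈ Finset.range (Finset.univ.filter fun a => ν a = i).card,
        ∑ k ∈ Finset.range (j + 1), Polynomial.X ^ k := by
  rw [(lexLead_hlPoly _ hν).pairing_eq, sum_stabilizer _ hν hB]

theorem sum_pow_ne_zero (j : ℕ) :
    (∑ k ∈ Finset.range (j + 1), Polynomial.X ^ k : Polynomial ℚ) ≠ 0 := by
  intro h
  have := congrArg (Polynomial.eval 1) h
  simp only [Polynomial.eval_finsetSum, Polynomial.eval_pow, Polynomial.eval_X, one_pow,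
    Finset.sum_const, Finset.card_range, nsmul_eq_mul, mul_one, Polynomial.eval_zero] at this
  exact absurd this (by positivity)

theorem alternant_expansion {n m : ℕ} {ι : Type*} [Fintype ι] [DecidableEq ι]
    {p : ι → Fin n → ℕ} (hinj : Function.Injective p) (hanti : ∀ i, Antitone (p i))
    (hsum : ∀ i, ∑ a, p i a = m)
    (hsurj : ∀ μ : Fin n → ℕ, Antitone μ → ∑ a, μ a = m → ∃ i, p i = μ)
    {v : ι → Polynomial ℚ}
    (hv : ∀ i, pairing Polynomial.X (p i + stair n) (hlPoly (Polynomial.X : Polynomial ℚ) (p i)) =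
      v i) {f : MvPolynomial (Fin n) (Polynomial ℚ)} (hf : IsAlternating f)
    (hd : f.IsHomogeneous (m + ∑ i, stair n i)) :
    C (∏ i, v i) * f = ∑ i, C (pairing Polynomial.X (p i + stair n) f *
      ∏ j ∈ Finset.univ.erase i, v j) * hlPoly Polynomial.X (p i) := by
  rw [← sub_eq_zero]
  refine eq_zero_of_pairing (m := m) Polynomial.X ?_ ?_ ?_
  · exact (hf.C_mul _).sub (IsAlternating.sum _ fun i _ =>
      IsAlternating.C_mul (rename_hlPoly (p i)) _)
  · refine (hd.C_mul _).sub (IsHomogeneous.sum _ _ _ fun i _ => ?_)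
    have := isHomogeneous_hlPoly (Polynomial.X : Polynomial ℚ) (p i)
    rw [hsum] at this
    exact this.C_mul _
  · intro μ hμ hμm
    obtain ⟨k, rfl⟩ := hsurj μ hμ hμm
    rw [map_sub, map_sum, pairing_C_mul, Finset.sum_eq_single k, pairing_C_mul, hv,
      ← Finset.mul_prod_erase _ _ (Finset.mem_univ k)]
    · ring
    · intro i _ hik
      rw [pairing_C_mul, pairing_hlPoly_of_ne hμ (hanti i) fun e => hik (hinj e).symm, mul_zero]
    · intro h
      exact absurd (Finset.mem_univ _) h

theorem partsFn_eq_pad (l : ℕ) (lam : Nat.Partition l) :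
    partsFn l lam = pad l (lam.parts.sort (· ≥ ·)) := rfl

theorem length_sort_parts_le {l : ℕ} (lam : Nat.Partition l) :
    (lam.parts.sort (· ≥ ·)).length ≤ l := by
  rw [Multiset.length_sort]
  have h := Multiset.card_nsmul_le_sum (s := lam.parts) (a := 1) fun x hx => lam.parts_pos hx
  rw [lam.parts_sum] at h
  simpa using h

theorem antitone_pad (n : ℕ) {μ : List ℕ} (h : μ.Pairwise (· ≥ ·)) : Antitone (pad n μ) := by
  intro i j hij
  simp only [pad]
  by_cases hj : (j : ℕ) < μ.length
  · have hi : (i : ℕ) < μ.length := lt_of_le_of_lt hij hj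
    rw [List.getD_eq_getElem _ _ hj, List.getD_eq_getElem _ _ hi]
    rcases (show (i : ℕ) ≤ j from hij).eq_or_lt with he | hlt
    · exact (getElem_congr_idx he.symm).le
    · exact List.pairwise_iff_getElem.1 h i j hi hj hlt
  · rw [List.getD_eq_default _ _ (not_lt.1 hj)]
    exact Nat.zero_le _

theorem antitone_partsFn {l : ℕ} (lam : Nat.Partition l) : Antitone (partsFn l lam) :=
  antitone_pad l (Multiset.pairwise_sort _ _)

theorem ofFn_pad {n : ℕ} {μ : List ℕ} (h : μ.length ≤ n) :
    List.ofFn (pad n μ) = μ ++ List.replicate (n - μ.length) 0 := by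
  refine List.ext_getElem (by simp; omega) fun i h1 h2 => ?_
  rw [List.getElem_ofFn, pad]
  by_cases hi : i < μ.length
  · rw [List.getElem_append_left hi, List.getD_eq_getElem _ _ hi]
  · rw [List.getElem_append_right (not_lt.1 hi), List.getElem_replicate,
      List.getD_eq_default _ _ (not_lt.1 hi)]

theorem coe_ofFn_partsFn {l : ℕ} (lam : Nat.Partition l) :
    (List.ofFn (partsFn l lam) : Multiset ℕ) =
      lam.parts + Multiset.replicate (l - Multiset.card lam.parts) 0 := by
  rw [partsFn_eq_pad, ofFn_pad (length_sort_parts_le lam), ← Multiset.coe_add, Multiset.sort_eq,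
    Multiset.length_sort, Multiset.coe_replicate]

theorem sum_partsFn {l : ℕ} (lam : Nat.Partition l) : ∑ i, partsFn l lam i = l := by
  rw [← List.sum_ofFn, ← Multiset.sum_coe, coe_ofFn_partsFn, Multiset.sum_add, lam.parts_sum]
  simp

theorem partsFn_injective (l : ℕ) : Function.Injective (partsFn l) := by
  intro lam sig h
  have h1 := congrArg (fun f => Multiset.filter (· ≠ 0) (List.ofFn f : Multiset ℕ)) h
  have h2 : ∀ lam : Nat.Partition l,
      Multiset.filter (· ≠ 0) (List.ofFn (partsFn l lam) : Multiset ℕ) = lam.parts := by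
    intro lam
    rw [coe_ofFn_partsFn, Multiset.filter_add, Multiset.filter_eq_self.2, Multiset.filter_eq_nil.2,
      add_zero]
    · intro x hx
      simpa using Multiset.eq_of_mem_replicate hx
    · intro x hx
      exact (lam.parts_pos hx).ne'
  simp only [h2] at h1
  exact Nat.Partition.ext h1

theorem eq_of_antitone_of_coe_ofFn {n : ℕ} {f g : Fin n → ℕ} (hf : Antitone f) (hg : Antitone g)
    (h : (List.ofFn f : Multiset ℕ) = List.ofFn g) : f = g := by
  refine List.ofFn_injective (List.Perm.eq_of_pairwise (le := (· ≥ ·)) ?_ ?_ ?_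
    (Multiset.coe_eq_coe.1 h))
  · intro a b _ _ h1 h2
    exact le_antisymm h2 h1
  · exact List.pairwise_ofFn.2 fun i j hij => hf hij.le
  · exact List.pairwise_ofFn.2 fun i j hij => hg hij.le

theorem exists_partsFn_eq {l : ℕ} {μ : Fin l → ℕ} (hμ : Antitone μ) (hs : ∑ i, μ i = l) :
    ∃ lam : Nat.Partition l, partsFn l lam = μ := by
  have hs' : (List.ofFn μ : Multiset ℕ).sum = l := by
    rw [Multiset.sum_coe, List.sum_ofFn, hs]
  refine ⟨Nat.Partition.ofSums l _ hs', eq_of_antitone_of_coe_ofFn (antitone_partsFn _) hμ ?_⟩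
  rw [coe_ofFn_partsFn, Nat.Partition.ofSums_parts]
  have h1 := Multiset.filter_add_not (· ≠ 0) (List.ofFn μ : Multiset ℕ)
  have h2 : Multiset.filter (fun a => ¬ a ≠ 0) (List.ofFn μ : Multiset ℕ) =
      Multiset.replicate (Multiset.card (Multiset.filter (fun a => ¬ a ≠ 0)
        (List.ofFn μ : Multiset ℕ))) 0 :=
    Multiset.eq_replicate_card.2 fun b hb => by simpa using (Multiset.mem_filter.1 hb).2
  have h3 := congrArg Multiset.card h1
  rw [Multiset.card_add, Multiset.coe_card, List.length_ofFn] at h3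
  rw [h2] at h1
  conv_rhs => rw [← h1]
  congr 2
  omega

theorem schurNum_eq (l : ℕ) (lam : Nat.Partition l) :
    schurNum l lam = alternant X (partsFn l lam + stair l) := by
  rw [schurNum, altSum, alternant_eq_sum]
  refine Finset.sum_congr rfl fun w _ => ?_
  rw [zsmul_eq_mul, map_prod]
  simp [stair]

theorem hlNum_eq (l : ℕ) (lam : Nat.Partition l) :
    hlNum l lam = hlPoly Polynomial.X (partsFn l lam) := by
  rw [hlNum, altSum, hlPoly]
  refine Finset.sum_congr rfl fun w _ => ?_
  rw [zsmul_eq_mul, map_mul, map_prod, map_prod]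
  simp

theorem partsFn_lt {l : ℕ} (lam : Nat.Partition l) (a : Fin l) : partsFn l lam a < l + 1 := by
  have := Finset.single_le_sum (f := partsFn l lam) (fun _ _ => Nat.zero_le _) (Finset.mem_univ a)
  rw [sum_partsFn] at this
  omega

theorem vHL_ne_zero (l : ℕ) (lam : Nat.Partition l) : vHL l lam ≠ 0 :=
  Finset.prod_ne_zero_iff.2 fun _ _ => Finset.prod_ne_zero_iff.2 fun j _ => sum_pow_ne_zero j

/-- The pairing of a Schur numerator with a Hall-Littlewood numerator. -/
noncomputable def kostkaFoulkes (l : ℕ) (lam sig : Nat.Partition l) : Rnu :=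
  pairing Polynomial.X (partsFn l sig + stair l) (schurNum l lam)

theorem schurNum_expansion (l : ℕ) (lam : Nat.Partition l) :
    algebraMap (SymA l) (FractionRing (SymA l)) (schurNum l lam)
      = ∑ sig : Nat.Partition l,
          algebraMap (SymA l) (FractionRing (SymA l)) (C (kostkaFoulkes l lam sig)) *
            algebraMap (SymA l) (FractionRing (SymA l)) (hlNum l sig) /
              algebraMap (SymA l) (FractionRing (SymA l)) (C (vHL l sig)) := by
  classical
  have hd : (schurNum l lam).IsHomogeneous (l + ∑ i, stair l i) := by
    have := isHomogeneous_alternant (A := Rnu) (partsFn l lam + stair l)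
    rw [schurNum_eq]
    simpa only [Pi.add_apply, Finset.sum_add_distrib, sum_partsFn] using this
  have h := alternant_expansion (partsFn_injective l) antitone_partsFn sum_partsFn
    (fun μ hμ hs => exists_partsFn_eq hμ hs) (v := vHL l)
    (fun i => pairing_hlPoly_self (antitone_partsFn i) (partsFn_lt i))
    (f := schurNum l lam) (by rw [schurNum_eq]; exact isAlternating_alternant _) hd
  have hinj := IsFractionRing.injective (SymA l) (FractionRing (SymA l))
  have hne : ∀ a : Rnu, a ≠ 0 → algebraMap (SymA l) (FractionRing (SymA l)) (C a) ≠ 0 := by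
    intro a ha
    rw [Ne, map_eq_zero_iff _ hinj, map_eq_zero_iff _ (C_injective _ _)]
    exact ha
  have hV : ∏ sig, vHL l sig ≠ 0 := Finset.prod_ne_zero_iff.2 fun sig _ => vHL_ne_zero l sig
  refine mul_left_cancel₀ (hne _ hV) ?_
  rw [← map_mul, h, map_sum, Finset.mul_sum]
  refine Finset.sum_congr rfl fun sig _ => ?_
  rw [← Finset.mul_prod_erase _ _ (Finset.mem_univ sig), ← mul_div_assoc,
    eq_div_iff (hne _ (vHL_ne_zero l sig)), hlNum_eq, kostkaFoulkes]
  simp only [map_mul]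
  ring

theorem kostkaFoulkes_eq_kostka (n : ℕ) (lam sig : Nat.Partition (n + 1)) :
    kostkaFoulkes (n + 1) lam sig =
      kostka n Polynomial.X (sig.parts.sort (· ≥ ·)) (partsFn (n + 1) lam) := by
  rw [kostkaFoulkes, schurNum_eq, partsFn_eq_pad (n + 1) sig]
  exact pairing_alternant _ (Multiset.pairwise_sort _ _) (length_sort_parts_le sig)
    (antitone_partsFn lam)

theorem kostkaFoulkes_self (l : ℕ) (lam : Nat.Partition l) : kostkaFoulkes l lam lam = 1 := by
  rw [kostkaFoulkes, schurNum_eq]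
  exact (lexLead_alternant (strictAnti_add_stair (antitone_partsFn lam))).pairing_eq _

theorem coeff_kostka (n : ℕ) (μ : List ℕ) (ν : Fin (n + 1) → ℕ) (i : ℕ) :
    ∃ c : ℕ, (kostka n (Polynomial.X : Polynomial ℚ) μ ν).coeff i = (c : ℚ) := by
  classical
  refine ⟨∑ M ∈ configs n μ with firstBad n 0 M = none ∧ wt n M = ν,
    if i = (energy n M).toNat then 1 else 0, ?_⟩
  rw [kostka, Polynomial.finsetSum_coeff, Nat.cast_sum]
  refine Finset.sum_congr (by congr) fun M _ => ?_
  rw [Polynomial.coeff_X_pow, Nat.cast_ite, Nat.cast_one, Nat.cast_zero]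

theorem sum_take_eq_sum_range (μ : List ℕ) (k : ℕ) :
    (μ.take k).sum = ∑ i ∈ Finset.range k, μ.getD i 0 := by
  induction k generalizing μ with
  | zero => simp
  | succ k ih =>
    cases μ with
    | nil => simp
    | cons a μ => simp [Finset.sum_range_succ', ih, add_comm]

theorem domLE_of_kostka_ne_zero {n : ℕ} {lam sig : Nat.Partition (n + 1)}
    (h : kostka n (Polynomial.X : Polynomial ℚ) (sig.parts.sort (· ≥ ·)) (partsFn (n + 1) lam) ≠ 0) :
    domLE (n + 1) sig lam := by
  classical
  obtain ⟨M, hM, -⟩ := Finset.exists_ne_zero_of_sum_ne_zero h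
  obtain ⟨hM, hb, hw⟩ := Finset.mem_filter.1 hM
  rw [mem_configs] at hM
  intro k
  rcases le_or_gt k (n + 1) with hk | hk
  · have h1 := take_sum_le hM (c := 0) (d := 0) hb (fun _ => le_rfl) (fun _ _ _ => rfl) k (by omega)
    rw [sum_take_eq_sum_range (lam.parts.sort (· ≥ ·))]
    have h2 : ∑ s ∈ Finset.range (0 + k), count s M =
        ((∑ i ∈ Finset.range k, (lam.parts.sort (· ≥ ·)).getD i 0 : ℕ) : ℤ) := by
      rw [zero_add, Nat.cast_sum]
      refine Finset.sum_congr rfl fun s hs => ?_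
      have hs' : s < n + 1 := (Finset.mem_range.1 hs).trans_le hk
      have h3 := congrFun hw ⟨s, hs'⟩
      rw [wt] at h3
      rw [← Int.toNat_of_nonneg (count_nonneg hM.isCol s), h3]
      rfl
    rw [h2] at h1
    exact_mod_cast h1
  · have h1 : (lam.parts.sort (· ≥ ·)).take k = lam.parts.sort (· ≥ ·) :=
      List.take_of_length_le ((length_sort_parts_le lam).trans hk.le)
    have h2 : (sig.parts.sort (· ≥ ·)).take k = sig.parts.sort (· ≥ ·) :=
      List.take_of_length_le ((length_sort_parts_le sig).trans hk.le)
    have h3 : ∀ lam : Nat.Partition (n + 1), (lam.parts.sort (· ≥ ·)).sum = n + 1 := by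
      intro lam
      rw [← Multiset.sum_coe, Multiset.sort_eq, lam.parts_sum]
    rw [h1, h2, h3, h3]

end KostkaFoulkes

/-- **Kostka–Foulkes polynomials via the Jordan quiver / nilpotent cone.**
In the ring of symmetric functions over `ℚ(ν)` the Schur functions expand in Hall–Littlewood
polynomials, `s_λ = Σ_σ K_{λσ}(ν) P_σ(ν)` (here written after clearing the common Vandermonde
denominator, `a_{λ+δ} = Σ_σ K_{λσ}(ν) · hlNum(σ)/v_σ(ν)` in the fraction field); the
transition coefficients `K_{λσ}` are the Kostka–Foulkes polynomials: they have nonnegative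
integer coefficients, vanish unless `σ ⪯ λ` in dominance order, and `K_{λλ} = 1`. -/
theorem stmt_17 (l : ℕ) :
    ∃ K : Nat.Partition l → Nat.Partition l → Rnu,
      (∀ lam : Nat.Partition l,
        algebraMap (SymA l) (FractionRing (SymA l)) (schurNum l lam)
          = ∑ sig : Nat.Partition l,
              algebraMap (SymA l) (FractionRing (SymA l)) (C (K lam sig)) *
                algebraMap (SymA l) (FractionRing (SymA l)) (hlNum l sig) /
                  algebraMap (SymA l) (FractionRing (SymA l)) (C (vHL l sig))) ∧
      (∀ lam sig, ∀ i : ℕ, ∃ c : ℕ, (K lam sig).coeff i = (c : ℚ)) ∧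
      (∀ lam sig, ¬ domLE l sig lam → K lam sig = 0) ∧
      (∀ lam, K lam lam = 1) := by
  refine ⟨KostkaFoulkes.kostkaFoulkes l, KostkaFoulkes.schurNum_expansion l, ?_, ?_,
    KostkaFoulkes.kostkaFoulkes_self l⟩
  · intro lam sig i
    cases l with
    | zero =>
      obtain rfl : lam = sig := Subsingleton.elim _ _
      refine ⟨if i = 0 then 1 else 0, ?_⟩
      rw [KostkaFoulkes.kostkaFoulkes_self, Polynomial.coeff_one]
      split_ifs <;> simp
    | succ n =>
      rw [KostkaFoulkes.kostkaFoulkes_eq_kostka]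
      exact KostkaFoulkes.coeff_kostka n _ _ i
  · intro lam sig h
    cases l with
    | zero =>
      obtain rfl : lam = sig := Subsingleton.elim _ _
      exact absurd (fun _ => le_rfl) h
    | succ n =>
      by_contra hne
      rw [KostkaFoulkes.kostkaFoulkes_eq_kostka] at hne
      exact h (KostkaFoulkes.domLE_of_kostka_ne_zero hne)
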